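/- If (μ_t, ν_t)_{t∈[0,T]} is the unique solution to the coupled nonlinear-linear Fokker-Planck-Kolmogorov system (9) with initial condition (μ̄, ν̄) ∈ P×P, and moreover (μ_t) is the unique vaguely continuous subprobability solution to (NLFPK) with initial condition μ̄, then the curve (ν_t × δ_{μ_t})_{t∈[0,T]} of product measures on ℝ^d×P is the unique weakly continuous solution to the linearized continuity equation (10) on ℝ^d×P with initial condition ν̄ × δ_{μ̄}. -/

import Mathlib

open MeasureTheory Topology Filter

noncomputable section

/-- Euclidean space `ℝ^d`. -/
abbrev Rd (d : ℕ) := Fin d → ℝ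

/-- The space of subprobability measures on `ℝ^d`. -/
def SP (d : ℕ) : Type := {μ : Measure (Rd d) // μ Set.univ ≤ 1}

/-- The vague topology on `SP d`: the initial topology of the maps `μ ↦ ∫ g dμ` for
`g : ℝ^d → ℝ` continuous with compact support. -/
instance (d : ℕ) : TopologicalSpace (SP d) :=
  ⨅ g : {g : Rd d → ℝ // Continuous g ∧ HasCompactSupport g},
    TopologicalSpace.induced (fun μ : SP d => ∫ x, g.1 x ∂μ.1) inferInstance

instance (d : ℕ) : MeasurableSpace (SP d) := borel (SP d)
instance (d : ℕ) : BorelSpace (SP d) := ⟨rfl⟩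

/-- First-order partial derivative `∂_i f`. -/
def pd {n : ℕ} (f : (Fin n → ℝ) → ℝ) (i : Fin n) (x : Fin n → ℝ) : ℝ :=
  fderiv ℝ f x (Pi.single i 1)

/-- Second-order partial derivative `∂²_{ij} f`. -/
def pd2 {n : ℕ} (f : (Fin n → ℝ) → ℝ) (i j : Fin n) (x : Fin n → ℝ) : ℝ :=
  fderiv ℝ (fun y => pd f j y) x (Pi.single i 1)

/-- Twice continuously differentiable with compact support. -/
def IsC2c {n : ℕ} (φ : (Fin n → ℝ) → ℝ) : Prop :=
  ContDiff ℝ 2 φ ∧ HasCompactSupport φ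

/-- Twice continuously differentiable, bounded, with bounded first and second order
partial derivatives. -/
def IsC2b {n : ℕ} (f : (Fin n → ℝ) → ℝ) : Prop :=
  ContDiff ℝ 2 f ∧ ∃ M : ℝ, ∀ x, |f x| ≤ M ∧ (∀ i, |pd f i x| ≤ M) ∧ ∀ i j, |pd2 f i j x| ≤ M

/-- Borel coefficients, with `a` symmetric and positive semidefinite (`S⁺_d`-valued). -/
def GoodCoeffs (d : ℕ) (a : ℝ → SP d → Rd d → Fin d → Fin d → ℝ)
    (b : ℝ → SP d → Rd d → Fin d → ℝ) : Prop :=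
  (∀ i j, Measurable fun p : ℝ × SP d × Rd d => a p.1 p.2.1 p.2.2 i j) ∧
  (∀ i, Measurable fun p : ℝ × SP d × Rd d => b p.1 p.2.1 p.2.2 i) ∧
  (∀ t μ x i j, a t μ x i j = a t μ x j i) ∧
  (∀ t μ x (v : Fin d → ℝ), 0 ≤ ∑ i, ∑ j, v i * a t μ x i j * v j)

/-- The Kolmogorov operator `L_{t,μ}φ = ∑ a_ij ∂²_ij φ + ∑ b_i ∂_i φ`. -/
def Lop {d : ℕ} (a : ℝ → SP d → Rd d → Fin d → Fin d → ℝ)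
    (b : ℝ → SP d → Rd d → Fin d → ℝ) (t : ℝ) (μ : SP d) (φ : Rd d → ℝ) (x : Rd d) : ℝ :=
  (∑ i, ∑ j, a t μ x i j * pd2 φ i j x) + ∑ i, b t μ x i * pd φ i x

/-- Global integrability condition for (NLFPK). -/
def NLFPKIntegrable (d : ℕ) (T : ℝ) (a : ℝ → SP d → Rd d → Fin d → Fin d → ℝ)
    (b : ℝ → SP d → Rd d → Fin d → ℝ) (μ : ℝ → SP d) : Prop :=
  ∀ i j, ∫⁻ t in Set.Ioc (0:ℝ) T,
      ∫⁻ x, ENNReal.ofReal (|a t (μ t) x i j| + |b t (μ t) x i|) ∂(μ t).1 < ⊤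

/-- The weak form of the nonlinear FPK equation, tested against `φ` at time `t`. -/
def NLFPKEq (d : ℕ) (a : ℝ → SP d → Rd d → Fin d → Fin d → ℝ)
    (b : ℝ → SP d → Rd d → Fin d → ℝ) (μ : ℝ → SP d) (φ : Rd d → ℝ) (t : ℝ) : Prop :=
  ∫ x, φ x ∂(μ t).1 - ∫ x, φ x ∂(μ 0).1 = ∫ s in (0:ℝ)..t, ∫ x, Lop a b s (μ s) φ x ∂(μ s).1

/-- Subprobability solution to (NLFPK): a vaguely continuous, globally integrable curve
in `SP` satisfying the weak equation for all test functions in `C²_c(ℝ^d)`. -/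
def IsSubprobSolution (d : ℕ) (T : ℝ) (a : ℝ → SP d → Rd d → Fin d → Fin d → ℝ)
    (b : ℝ → SP d → Rd d → Fin d → ℝ) (μ : ℝ → SP d) : Prop :=
  ContinuousOn μ (Set.Icc 0 T) ∧ NLFPKIntegrable d T a b μ ∧
  ∀ φ : Rd d → ℝ, IsC2c φ → ∀ t ∈ Set.Icc (0:ℝ) T, NLFPKEq d a b μ φ t

/-- Weak continuity (in duality with bounded continuous functions) of a curve in `SP`. -/
def WeaklyContinuousOn {d : ℕ} (μ : ℝ → SP d) (s : Set ℝ) : Prop :=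
  ∀ f : Rd d → ℝ, Continuous f → (∃ M, ∀ x, |f x| ≤ M) →
    ContinuousOn (fun t => ∫ x, f x ∂(μ t).1) s

/-- Probability solution to (NLFPK): a weakly continuous solution consisting of
probability measures. -/
def IsProbSolution (d : ℕ) (T : ℝ) (a : ℝ → SP d → Rd d → Fin d → Fin d → ℝ)
    (b : ℝ → SP d → Rd d → Fin d → ℝ) (μ : ℝ → SP d) : Prop :=
  IsSubprobSolution d T a b μ ∧ (∀ t ∈ Set.Icc (0:ℝ) T, (μ t).1 Set.univ = 1) ∧
  WeaklyContinuousOn μ (Set.Icc 0 T)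

/-- `φ` and `ψ` are uniformly `ε`-close, together with their first and second order
partial derivatives (closeness in the `C²_b` norm). -/
def C2Close {n : ℕ} (φ ψ : (Fin n → ℝ) → ℝ) (ε : ℝ) : Prop :=
  (∀ x, |φ x - ψ x| ≤ ε) ∧ (∀ i x, |pd φ i x - pd ψ i x| ≤ ε) ∧
  ∀ i j x, |pd2 φ i j x - pd2 ψ i j x| ≤ ε

/-- A countable family `g i ∈ C²_c(ℝ^d) \ {0}` which is dense in `C²_c(ℝ^d)` with respect
to the `C²_b` norm. -/
def GFamily (d : ℕ) (g : ℕ → Rd d → ℝ) : Prop :=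
  (∀ i, IsC2c (g i)) ∧ (∀ i, g i ≠ 0) ∧
  ∀ φ : Rd d → ℝ, IsC2c φ → ∀ ε : ℝ, 0 < ε → ∃ i, C2Close (g i) φ ε

/-- The global chart `G : SP → ℝ^∞`, `G(μ) = (μ(g_i))_i`. -/
def Gmap {d : ℕ} (g : ℕ → Rd d → ℝ) (μ : SP d) : ℕ → ℝ := fun i => ∫ x, g i x ∂μ.1

/-- `F(μ) = f(μ(g_1),…,μ(g_n))`, a typical element of `FC²_b(G)`. -/
def Fof {d : ℕ} (g : ℕ → Rd d → ℝ) {n : ℕ} (f : (Fin n → ℝ) → ℝ) (μ : SP d) : ℝ :=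
  f fun k : Fin n => ∫ x, g k x ∂μ.1

/-- The action `𝐋_t F(μ) = ⟨∇^{SP} F(μ), b(t,μ) + a(t,μ)∇⟩_{L²(μ)}` of the linearized
operator on `F(μ) = f(μ(g_1),…,μ(g_n)) ∈ FC²_b(G)`. -/
def bL {d : ℕ} (a : ℝ → SP d → Rd d → Fin d → Fin d → ℝ)
    (b : ℝ → SP d → Rd d → Fin d → ℝ) (g : ℕ → Rd d → ℝ) {n : ℕ}
    (f : (Fin n → ℝ) → ℝ) (t : ℝ) (μ : SP d) : ℝ :=
  ∑ k : Fin n, pd f k (fun l : Fin n => ∫ x, g l x ∂μ.1) * ∫ x, Lop a b t μ (g k) x ∂μ.1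

/-- Weak continuity of a curve of Borel measures on `SP`. -/
def WeaklyContinuousMeasOn {d : ℕ} (Γ : ℝ → Measure (SP d)) (s : Set ℝ) : Prop :=
  ∀ F : SP d → ℝ, Continuous F → (∃ M, ∀ μ, |F μ| ≤ M) →
    ContinuousOn (fun t => ∫ μ, F μ ∂(Γ t)) s

/-- Weakly continuous solution to the linearized continuity equation (SP-CE) on `P(SP)`. -/
def IsSPCESolution (d : ℕ) (T : ℝ) (a : ℝ → SP d → Rd d → Fin d → Fin d → ℝ)
    (b : ℝ → SP d → Rd d → Fin d → ℝ) (g : ℕ → Rd d → ℝ)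
    (Γ : ℝ → Measure (SP d)) : Prop :=
  (∀ t ∈ Set.Icc (0:ℝ) T, IsProbabilityMeasure (Γ t)) ∧
  WeaklyContinuousMeasOn Γ (Set.Icc 0 T) ∧
  (∫⁻ t in Set.Ioc (0:ℝ) T, ∫⁻ μ : SP d,
      (∫⁻ x, ENNReal.ofReal ((∑ i, |b t μ x i|) + ∑ i, ∑ j, |a t μ x i j|) ∂μ.1) ∂(Γ t) < ⊤) ∧
  ∀ (n : ℕ) (f : (Fin n → ℝ) → ℝ), IsC2b f → ∀ t ∈ Set.Icc (0:ℝ) T,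
    ∫ μ, Fof g f μ ∂(Γ t) - ∫ μ, Fof g f μ ∂(Γ 0) =
      ∫ s in (0:ℝ)..t, ∫ μ, bL a b g f s μ ∂(Γ s)

/-- Solution of the linear FPK equation `∂_t ν_t = L*_{t,μ_t} ν_t` (the second component
of the coupled system (9)), with the solution `(μ_t)` of (NLFPK) frozen in the
nonlinearity spot. -/
def IsLinearizedSolution (d : ℕ) (T : ℝ) (a : ℝ → SP d → Rd d → Fin d → Fin d → ℝ)
    (b : ℝ → SP d → Rd d → Fin d → ℝ) (μ ν : ℝ → SP d) : Prop :=
  (∀ t ∈ Set.Icc (0:ℝ) T, (ν t).1 Set.univ = 1) ∧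
  WeaklyContinuousOn ν (Set.Icc 0 T) ∧
  (∀ i j, ∫⁻ t in Set.Ioc (0:ℝ) T,
      ∫⁻ x, ENNReal.ofReal (|a t (μ t) x i j| + |b t (μ t) x i|) ∂(ν t).1 < ⊤) ∧
  ∀ φ : Rd d → ℝ, IsC2c φ → ∀ t ∈ Set.Icc (0:ℝ) T,
    ∫ x, φ x ∂(ν t).1 - ∫ x, φ x ∂(ν 0).1 =
      ∫ s in (0:ℝ)..t, ∫ x, Lop a b s (μ s) φ x ∂(ν s).1

/-- Solution of the coupled nonlinear-linear FPK system (9) with initial condition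
`(μ̄, ν̄)`. -/
def IsCoupledSolution (d : ℕ) (T : ℝ) (a : ℝ → SP d → Rd d → Fin d → Fin d → ℝ)
    (b : ℝ → SP d → Rd d → Fin d → ℝ) (μbar νbar : SP d) (μ ν : ℝ → SP d) : Prop :=
  IsProbSolution d T a b μ ∧ μ 0 = μbar ∧
  IsLinearizedSolution d T a b μ ν ∧ ν 0 = νbar

/-- Weakly continuous solution to the continuity equation (10) on `ℝ^d × P`, for curves of
Borel probability measures on `ℝ^d × SP` concentrated on `ℝ^d × P`, tested against the
products `Φ(x,μ) = φ(x)F(μ)`, `φ ∈ C²_c(ℝ^d)`, `F ∈ FC²_b(G)`. -/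
def IsProdCESolution (d : ℕ) (T : ℝ) (a : ℝ → SP d → Rd d → Fin d → Fin d → ℝ)
    (b : ℝ → SP d → Rd d → Fin d → ℝ) (g : ℕ → Rd d → ℝ)
    (Λ : ℝ → Measure (Rd d × SP d)) : Prop :=
  (∀ t ∈ Set.Icc (0:ℝ) T, IsProbabilityMeasure (Λ t) ∧
    Λ t {p : Rd d × SP d | p.2.1 Set.univ = 1} = 1) ∧
  (∀ Φ : Rd d × SP d → ℝ, Continuous Φ → (∃ M, ∀ p, |Φ p| ≤ M) →
      ContinuousOn (fun t => ∫ p, Φ p ∂(Λ t)) (Set.Icc 0 T)) ∧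
  (∫⁻ t in Set.Ioc (0:ℝ) T, ∫⁻ p : Rd d × SP d,
      ENNReal.ofReal (∑ i, ∑ j, (|a t p.2 p.1 i j| + |b t p.2 p.1 i|)) ∂(Λ t) < ⊤) ∧
  (∫⁻ t in Set.Ioc (0:ℝ) T, ∫⁻ ν : SP d,
      (∫⁻ x, ENNReal.ofReal ((∑ i, |b t ν x i|) + ∑ i, ∑ j, |a t ν x i j|) ∂ν.1)
        ∂((Λ t).map Prod.snd) < ⊤) ∧
  ∀ φ : Rd d → ℝ, IsC2c φ → ∀ (n : ℕ) (f : (Fin n → ℝ) → ℝ), IsC2b f →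
    ∀ t ∈ Set.Icc (0:ℝ) T,
    ∫ p, φ p.1 * Fof g f p.2 ∂(Λ t) - ∫ p, φ p.1 * Fof g f p.2 ∂(Λ 0) =
      ∫ s in (0:ℝ)..t,
        ∫ p, (Fof g f p.2 * Lop a b s p.2 φ p.1 + φ p.1 * bL a b g f s p.2) ∂(Λ s)

section Mollification

open Set ContinuousLinearMap
open scoped Convolution ContDiff

/-- `f` is a mollification of `V`, i.e. a convolution of `V` with a smooth compactly supported
kernel. -/
def IsMollification {E : Type*} [NormedAddCommGroup E] [NormedSpace ℝ E] [MeasurableSpace E]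
    (μ : Measure E) (V f : E → ℝ) : Prop :=
  ∃ ρ : E → ℝ, ContDiff ℝ ∞ ρ ∧ HasCompactSupport ρ ∧ f = ρ ⋆[lsmul ℝ ℝ, μ] V

lemma IsMollification.bounded {E : Type*} [NormedAddCommGroup E] [NormedSpace ℝ E]
    [MeasurableSpace E] [BorelSpace E] {μ : Measure E} [IsFiniteMeasureOnCompacts μ] {V f : E → ℝ} {B : ℝ} (hB : ∀ z, |V z| ≤ B)
    (hf : IsMollification μ V f) : ∃ C, ∀ z, |f z| ≤ C := by
  obtain ⟨ρ, hρ, hc, rfl⟩ := hf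
  have hi : Integrable ρ μ := hρ.continuous.integrable_of_hasCompactSupport hc
  refine ⟨∫ z, ‖ρ z‖ * B ∂μ, fun z => ?_⟩
  rw [← Real.norm_eq_abs, convolution]
  refine norm_integral_le_of_norm_le (hi.norm.mul_const B) (Eventually.of_forall fun y => ?_)
  simp only [lsmul_apply, smul_eq_mul, norm_mul]
  exact mul_le_mul_of_nonneg_left (hB _) (norm_nonneg _)

lemma locallyIntegrable_of_bounded {E : Type*} [NormedAddCommGroup E] [NormedSpace ℝ E]
    [FiniteDimensional ℝ E] [MeasurableSpace E] {μ : Measure E} [IsLocallyFiniteMeasure μ] {V : E → ℝ} (hVm : Measurable V) {B : ℝ}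
    (hB : ∀ z, |V z| ≤ B) : LocallyIntegrable V μ := by
  refine (locallyIntegrable_const (B : ℝ)).mono hVm.aestronglyMeasurable ?_
  exact Eventually.of_forall fun z => (hB z).trans (le_abs_self B)

variable {E : Type*} [NormedAddCommGroup E] [NormedSpace ℝ E] [FiniteDimensional ℝ E]
  [MeasurableSpace E] [BorelSpace E] {μ : Measure E} [μ.IsAddHaarMeasure]

lemma IsMollification.contDiff {V f : E → ℝ} (hV : LocallyIntegrable V μ)
    (hf : IsMollification μ V f) : ContDiff ℝ ∞ f := by
  obtain ⟨ρ, hρ, hc, rfl⟩ := hf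
  exact hc.contDiff_convolution_left _ hρ hV

lemma IsMollification.fderiv_apply {V f : E → ℝ} (hV : LocallyIntegrable V μ)
    (hf : IsMollification μ V f) (w : E) : IsMollification μ V (fun z => fderiv ℝ f z w) := by
  obtain ⟨ρ, hρ, hc, rfl⟩ := hf
  refine ⟨fun z => fderiv ℝ ρ z w, (hρ.fderiv_right (m := ∞) (by simp)).clm_apply contDiff_const,
    hc.fderiv_apply (𝕜 := ℝ) w, ?_⟩
  ext z
  have h1 : ContDiff ℝ 1 ρ := hρ.of_le (by exact_mod_cast le_top)
  rw [(hc.hasFDerivAt_convolution_left (lsmul ℝ ℝ) h1 hV z).fderiv]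
  have h2 : ConvolutionExistsAt (fderiv ℝ ρ) V z (precompL E (lsmul ℝ ℝ)) μ :=
    (hc.fderiv ℝ).convolutionExists_left _ (h1.continuous_fderiv one_ne_zero) hV z
  simp only [convolution]
  rw [ContinuousLinearMap.integral_apply h2]
  rfl

lemma IsMollification.fderiv_comm {V f : E → ℝ} (hV : LocallyIntegrable V μ)
    (hf : IsMollification μ V f) (v w z : E) :
    fderiv ℝ (fun y => fderiv ℝ f y v) z w = fderiv ℝ (fun y => fderiv ℝ f y w) z v := by
  have h := hf.contDiff hV
  have hs : IsSymmSndFDerivAt ℝ f z :=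
    h.contDiffAt.isSymmSndFDerivAt (by
      simpa [minSmoothness_of_isRCLikeNormedField] using
        (by exact_mod_cast le_top : ((2 : ℕ∞) : WithTop ℕ∞) ≤ ∞))
  have hd : DifferentiableAt ℝ (fderiv ℝ f) z :=
    ((h.fderiv_right (m := ∞) (by simp)).differentiable (by simp)) z
  have e : ∀ u, fderiv ℝ (fun y => fderiv ℝ f y u) z = (fderiv ℝ (fderiv ℝ f) z).flip u := by
    intro u
    rw [fderiv_clm_apply hd (differentiableAt_const u)]
    simp
  rw [e, e]
  simpa using hs w v

end Mollification

section TimeDependentTest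

open Set
open scoped ContDiff

variable {n : ℕ}

instance : (volume : Measure (ℝ × (Fin n → ℝ))).IsAddHaarMeasure :=
  inferInstanceAs ((volume : Measure ℝ).prod (volume : Measure (Fin n → ℝ))).IsAddHaarMeasure

lemma IsMollification.slice_hasFDerivAt {V f : ℝ × (Fin n → ℝ) → ℝ}
    (hV : LocallyIntegrable V volume) (hf : IsMollification volume V f) (t : ℝ)
    (x : Fin n → ℝ) : HasFDerivAt (fun y => f (t, y))
      ((fderiv ℝ f (t, x)).comp (ContinuousLinearMap.inr ℝ ℝ (Fin n → ℝ))) x := by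
  have h := ((hf.contDiff hV).differentiable (by simp) (t, x)).hasFDerivAt
  exact h.comp x (hasFDerivAt_prodMk_right t x)

lemma IsMollification.pd_slice {V f : ℝ × (Fin n → ℝ) → ℝ}
    (hV : LocallyIntegrable V volume) (hf : IsMollification volume V f) (t : ℝ) (k : Fin n) :
    pd (fun y => f (t, y)) k = fun x => fderiv ℝ f (t, x) (0, Pi.single k 1) := by
  ext x
  rw [pd, (hf.slice_hasFDerivAt hV t x).fderiv]
  simp

lemma IsMollification.isC2b_slice {V f : ℝ × (Fin n → ℝ) → ℝ} (hVm : Measurable V) {B : ℝ}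
    (hB : ∀ z, |V z| ≤ B) (hf : IsMollification volume V f) (t : ℝ) :
    IsC2b fun y => f (t, y) := by
  have hV : LocallyIntegrable V volume := locallyIntegrable_of_bounded hVm hB
  refine ⟨?_, ?_⟩
  · have := contDiff_infty.1 (hf.contDiff hV) 2
    exact this.comp (contDiff_prodMk_right t)
  obtain ⟨C0, h0⟩ := hf.bounded hB
  have h1 := fun k : Fin n => hf.fderiv_apply hV (0, Pi.single k 1)
  choose C1 hC1 using fun k => (h1 k).bounded hB
  choose C2 hC2 using fun j i : Fin n =>
    ((h1 j).fderiv_apply hV (0, Pi.single i 1)).bounded hB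
  have hC1p : ∀ k, 0 ≤ C1 k := fun k => (abs_nonneg _).trans (hC1 k 0)
  have hC2p : ∀ k i, 0 ≤ C2 k i := fun k i => (abs_nonneg _).trans (hC2 k i 0)
  have hC0p : 0 ≤ C0 := (abs_nonneg _).trans (h0 0)
  have hs1 : 0 ≤ ∑ k, C1 k := Finset.sum_nonneg fun k _ => hC1p k
  have hs2 : 0 ≤ ∑ k, ∑ i, C2 k i :=
    Finset.sum_nonneg fun k _ => Finset.sum_nonneg fun i _ => hC2p k i
  refine ⟨C0 + ∑ k, C1 k + ∑ k, ∑ i, C2 k i, fun x => ⟨?_, fun i => ?_, fun i j => ?_⟩⟩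
  · linarith [h0 (t, x)]
  · rw [hf.pd_slice hV]
    have := Finset.single_le_sum (fun k _ => hC1p k) (Finset.mem_univ i)
    linarith [hC1 i (t, x)]
  · have e : pd2 (fun y => f (t, y)) i j x =
        fderiv ℝ (fun z => fderiv ℝ f z (0, Pi.single j 1)) (t, x) (0, Pi.single i 1) := by
      rw [← congrFun ((h1 j).pd_slice hV t i) x, ← hf.pd_slice hV]
      rfl
    rw [e]
    have h3 := Finset.single_le_sum (f := fun k => ∑ i, C2 k i)
      (fun k _ => Finset.sum_nonneg fun i _ => hC2p k i) (Finset.mem_univ j)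
    have h4 := Finset.single_le_sum (f := fun i => C2 j i) (fun i _ => hC2p j i)
      (Finset.mem_univ i)
    have := hC2 j i (t, x)
    linarith

end TimeDependentTest

section TimeDependentEquation

open Set ProbabilityTheory
open scoped ContDiff

variable {n : ℕ} {Ω : Type*} [MeasurableSpace Ω]

/-- The law of `(t, o)` with `t` uniform on `(0, T]` and `o ∼ m t`. -/
abbrev spaceTime (T : ℝ) (m : Kernel ℝ Ω) : Measure (ℝ × Ω) :=
  (volume.restrict (Ioc 0 T)) ⊗ₘ m

lemma spaceTime_ae_mem (T : ℝ) (m : Kernel ℝ Ω) [IsMarkovKernel m] :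
    ∀ᵐ z ∂(spaceTime T m), z.1 ∈ Ioc 0 T := by
  have h : ∀ᵐ t ∂(volume.restrict (Ioc (0 : ℝ) T)), t ∈ Ioc 0 T :=
    ae_restrict_mem measurableSet_Ioc
  have e : (spaceTime T m).map Prod.fst = volume.restrict (Ioc 0 T) :=
    Measure.fst_compProd _ _
  rw [← e] at h
  exact ae_of_ae_map measurable_fst.aemeasurable h

/-- The weak continuity equation for the laws of `X` under `m t`, with velocity `v` and initial
law `δ_{x₀}`. -/
def IsVelocity (T : ℝ) (m : Kernel ℝ Ω) (X : Ω → Fin n → ℝ) (x₀ : Fin n → ℝ)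
    (v : Fin n → ℝ × Ω → ℝ) : Prop :=
  ∀ h : (Fin n → ℝ) → ℝ, IsC2b h → ∀ t ∈ Icc (0 : ℝ) T,
    ∫ o, h (X o) ∂(m t) - h x₀ =
      ∫ z in {z | z.1 ≤ t}, ∑ k, pd h k (X z.2) * v k z ∂(spaceTime T m)

variable {T : ℝ} {m : Kernel ℝ Ω} [IsMarkovKernel m] {X : Ω → Fin n → ℝ} {x₀ : Fin n → ℝ}
  {v : Fin n → ℝ × Ω → ℝ}

lemma integrable_integral_measure_compProd {α β : Type*} [MeasurableSpace α] [MeasurableSpace β]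
    {μ : Measure α} [SFinite μ] {κ : Kernel α β} [IsSFiniteKernel κ] {f : α × β → ℝ}
    (hf : Integrable f (μ ⊗ₘ κ)) : Integrable (fun a => ∫ b, f (a, b) ∂(κ a)) μ := by
  rw [Measure.compProd] at hf
  simpa using hf.integral_compProd

lemma integrable_bdd_mul {α : Type*} [MeasurableSpace α] {μ : Measure α} {f g : α → ℝ}
    (hf : Measurable f) {C : ℝ} (hC : ∀ z, |f z| ≤ C) (hg : Integrable g μ) :
    Integrable (fun z => f z * g z) μ :=
  hg.bdd_mul hf.aestronglyMeasurable (c := C) (Eventually.of_forall hC)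

lemma IsVelocity.sub_eq (hv : ∀ k, Integrable (v k) (spaceTime T m)) (hX : Measurable X)
    (hT : 0 < T) (h : IsVelocity T m X x₀ v) {φ : (Fin n → ℝ) → ℝ} (hφ : IsC2b φ)
    {t : ℝ} (ht : t ∈ Icc 0 T) :
    ∫ o, φ (X o) ∂(m T) - ∫ o, φ (X o) ∂(m t) =
      ∫ z, (if t < z.1 then 1 else 0) * ∑ k, pd φ k (X z.2) * v k z ∂(spaceTime T m) := by
  have h1 := h φ hφ T ⟨hT.le, le_rfl⟩
  have h2 := h φ hφ t ht
  have hms : ∀ s : ℝ, MeasurableSet {z : ℝ × Ω | z.1 ≤ s} :=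
    fun s => measurableSet_le measurable_fst measurable_const
  obtain ⟨C, hC⟩ := hφ.2
  have hpd : ∀ k, Measurable fun x => pd φ k x := fun k =>
    (hφ.1.continuous_fderiv_apply (by simp)).comp
      (continuous_id.prodMk continuous_const) |>.measurable
  have hi : Integrable (fun z : ℝ × Ω => ∑ k, pd φ k (X z.2) * v k z) (spaceTime T m) :=
    integrable_finsetSum _ fun k _ => integrable_bdd_mul
      ((hpd k).comp (hX.comp measurable_snd)) (fun z => (hC _).2.1 k) (hv k)
  have e : ∀ s : ℝ, ∫ z in {z | z.1 ≤ s}, ∑ k, pd φ k (X z.2) * v k z ∂(spaceTime T m) =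
      ∫ z, (if z.1 ≤ s then 1 else 0) * ∑ k, pd φ k (X z.2) * v k z ∂(spaceTime T m) := by
    intro s
    rw [← integral_indicator (hms s)]
    congr with z
    by_cases hz : z.1 ≤ s <;> simp [indicator, hz]
  rw [e] at h1 h2
  have hint : ∀ s : ℝ, Integrable (fun z : ℝ × Ω => (if z.1 ≤ s then (1 : ℝ) else 0) *
      ∑ k, pd φ k (X z.2) * v k z) (spaceTime T m) := fun s =>
    integrable_bdd_mul (C := 1) (Measurable.ite (hms s) measurable_const measurable_const)
      (fun z => by split_ifs <;> simp) hi
  have : ∫ o, φ (X o) ∂(m T) - ∫ o, φ (X o) ∂(m t) =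
    (∫ o, φ (X o) ∂(m T) - φ x₀) - (∫ o, φ (X o) ∂(m t) - φ x₀) := by ring
  rw [this, h1, h2, ← integral_sub (hint T) (hint t)]
  refine integral_congr_ae ?_
  filter_upwards [spaceTime_ae_mem T m] with z hz
  simp only [hz.2, if_true]
  by_cases hzt : z.1 ≤ t
  · simp [hzt, not_lt.2 hzt]
  · simp [hzt, not_le.1 hzt]

lemma clm_apply_prod (A : ℝ × (Fin n → ℝ) →L[ℝ] ℝ) (a : ℝ) (p : Fin n → ℝ) :
    A (a, p) = a * A (1, 0) + ∑ k, A (0, Pi.single k 1) * p k := by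
  have h : ((a, p) : ℝ × (Fin n → ℝ)) =
      a • (1, 0) + ∑ k, p k • ((0, Pi.single k 1) : ℝ × (Fin n → ℝ)) := by
    ext j
    · simp [Prod.fst_sum]
    · simp [Prod.snd_sum, Finset.sum_apply, Pi.single_apply]
  rw [h, map_add, map_smul, map_sum]
  simp only [map_smul, smul_eq_mul, mul_comm]

lemma IsMollification.hasDerivAt_time {V f : ℝ × (Fin n → ℝ) → ℝ}
    (hV : LocallyIntegrable V volume) (hf : IsMollification volume V f) (t : ℝ)
    (x : Fin n → ℝ) : HasDerivAt (fun s => f (s, x)) (fderiv ℝ f (t, x) (1, 0)) t := by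
  have h := ((hf.contDiff hV).differentiable (by simp) (t, x)).hasFDerivAt
  have h2 : HasDerivAt (fun s : ℝ => ((s, x) : ℝ × (Fin n → ℝ))) (1, 0) t :=
    (hasDerivAt_id t).prodMk (hasDerivAt_const t x)
  exact h.comp_hasDerivAt t h2

lemma IsMollification.integral_time {V f : ℝ × (Fin n → ℝ) → ℝ}
    (hV : LocallyIntegrable V volume) (hf : IsMollification volume V f) {a b : ℝ}
    (x : Fin n → ℝ) : ∫ t in a..b, fderiv ℝ f (t, x) (1, 0) = f (b, x) - f (a, x) := by
  refine intervalIntegral.integral_eq_sub_of_hasDerivAt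
    (fun t _ => hf.hasDerivAt_time hV t x) ?_
  have := ((hf.fderiv_apply hV (1, 0)).contDiff hV).continuous
  exact (this.comp (continuous_id.prodMk continuous_const)).intervalIntegrable _ _

theorem IsVelocity.timeDependent (hv : ∀ k, Integrable (v k) (spaceTime T m))
    (hX : Measurable X) (hT : 0 < T) (h : IsVelocity T m X x₀ v)
    {V f : ℝ × (Fin n → ℝ) → ℝ} (hVm : Measurable V) {B : ℝ} (hB : ∀ z, |V z| ≤ B)
    (hf : IsMollification volume V f) :
    Integrable (fun z => fderiv ℝ f (z.1, X z.2) (1, fun k => v k z)) (spaceTime T m) ∧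
    ∫ o, f (T, X o) ∂(m T) - f (0, x₀) =
      ∫ z, fderiv ℝ f (z.1, X z.2) (1, fun k => v k z) ∂(spaceTime T m) := by
  have hV : LocallyIntegrable V volume := locallyIntegrable_of_bounded hVm hB
  set D : ℝ × (Fin n → ℝ) → ℝ := fun z => fderiv ℝ f z (1, 0) with hD
  have hDm : IsMollification volume V D := hf.fderiv_apply hV _
  set P : Fin n → ℝ × (Fin n → ℝ) → ℝ := fun k z => fderiv ℝ f z (0, Pi.single k 1) with hP
  have hPm : ∀ k, IsMollification volume V (P k) := fun k => hf.fderiv_apply hV _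
  have hmeas : ∀ {g : ℝ × (Fin n → ℝ) → ℝ}, IsMollification volume V g → Measurable g :=
    fun hg => (hg.contDiff hV).continuous.measurable
  obtain ⟨CD, hCD⟩ := hDm.bounded hB
  choose CP hCP using fun k => (hPm k).bounded hB
  choose CQ hCQ using fun k => (hDm.fderiv_apply hV (0, Pi.single k 1)).bounded hB
  have hbi : ∀ {α : Type _} [MeasurableSpace α] {μ : Measure α} [IsFiniteMeasure μ]
      {g : α → ℝ} {C : ℝ}, Measurable g → (∀ z, |g z| ≤ C) → Integrable g μ :=
    fun hg hC => Integrable.of_bound hg.aestronglyMeasurable _ (Eventually.of_forall hC)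
  have hXz : Measurable fun z : ℝ × Ω => X z.2 := hX.comp measurable_snd
  -- the time derivative integrated against the terminal law
  have s1 : ∫ o, f (T, X o) ∂(m T) - ∫ o, f (0, X o) ∂(m T) =
      ∫ t in Ioc 0 T, ∫ o, D (t, X o) ∂(m T) := by
    obtain ⟨C, hC⟩ := hf.bounded hB
    have hfi : ∀ s : ℝ, Integrable (fun o => f (s, X o)) (m T) := fun s =>
      hbi ((hmeas hf).comp (measurable_const.prodMk hX)) fun z => hC _
    rw [← integral_sub (hfi T) (hfi 0), integral_integral_swap]
    · congr with o
      rw [← intervalIntegral.integral_of_le hT.le, hf.integral_time hV]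
    · exact hbi ((hmeas hDm).comp (measurable_fst.prodMk (hX.comp measurable_snd)))
        fun z => hCD _
  have s2 : ∫ t in Ioc 0 T, ∫ o, D (t, X o) ∂(m T) =
      ∫ t in Ioc 0 T, ((∫ o, D (t, X o) ∂(m t)) + ∫ z, (if t < z.1 then 1 else 0) *
        ∑ k, fderiv ℝ D (t, X z.2) (0, Pi.single k 1) * v k z ∂(spaceTime T m)) := by
    refine setIntegral_congr_fun measurableSet_Ioc fun t ht => ?_
    have := h.sub_eq hv hX hT (hDm.isC2b_slice hVm hB t) (Ioc_subset_Icc_self ht)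
    simp only [hDm.pd_slice hV] at this
    linarith
  have hQi : Integrable (fun p : ℝ × (ℝ × Ω) => (if p.1 < p.2.1 then (1 : ℝ) else 0) *
        ∑ k, fderiv ℝ D (p.1, X p.2.2) (0, Pi.single k 1) * v k p.2)
        ((volume.restrict (Ioc 0 T)).prod (spaceTime T m)) := by
    refine integrable_bdd_mul (C := 1) (Measurable.ite (measurableSet_lt measurable_fst
      (measurable_fst.comp measurable_snd)) measurable_const measurable_const)
      (fun z => by split_ifs <;> simp) ?_
    refine integrable_finsetSum _ fun k _ => integrable_bdd_mul (C := CQ k)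
      ((hmeas (hDm.fderiv_apply hV (0, Pi.single k 1))).comp
        (measurable_fst.prodMk (hX.comp (measurable_snd.comp measurable_snd))))
      (fun z => hCQ k _) ((hv k).comp_snd _)
  have hDi : Integrable (fun z : ℝ × Ω => D (z.1, X z.2)) (spaceTime T m) :=
    hbi ((hmeas hDm).comp (measurable_fst.prodMk hXz)) fun z => hCD _
  have s3 : ∫ t in Ioc 0 T, ((∫ o, D (t, X o) ∂(m t)) + ∫ z, (if t < z.1 then 1 else 0) *
        ∑ k, fderiv ℝ D (t, X z.2) (0, Pi.single k 1) * v k z ∂(spaceTime T m)) =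
      ∫ z, D (z.1, X z.2) ∂(spaceTime T m) +
      ∫ z, ∑ k, (P k (z.1, X z.2) - P k (0, X z.2)) * v k z ∂(spaceTime T m) := by
    rw [integral_add, Measure.integral_compProd hDi]
    · congr 1
      rw [integral_integral_swap hQi]
      refine integral_congr_ae ?_
      filter_upwards [spaceTime_ae_mem T m] with z hz
      have e : ∀ t, (if t < z.1 then (1 : ℝ) else 0) *
          ∑ k, fderiv ℝ D (t, X z.2) (0, Pi.single k 1) * v k z =
          (Iio z.1).indicator (fun t => ∑ k, fderiv ℝ (P k) (t, X z.2) (1, 0) * v k z) t := by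
        intro t
        by_cases htz : t < z.1 <;> simp [htz, indicator, hD, hP]
        exact Finset.sum_congr rfl fun k _ => by rw [hf.fderiv_comm hV]
      simp_rw [e]
      rw [integral_indicator measurableSet_Iio, Measure.restrict_restrict measurableSet_Iio]
      have e2 : (Iio z.1 ∩ Ioc 0 T : Set ℝ) = Ioo 0 z.1 := by
        ext s
        simp only [mem_inter_iff, mem_Iio, mem_Ioc, mem_Ioo]
        exact ⟨fun h => ⟨h.2.1, h.1⟩, fun h => ⟨h.2, h.1, h.2.le.trans hz.2⟩⟩
      rw [e2, ← integral_Ioc_eq_integral_Ioo, ← intervalIntegral.integral_of_le hz.1.le,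
        intervalIntegral.integral_finsetSum]
      · refine Finset.sum_congr rfl fun k _ => ?_
        rw [intervalIntegral.integral_mul_const, (hPm k).integral_time hV]
      · intro k _
        have := (((hPm k).fderiv_apply hV (1, 0)).contDiff hV).continuous
        exact ((this.comp (continuous_id.prodMk continuous_const)).mul
          continuous_const).intervalIntegrable _ _
    · exact integrable_integral_measure_compProd hDi
    · exact hQi.integral_prod_left
  have s4 := h _ (hf.isC2b_slice hVm hB 0) T ⟨hT.le, le_rfl⟩
  rw [setIntegral_eq_integral_of_ae_compl_eq_zero] at s4
  swap
  · filter_upwards [spaceTime_ae_mem T m] with z hz hz2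
    exact absurd hz.2 hz2
  simp only [hf.pd_slice hV] at s4
  have hPi : ∀ k, ∀ τ : ℝ × Ω → ℝ, Measurable τ →
      Integrable (fun z : ℝ × Ω => P k (τ z, X z.2) * v k z) (spaceTime T m) :=
    fun k τ hτ => integrable_bdd_mul ((hmeas (hPm k)).comp (hτ.prodMk hXz))
      (fun z => hCP k _) (hv k)
  have hi0 : Integrable (fun z : ℝ × Ω => ∑ k, P k (0, X z.2) * v k z) (spaceTime T m) :=
    integrable_finsetSum _ fun k _ => hPi k (fun _ => 0) measurable_const
  have hi1 : Integrable (fun z : ℝ × Ω => ∑ k, P k (z.1, X z.2) * v k z) (spaceTime T m) :=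
    integrable_finsetSum _ fun k _ => hPi k _ measurable_fst
  have e3 : ∫ z, ∑ k, (P k (z.1, X z.2) - P k (0, X z.2)) * v k z ∂(spaceTime T m) =
      ∫ z, ∑ k, P k (z.1, X z.2) * v k z ∂(spaceTime T m) -
      ∫ z, ∑ k, P k (0, X z.2) * v k z ∂(spaceTime T m) := by
    rw [← integral_sub hi1 hi0]
    congr with z
    rw [← Finset.sum_sub_distrib]
    exact Finset.sum_congr rfl fun k _ => by ring
  have e5 : (fun z => fderiv ℝ f (z.1, X z.2) (1, fun k => v k z)) =
      fun z => D (z.1, X z.2) + ∑ k, P k (z.1, X z.2) * v k z := by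
    ext z
    rw [clm_apply_prod, one_mul]
  have e4 : ∫ z, fderiv ℝ f (z.1, X z.2) (1, fun k => v k z) ∂(spaceTime T m) =
      ∫ z, D (z.1, X z.2) ∂(spaceTime T m) +
      ∫ z, ∑ k, P k (z.1, X z.2) * v k z ∂(spaceTime T m) := by
    rw [← integral_add hDi hi1, e5]
  rw [s2, s3, e3] at s1
  rw [e4]
  refine ⟨e5 ▸ hDi.add hi1, ?_⟩
  linarith

end TimeDependentEquation

section ValueFunction

open Set

variable {n : ℕ}

/-- Bounded measurable controls. -/
def IsControl (u : ℝ → Fin n → ℝ) : Prop :=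
  Measurable u ∧ ∃ C, ∀ r, ‖u r‖ ≤ C

/-- The cost of a control `u` with running cost `ℓ`, started at `z = (t, x)` and run until `T`. -/
def controlCost (ℓ : (ℝ × (Fin n → ℝ)) × (Fin n → ℝ) → ℝ) (T : ℝ) (u : ℝ → Fin n → ℝ)
    (z : ℝ × (Fin n → ℝ)) : ℝ :=
  ∫ r in Ioc z.1 T, ℓ ((r, z.2 + ∫ s in z.1..r, u s), u r)

/-- The value function of the control problem. -/
def valueFn (ℓ : (ℝ × (Fin n → ℝ)) × (Fin n → ℝ) → ℝ) (T : ℝ) (z : ℝ × (Fin n → ℝ)) : ℝ :=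
  ⨅ u : {u : ℝ → Fin n → ℝ // IsControl u}, controlCost ℓ T u.1 z

lemma IsControl.intervalIntegrable {u : ℝ → Fin n → ℝ} (hu : IsControl u) (a b : ℝ) :
    IntervalIntegrable u volume a b := by
  obtain ⟨C, hC⟩ := hu.2
  rw [intervalIntegrable_iff, uIoc]
  exact Integrable.of_bound hu.1.aestronglyMeasurable C (Eventually.of_forall hC)

lemma IsControl.continuous_primitive {u : ℝ → Fin n → ℝ} (hu : IsControl u) :
    Continuous fun p : ℝ × ℝ => ∫ s in p.1..p.2, u s := by
  have h := intervalIntegral.continuous_primitive hu.intervalIntegrable 0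
  have e : (fun p : ℝ × ℝ => ∫ s in p.1..p.2, u s) =
      fun p => (∫ s in 0..p.2, u s) - ∫ s in 0..p.1, u s := by
    ext1 p
    rw [intervalIntegral.integral_interval_sub_left (hu.intervalIntegrable _ _)
      (hu.intervalIntegrable _ _)]
  rw [e]
  exact (h.comp continuous_snd).sub (h.comp continuous_fst)

lemma isControl_const (p : Fin n → ℝ) : IsControl fun _ => p :=
  ⟨measurable_const, ‖p‖, fun _ => le_rfl⟩

lemma IsControl.ite {u u' : ℝ → Fin n → ℝ} (hu : IsControl u) (hu' : IsControl u') (t : ℝ) :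
    IsControl fun r => if r ≤ t then u r else u' r := by
  obtain ⟨C, hC⟩ := hu.2
  obtain ⟨C', hC'⟩ := hu'.2
  refine ⟨Measurable.ite measurableSet_Iic hu.1 hu'.1, max C C', fun r => ?_⟩
  dsimp only
  split_ifs
  · exact (hC r).trans (le_max_left _ _)
  · exact (hC' r).trans (le_max_right _ _)

variable {ℓ : (ℝ × (Fin n → ℝ)) × (Fin n → ℝ) → ℝ} {L : NNReal} {C T : ℝ}

lemma LipschitzWith.le_add_of_dist_fst_le (hL : LipschitzWith L ℓ) {z z' : ℝ × (Fin n → ℝ)}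
    {δ : ℝ} (h : dist z z' ≤ δ) (p : Fin n → ℝ) : ℓ (z, p) ≤ ℓ (z', p) + L * δ := by
  have h1 := hL.dist_le_mul (z, p) (z', p)
  rw [Real.dist_eq, Prod.dist_eq] at h1
  simp only [dist_self, max_eq_left dist_nonneg] at h1
  have h2 := le_abs_self (ℓ (z, p) - ℓ (z', p))
  have h3 : (L : ℝ) * dist z z' ≤ L * δ := by gcongr
  linarith

lemma LipschitzWith.le_add_mul_norm (hL : LipschitzWith L ℓ) (hC : ∀ z, ℓ (z, 0) ≤ C)
    (z : ℝ × (Fin n → ℝ)) (p : Fin n → ℝ) : ℓ (z, p) ≤ C + L * ‖p‖ := by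
  have h1 := hL.dist_le_mul (z, p) (z, 0)
  rw [Real.dist_eq, Prod.dist_eq] at h1
  simp only [dist_self, dist_zero_right, max_eq_right (norm_nonneg p)] at h1
  have h2 := le_abs_self (ℓ (z, p) - ℓ (z, 0))
  linarith [hC z]

lemma IsControl.measurable_integrand {u : ℝ → Fin n → ℝ} (hu : IsControl u)
    (hL : LipschitzWith L ℓ) (z : ℝ × (Fin n → ℝ)) :
    Measurable fun r => ℓ ((r, z.2 + ∫ s in z.1..r, u s), u r) := by
  have h : Continuous fun r : ℝ => ∫ s in z.1..r, u s :=
    hu.continuous_primitive.comp (continuous_const.prodMk continuous_id)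
  exact hL.continuous.measurable.comp
    ((measurable_id.prodMk (measurable_const.add h.measurable)).prodMk hu.1)

lemma IsControl.bounded_integrand {u : ℝ → Fin n → ℝ} (hu : IsControl u)
    (hL : LipschitzWith L ℓ) (h0 : ∀ w, 0 ≤ ℓ w) (hC : ∀ z, ℓ (z, 0) ≤ C) :
    ∃ K, ∀ z r, ‖ℓ (z, u r)‖ ≤ K := by
  obtain ⟨K, hK⟩ := hu.2
  refine ⟨C + L * K, fun z r => ?_⟩
  rw [Real.norm_of_nonneg (h0 _)]
  refine (hL.le_add_mul_norm hC z (u r)).trans ?_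
  gcongr
  exact hK r

lemma IsControl.integrableOn_integrand {u : ℝ → Fin n → ℝ} (hu : IsControl u)
    (hL : LipschitzWith L ℓ) (h0 : ∀ w, 0 ≤ ℓ w) (hC : ∀ z, ℓ (z, 0) ≤ C)
    (z : ℝ × (Fin n → ℝ)) (a b : ℝ) :
    IntegrableOn (fun r => ℓ ((r, z.2 + ∫ s in z.1..r, u s), u r)) (Ioc a b) := by
  obtain ⟨K, hK⟩ := hu.bounded_integrand hL h0 hC
  exact Integrable.of_bound (hu.measurable_integrand hL z).aestronglyMeasurable K
    (Eventually.of_forall fun r => hK _ r)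

lemma controlCost_nonneg (h0 : ∀ w, 0 ≤ ℓ w) (u : ℝ → Fin n → ℝ) (z : ℝ × (Fin n → ℝ)) :
    0 ≤ controlCost ℓ T u z :=
  integral_nonneg fun _ => h0 _

lemma IsControl.continuous_controlCost {u : ℝ → Fin n → ℝ} (hu : IsControl u)
    (hL : LipschitzWith L ℓ) (h0 : ∀ w, 0 ≤ ℓ w) (hC : ∀ z, ℓ (z, 0) ≤ C) :
    Continuous (controlCost ℓ T u) := by
  obtain ⟨K, hK⟩ := hu.bounded_integrand hL h0 hC
  refine continuous_iff_continuousAt.2 fun z₀ => ?_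
  have hnear : ∀ᶠ z : ℝ × (Fin n → ℝ) in 𝓝 z₀, z₀.1 - 1 < z.1 :=
    continuous_fst.continuousAt.eventually_const_lt (by linarith)
  have e : ∀ z : ℝ × (Fin n → ℝ), z₀.1 - 1 < z.1 → controlCost ℓ T u z =
      ∫ r in Ioc (z₀.1 - 1) T, (Ioi z.1).indicator
        (fun r => ℓ ((r, z.2 + ∫ s in z.1..r, u s), u r)) r := by
    intro z hz
    rw [setIntegral_indicator measurableSet_Ioi, controlCost]
    congr 2
    ext r
    simp only [mem_Ioc, mem_inter_iff, mem_Ioi]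
    exact ⟨fun h => ⟨⟨hz.trans h.1, h.2⟩, h.1⟩, fun h => ⟨h.2, h.1.2⟩⟩
  have hcongr : controlCost ℓ T u =ᶠ[𝓝 z₀] fun z => ∫ r in Ioc (z₀.1 - 1) T,
      (Ioi z.1).indicator (fun r => ℓ ((r, z.2 + ∫ s in z.1..r, u s), u r)) r :=
    hnear.mono e
  refine ContinuousAt.congr ?_ hcongr.symm
  refine continuousAt_of_dominated (bound := fun _ => K) ?_ ?_ ?_ ?_
  · exact Eventually.of_forall fun z =>
      ((hu.measurable_integrand hL z).indicator measurableSet_Ioi).aestronglyMeasurable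
  · exact Eventually.of_forall fun z => Eventually.of_forall fun r =>
      (norm_indicator_le_norm_self _ _).trans (hK _ r)
  · exact integrable_const K
  · have hne : ∀ᵐ r ∂(volume.restrict (Ioc (z₀.1 - 1) T)), r ≠ z₀.1 :=
      ae_restrict_of_ae (Measure.ae_ne volume z₀.1)
    filter_upwards [hne] with r hr
    have hcont : ContinuousAt (fun z : ℝ × (Fin n → ℝ) =>
        ℓ ((r, z.2 + ∫ s in z.1..r, u s), u r)) z₀ := by
      refine (hL.continuous.comp (Continuous.prodMk (continuous_const.prodMk
        (continuous_snd.add (hu.continuous_primitive.comp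
          (continuous_fst.prodMk continuous_const)))) continuous_const)).continuousAt
    rcases lt_or_gt_of_ne hr with h | h
    · have : ∀ᶠ z : ℝ × (Fin n → ℝ) in 𝓝 z₀, r < z.1 :=
        continuous_fst.continuousAt.eventually_const_lt h
      refine ContinuousAt.congr (continuousAt_const (y := (0 : ℝ))) ?_
      filter_upwards [this] with z hz
      rw [indicator_of_notMem]
      exact fun h' => lt_asymm hz h'
    · have : ∀ᶠ z : ℝ × (Fin n → ℝ) in 𝓝 z₀, z.1 < r :=
        continuous_fst.continuousAt.eventually_lt_const h
      refine ContinuousAt.congr hcont ?_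
      filter_upwards [this] with z hz
      rw [indicator_of_mem (show r ∈ Ioi z.1 from hz)]

lemma controlCost_ite_le {u : ℝ → Fin n → ℝ} (hu : IsControl u)
    (hL : LipschitzWith L ℓ) (h0 : ∀ w, 0 ≤ ℓ w) (hC : ∀ z, ℓ (z, 0) ≤ C)
    {z : ℝ × (Fin n → ℝ)} {h : ℝ} (hh : 0 ≤ h) (hT : z.1 + h ≤ T) (p : Fin n → ℝ) :
    controlCost ℓ T (fun r => if r ≤ z.1 + h then p else u r) z ≤
      controlCost ℓ T u (z + h • (1, p)) + h * (ℓ (z, p) + L * (h * (1 + ‖p‖))) := by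
  set u' : ℝ → Fin n → ℝ := fun r => if r ≤ z.1 + h then p else u r with hu'
  have hcu' : IsControl u' := (isControl_const p).ite hu _
  have hp : ∀ r, z.1 ≤ r → r ≤ z.1 + h → ∫ s in z.1..r, u' s = (r - z.1) • p := by
    intro r h1 h2
    rw [← intervalIntegral.integral_const]
    refine intervalIntegral.integral_congr fun s hs => ?_
    rw [uIcc_of_le h1] at hs
    simp [hu', hs.2.trans h2]
  have hq : ∀ r, z.1 + h < r →
      ∫ s in z.1..r, u' s = h • p + ∫ s in (z.1 + h)..r, u s := by
    intro r hr
    rw [← intervalIntegral.integral_add_adjacent_intervals (hcu'.intervalIntegrable z.1 (z.1 + h))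
      (hcu'.intervalIntegrable _ r), hp _ (by linarith) le_rfl]
    congr 1
    · rw [add_sub_cancel_left]
    · rw [intervalIntegral.integral_of_le hr.le, intervalIntegral.integral_of_le hr.le]
      refine setIntegral_congr_fun measurableSet_Ioc fun s hs => ?_
      simp [hu', hs.1]
  rw [controlCost, ← Ioc_union_Ioc_eq_Ioc (show z.1 ≤ z.1 + h by linarith) hT,
    setIntegral_union (Ioc_disjoint_Ioc_of_le le_rfl) measurableSet_Ioc
      (hcu'.integrableOn_integrand hL h0 hC _ _ _) (hcu'.integrableOn_integrand hL h0 hC _ _ _),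
    add_comm]
  refine add_le_add (le_of_eq ?_) ?_
  · simp only [controlCost, Prod.fst_add, Prod.smul_fst, smul_eq_mul, mul_one, Prod.snd_add,
      Prod.smul_snd]
    refine setIntegral_congr_fun measurableSet_Ioc fun r hr => ?_
    simp only [hq r hr.1, add_assoc]
    simp [hu', not_le.2 hr.1]
  · have hb : ∀ r ∈ Ioc z.1 (z.1 + h), ℓ ((r, z.2 + ∫ s in z.1..r, u' s), u' r) ≤
        ℓ (z, p) + L * (h * (1 + ‖p‖)) := by
      intro r hr
      rw [hp r hr.1.le hr.2]
      have e : u' r = p := by simp [hu', hr.2]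
      rw [e]
      refine hL.le_add_of_dist_fst_le ?_ p
      have hr1 : 0 ≤ r - z.1 := by linarith [hr.1]
      have hr2 : r - z.1 ≤ h := by linarith [hr.2]
      rw [Prod.dist_eq]
      refine max_le ?_ ?_
      · rw [Real.dist_eq, abs_of_nonneg hr1]
        nlinarith [norm_nonneg p]
      · simp only [dist_self_add_left, norm_smul, Real.norm_of_nonneg hr1]
        nlinarith [norm_nonneg p]
    calc ∫ r in Ioc z.1 (z.1 + h), ℓ ((r, z.2 + ∫ s in z.1..r, u' s), u' r)
        ≤ ∫ _ in Ioc z.1 (z.1 + h), (ℓ (z, p) + L * (h * (1 + ‖p‖))) :=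
          setIntegral_mono_on (hcu'.integrableOn_integrand hL h0 hC _ _ _)
            (integrableOn_const (by simp)) measurableSet_Ioc hb
      _ = h * (ℓ (z, p) + L * (h * (1 + ‖p‖))) := by
          simp [measureReal_def, hh]

instance : Nonempty {u : ℝ → Fin n → ℝ // IsControl u} := ⟨⟨_, isControl_const 0⟩⟩

lemma bddBelow_controlCost (h0 : ∀ w, 0 ≤ ℓ w) (z : ℝ × (Fin n → ℝ)) :
    BddBelow (range fun u : {u : ℝ → Fin n → ℝ // IsControl u} => controlCost ℓ T u.1 z) :=
  ⟨0, by rintro _ ⟨u, rfl⟩; exact controlCost_nonneg h0 _ _⟩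

lemma valueFn_nonneg (h0 : ∀ w, 0 ≤ ℓ w) (z : ℝ × (Fin n → ℝ)) : 0 ≤ valueFn ℓ T z :=
  le_ciInf fun _ => controlCost_nonneg h0 _ _

lemma valueFn_le (h0 : ∀ w, 0 ≤ ℓ w) {u : ℝ → Fin n → ℝ} (hu : IsControl u)
    (z : ℝ × (Fin n → ℝ)) : valueFn ℓ T z ≤ controlCost ℓ T u z :=
  ciInf_le (bddBelow_controlCost h0 z) ⟨u, hu⟩

lemma measurable_valueFn (hL : LipschitzWith L ℓ) (h0 : ∀ w, 0 ≤ ℓ w)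
    (hC : ∀ z, ℓ (z, 0) ≤ C) : Measurable (valueFn ℓ T) :=
  (upperSemicontinuous_ciInf (bddBelow_controlCost h0) fun u =>
    (u.2.continuous_controlCost hL h0 hC).upperSemicontinuous).measurable

lemma valueFn_le_max (h0 : ∀ w, 0 ≤ ℓ w) (hC : ∀ z, ℓ (z, 0) ≤ C) (z : ℝ × (Fin n → ℝ)) :
    valueFn ℓ T z ≤ C * max (T - z.1) 0 := by
  refine (valueFn_le h0 (isControl_const 0) z).trans ?_
  have hC0 : 0 ≤ C := (h0 _).trans (hC 0)
  have : ‖controlCost ℓ T (fun _ => 0) z‖ ≤ C * volume.real (Ioc z.1 T) := by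
    refine norm_setIntegral_le_of_norm_le_const (by simp) fun r _ => ?_
    rw [Real.norm_of_nonneg (h0 _)]
    exact hC _
  simpa [measureReal_def, ENNReal.toReal_ofReal'] using (le_abs_self _).trans this

/-- The dynamic programming inequality. -/
lemma valueFn_le_add (hL : LipschitzWith L ℓ) (h0 : ∀ w, 0 ≤ ℓ w)
    (hC : ∀ z, ℓ (z, 0) ≤ C) {z : ℝ × (Fin n → ℝ)} {h : ℝ} (hh : 0 ≤ h) (hT : z.1 + h ≤ T)
    (p : Fin n → ℝ) :
    valueFn ℓ T z ≤ valueFn ℓ T (z + h • (1, p)) + h * (ℓ (z, p) + L * (h * (1 + ‖p‖))) := by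
  rw [← sub_le_iff_le_add]
  refine le_ciInf fun u => ?_
  rw [sub_le_iff_le_add]
  exact (valueFn_le h0 ((isControl_const p).ite u.2 _) z).trans
    (controlCost_ite_le u.2 hL h0 hC hh hT p)

lemma IsControl.shift {u : ℝ → Fin n → ℝ} (hu : IsControl u) (t : ℝ) :
    IsControl fun r => u (r + t) :=
  ⟨hu.1.comp (measurable_id.add_const t), hu.2.imp fun _ h r => h (r + t)⟩

lemma controlCost_shift_le {u : ℝ → Fin n → ℝ} (hu : IsControl u)
    (hL : LipschitzWith L ℓ) (h0 : ∀ w, 0 ≤ ℓ w) (hC : ∀ z, ℓ (z, 0) ≤ C)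
    {z : ℝ × (Fin n → ℝ)} {x₀ : Fin n → ℝ} {δ T' : ℝ} (hz : dist ((0 : ℝ), x₀) z ≤ δ)
    (hT' : 0 ≤ T') (hT : T' + δ ≤ T) :
    controlCost ℓ T' (fun r => u (r + z.1)) (0, x₀) ≤ controlCost ℓ T u z + L * δ * T' := by
  have hz1 : |z.1| ≤ δ := by
    have := (le_max_left _ _).trans hz
    simpa [Real.dist_eq] using this
  have hpath : ∀ r, ∫ s in 0..r, u (s + z.1) = ∫ s in z.1..(r + z.1), u s := by
    intro r
    rw [intervalIntegral.integral_comp_add_right (fun s => u s), zero_add]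
  have hi := hu.integrableOn_integrand hL h0 hC z
  have hi' := (hu.shift z.1).integrableOn_integrand hL h0 hC (0, x₀) 0 T'
  have hle : T' + z.1 ≤ T := by linarith [le_abs_self z.1]
  have h1 : ∫ r in z.1..(T' + z.1), ℓ ((r, z.2 + ∫ s in z.1..r, u s), u r) ≤
      controlCost ℓ T u z := by
    rw [intervalIntegral.integral_of_le (by linarith), controlCost]
    exact setIntegral_mono_set (hi _ _) (Eventually.of_forall fun r => h0 _)
      (Ioc_subset_Ioc_right hle).eventuallyLE
  have h2 : ∫ r in z.1..(T' + z.1), ℓ ((r, z.2 + ∫ s in z.1..r, u s), u r) =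
      ∫ r in Ioc 0 T', ℓ ((r + z.1, z.2 + ∫ s in 0..r, u (s + z.1)), u (r + z.1)) := by
    simp_rw [hpath]
    rw [← intervalIntegral.integral_of_le hT', intervalIntegral.integral_comp_add_right
      (fun r => ℓ ((r, z.2 + ∫ s in z.1..r, u s), u r)), zero_add]
  have hi2 : IntegrableOn (fun r => ℓ ((r + z.1, z.2 + ∫ s in 0..r, u (s + z.1)), u (r + z.1)))
      (Ioc 0 T') := by
    simp_rw [hpath]
    have := (intervalIntegrable_iff_integrableOn_Ioc_of_le (by linarith)).2 (hi z.1 (T' + z.1))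
    have := this.comp_add_right z.1
    simp only [sub_self, add_sub_cancel_right] at this
    exact (intervalIntegrable_iff_integrableOn_Ioc_of_le hT').1 this
  have h3 : controlCost ℓ T' (fun r => u (r + z.1)) (0, x₀) ≤
      ∫ r in Ioc 0 T', (ℓ ((r + z.1, z.2 + ∫ s in 0..r, u (s + z.1)), u (r + z.1)) + L * δ) := by
    refine integral_mono hi' (hi2.add (integrableOn_const (by simp))) fun r => ?_
    refine hL.le_add_of_dist_fst_le ?_ _
    refine le_trans (le_of_eq ?_) hz
    simp [Prod.dist_eq, Real.dist_eq]
  rw [integral_add hi2 (integrableOn_const (by simp))] at h3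
  simp only [integral_const, measureReal_restrict_apply_univ, Real.volume_real_Ioc_of_le hT',
    smul_eq_mul, sub_zero] at h3
  linarith

lemma neg_le_fderiv_of_forall_le {E : Type*} [NormedAddCommGroup E] [NormedSpace ℝ E]
    {f : E → ℝ} {z w : E} (hf : DifferentiableAt ℝ f z) {η a c : ℝ} (hη : 0 < η)
    (h : ∀ s, 0 < s → s ≤ η → f z ≤ f (z + s • w) + s * (a + c * s)) :
    -a ≤ fderiv ℝ f z w := by
  have h1 : HasDerivAt (fun s : ℝ => f (z + s • w)) (fderiv ℝ f z w) 0 :=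
    hf.hasFDerivAt.hasLineDerivAt w
  have h2 := (hasDerivAt_iff_tendsto_slope_zero.1 h1).mono_left
    (nhdsWithin_mono 0 (show Ioi (0 : ℝ) ⊆ {0}ᶜ from fun s hs => ne_of_gt hs))
  have h3 : Tendsto (fun s : ℝ => -(a + c * s)) (𝓝[>] 0) (𝓝 (-(a + c * 0))) :=
    ((continuous_const.add (continuous_const.mul continuous_id)).neg.tendsto 0).mono_left
      nhdsWithin_le_nhds
  rw [mul_zero, add_zero] at h3
  refine le_of_tendsto_of_tendsto h3 h2 ?_
  filter_upwards [Ioc_mem_nhdsGT hη] with s hs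
  have := h s hs.1 hs.2
  simp only [zero_add, zero_smul, add_zero, smul_eq_mul]
  rw [le_inv_mul_iff₀ hs.1]
  linarith

end ValueFunction

section Mollified

open Set ContinuousLinearMap
open scoped Convolution ContDiff

variable {E : Type*} [NormedAddCommGroup E] [NormedSpace ℝ E] [FiniteDimensional ℝ E]
  [MeasurableSpace E] [BorelSpace E] {μ : Measure E} [μ.IsAddHaarMeasure]

lemma isMollification_normed [HasContDiffBump E] (φ : ContDiffBump (0 : E)) (V : E → ℝ) :
    IsMollification μ V (φ.normed μ ⋆[lsmul ℝ ℝ, μ] V) :=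
  ⟨φ.normed μ, φ.contDiff_normed, φ.hasCompactSupport_normed, rfl⟩

lemma integrable_normed_mul [HasContDiffBump E] (φ : ContDiffBump (0 : E)) {W : E → ℝ}
    (hW : Measurable W) {B : ℝ} (hB : ∀ z, |W z| ≤ B) :
    Integrable (fun ζ => φ.normed μ ζ * W ζ) μ :=
  φ.integrable_normed.mul_bdd (c := B) hW.aestronglyMeasurable (Eventually.of_forall hB)

lemma integral_normed_mul_le [HasContDiffBump E] (φ : ContDiffBump (0 : E)) {W W' : E → ℝ}
    (hW : Measurable W) {B : ℝ} (hB : ∀ z, |W z| ≤ B) (hW' : Measurable W')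
    {B' : ℝ} (hB' : ∀ z, |W' z| ≤ B') {c : ℝ}
    (h : ∀ ζ, ‖ζ‖ < φ.rOut → W ζ ≤ W' ζ + c) :
    ∫ ζ, φ.normed μ ζ * W ζ ∂μ ≤ ∫ ζ, φ.normed μ ζ * W' ζ ∂μ + c := by
  have e : ∫ ζ, φ.normed μ ζ * W' ζ ∂μ + c = ∫ ζ, (φ.normed μ ζ * W' ζ + φ.normed μ ζ * c) ∂μ := by
    rw [integral_add (integrable_normed_mul φ hW' hB') (φ.integrable_normed.mul_const c),
      integral_mul_const, φ.integral_normed, one_mul]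
  rw [e]
  refine integral_mono (integrable_normed_mul φ hW hB)
    ((integrable_normed_mul φ hW' hB').add (φ.integrable_normed.mul_const c)) fun ζ => ?_
  rw [← mul_add]
  by_cases hζ : ‖ζ‖ < φ.rOut
  · exact mul_le_mul_of_nonneg_left (h ζ hζ) (φ.nonneg_normed ζ)
  · have : φ.normed μ ζ = 0 := by
      rw [← Function.notMem_support, φ.support_normed_eq]
      simpa using hζ
    simp [this]

end Mollified

section FiniteDimensionalSuperposition

open Set ContinuousLinearMap ProbabilityTheory
open scoped Convolution

variable {n : ℕ} {Ω : Type*} [MeasurableSpace Ω] {T : ℝ} {m : Kernel ℝ Ω} [IsMarkovKernel m]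
  {X : Ω → Fin n → ℝ} {x₀ : Fin n → ℝ} {v : Fin n → ℝ × Ω → ℝ}
  {ℓ : (ℝ × (Fin n → ℝ)) × (Fin n → ℝ) → ℝ} {L : NNReal} {C : ℝ}

/-- A curve whose cost nearly does not exceed the averaged cost of a solution to the continuity
equation. -/
theorem IsVelocity.exists_control (hT : 0 < T) (hv : ∀ k, Integrable (v k) (spaceTime T m))
    (hX : Measurable X) (h : IsVelocity T m X x₀ v) (hL : LipschitzWith L ℓ)
    (h0 : ∀ w, 0 ≤ ℓ w) (hC : ∀ z, ℓ (z, 0) ≤ C) {ε : ℝ} (hε : 0 < ε) :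
    ∃ u, IsControl u ∧ controlCost ℓ T u (0, x₀) ≤
      ∫ z, ℓ ((z.1, X z.2), fun k => v k z) ∂(spaceTime T m) + ε := by
  have hC0 : 0 ≤ C := (h0 _).trans (hC 0)
  set S : ℝ := 2 * L * T + 2 * C + 3 with hS
  have hLT : 0 ≤ (L : ℝ) * T := mul_nonneg L.2 hT.le
  have hSpos : 0 < S := by rw [hS]; nlinarith
  obtain ⟨η, hη, hη1, hηε⟩ : ∃ η : ℝ, 0 < η ∧ η ≤ 1 ∧ η * S ≤ ε := by
    refine ⟨min 1 (ε / S), by positivity, min_le_left _ _, ?_⟩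
    rw [← le_div_iff₀ hSpos]
    exact min_le_right _ _
  set T1 : ℝ := T + η with hT1
  set B : ℝ := C * (T1 + 1) with hB
  have hBpos : 0 ≤ B := by positivity
  set V : ℝ × (Fin n → ℝ) → ℝ := fun z => min (valueFn ℓ T1 z) B with hV
  have hVm : Measurable V := (measurable_valueFn hL h0 hC).min measurable_const
  have hV0 : ∀ z, 0 ≤ V z := fun z => le_min (valueFn_nonneg h0 z) hBpos
  have hVB : ∀ z, |V z| ≤ B := fun z => by
    rw [abs_of_nonneg (hV0 z)]; exact min_le_right _ _
  have hVdpp : ∀ z : ℝ × (Fin n → ℝ), ∀ s, 0 ≤ s → z.1 + s ≤ T1 → ∀ p,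
      V z ≤ V (z + s • (1, p)) + s * (ℓ (z, p) + L * (s * (1 + ‖p‖))) := by
    intro z s hs hz p
    have h1 := valueFn_le_add hL h0 hC hs hz p
    have h2 : 0 ≤ s * (ℓ (z, p) + L * (s * (1 + ‖p‖))) :=
      mul_nonneg hs (add_nonneg (h0 _) (by positivity))
    rw [hV]
    simp only [← min_add_add_right]
    exact min_le_min h1 (by linarith)
  let φ : ContDiffBump (0 : ℝ × (Fin n → ℝ)) := ⟨η / 4, η / 2, by positivity, by linarith⟩
  have hφr : φ.rOut = η / 2 := rfl
  set f : ℝ × (Fin n → ℝ) → ℝ := φ.normed volume ⋆[lsmul ℝ ℝ, volume] V with hf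
  have hfm : IsMollification volume V f := isMollification_normed φ V
  have hfe : ∀ z, f z = ∫ ζ, φ.normed volume ζ * V (z - ζ) := fun z => rfl
  have hVs : ∀ z, Measurable fun ζ => V (z - ζ) := fun z =>
    hVm.comp (measurable_const.sub measurable_id)
  have hVl : LocallyIntegrable V volume := locallyIntegrable_of_bounded hVm hVB
  have hnorm : ∀ ζ : ℝ × (Fin n → ℝ), ‖ζ‖ < φ.rOut → |ζ.1| < η / 2 := fun ζ hζ =>
    lt_of_le_of_lt (norm_fst_le ζ) hζ
  have hder : ∀ z : ℝ × (Fin n → ℝ), z.1 ≤ T → ∀ p,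
      -(ℓ (z, p) + L * (η / 2)) ≤ fderiv ℝ f z (1, p) := by
    intro z hz p
    refine neg_le_fderiv_of_forall_le (η := η / 2) (c := L * (1 + ‖p‖))
      ((hfm.contDiff hVl).differentiable (by simp) z) (by positivity) fun s hs hs2 => ?_
    rw [hfe, hfe]
    refine integral_normed_mul_le φ (hVs z) (fun ζ => hVB _) (hVs _) (fun ζ => hVB _)
      fun ζ hζ => ?_
    have h1 := hVdpp (z - ζ) s hs.le (by
      have := abs_lt.1 (hnorm ζ hζ)
      simp only [Prod.fst_sub]
      linarith) p
    have h2 : ℓ (z - ζ, p) ≤ ℓ (z, p) + L * (η / 2) :=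
      hL.le_add_of_dist_fst_le (by simpa [dist_eq_norm] using hζ.le) p
    have h3 : z + s • (1, p) - ζ = z - ζ + s • (1, p) := by abel
    rw [h3]
    have h4 := mul_le_mul_of_nonneg_left h2 hs.le
    nlinarith
  obtain ⟨hint, heq⟩ := h.timeDependent hv hX hT hVm hVB hfm
  have hℓi : Integrable (fun z : ℝ × Ω => ℓ ((z.1, X z.2), fun k => v k z)) (spaceTime T m) := by
    have hvm : AEMeasurable (fun z : ℝ × Ω => fun k => v k z) (spaceTime T m) :=
      aemeasurable_pi_lambda _ fun k => (hv k).aestronglyMeasurable.aemeasurable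
    refine Integrable.mono' (g := fun z => C + L * ∑ k, |v k z|)
      ((integrable_const C).add ((integrable_finsetSum _ fun k _ => (hv k).abs).const_mul _))
      (hL.continuous.measurable.comp_aemeasurable ((measurable_fst.prodMk
        (hX.comp measurable_snd)).aemeasurable.prodMk hvm)).aestronglyMeasurable
      (Eventually.of_forall fun z => ?_)
    rw [Real.norm_of_nonneg (h0 _)]
    refine (hL.le_add_mul_norm hC _ _).trans ?_
    gcongr
    refine (pi_norm_le_iff_of_nonneg (by positivity)).2 fun k => ?_
    exact Finset.single_le_sum (f := fun k => |v k z|) (fun k _ => abs_nonneg _)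
      (Finset.mem_univ k)
  have hM : (spaceTime T m).real univ = T := by
    rw [measureReal_def, Measure.compProd_apply MeasurableSet.univ]
    simp [hT.le]
  have hlow : -(∫ z, ℓ ((z.1, X z.2), fun k => v k z) ∂(spaceTime T m)) - L * (η / 2) * T ≤
      ∫ z, fderiv ℝ f (z.1, X z.2) (1, fun k => v k z) ∂(spaceTime T m) := by
    have e : -(∫ z, ℓ ((z.1, X z.2), fun k => v k z) ∂(spaceTime T m)) - L * (η / 2) * T =
        ∫ z, -(ℓ ((z.1, X z.2), fun k => v k z) + L * (η / 2)) ∂(spaceTime T m) := by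
      rw [integral_neg, integral_add hℓi (integrable_const _), integral_const, hM, smul_eq_mul]
      ring
    rw [e]
    refine integral_mono_ae (hℓi.add (integrable_const _)).neg hint ?_
    filter_upwards [spaceTime_ae_mem T m] with z hz
    exact hder (z.1, X z.2) hz.2 _
  have hfT : ∀ x, f (T, x) ≤ 2 * C * η := by
    intro x
    have h1 := integral_normed_mul_le (μ := volume) φ (hVs (T, x)) (fun ζ => hVB _)
      (measurable_const (a := (0 : ℝ))) (B' := 0) (fun _ => by simp) (c := 2 * C * η)
      fun ζ hζ => by
        have h2 := abs_lt.1 (hnorm ζ hζ)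
        refine (min_le_left _ _).trans ((valueFn_le_max h0 hC _).trans ?_)
        rw [zero_add, mul_comm 2 C, mul_assoc]
        refine mul_le_mul_of_nonneg_left (max_le ?_ (by positivity)) hC0
        simp only [Prod.fst_sub]
        linarith
    rw [hfe]
    simpa using h1
  have hfTi : ∫ o, f (T, X o) ∂(m T) ≤ 2 * C * η := by
    obtain ⟨K, hK⟩ := hfm.bounded hVB
    have hfi : Integrable (fun o => f (T, X o)) (m T) :=
      Integrable.of_bound ((hfm.contDiff hVl).continuous.measurable.comp
        (measurable_const.prodMk hX)).aestronglyMeasurable K (Eventually.of_forall fun o => hK _)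
    calc ∫ o, f (T, X o) ∂(m T) ≤ ∫ _, 2 * C * η ∂(m T) :=
          integral_mono hfi (integrable_const _) fun o => hfT _
      _ = 2 * C * η := by simp
  obtain ⟨ζ, hζ, hζV⟩ : ∃ ζ : ℝ × (Fin n → ℝ), ‖ζ‖ < φ.rOut ∧
      V ((0, x₀) - ζ) ≤ f (0, x₀) + η := by
    by_contra! hcon
    have h1 := integral_normed_mul_le (μ := volume) φ (W := fun _ => f (0, x₀) + η)
      measurable_const (B := |f (0, x₀) + η|) (fun _ => le_rfl) (hVs (0, x₀))
      (fun ζ => hVB _) (c := 0) fun ζ hζ => by linarith [hcon ζ hζ]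
    rw [integral_mul_const, φ.integral_normed, ← hfe] at h1
    linarith
  set z : ℝ × (Fin n → ℝ) := (0, x₀) - ζ with hz
  have hzval : valueFn ℓ T1 z ≤ B := by
    refine (valueFn_le_max h0 hC z).trans (mul_le_mul_of_nonneg_left (max_le ?_ ?_) hC0)
    · have := abs_lt.1 (hnorm ζ hζ)
      simp only [hz, Prod.fst_sub]
      linarith
    · positivity
  have hVz : V z = valueFn ℓ T1 z := min_eq_left hzval
  obtain ⟨⟨u, hu⟩, hulty⟩ := exists_lt_of_ciInf_lt (show valueFn ℓ T1 z < valueFn ℓ T1 z + η by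
    linarith)
  have hdist : dist ((0 : ℝ), x₀) z ≤ η / 2 := by
    rw [hz, dist_eq_norm, sub_sub_cancel]
    exact hζ.le
  have hshift := controlCost_shift_le (T := T1) hu hL h0 hC hdist hT.le (by linarith)
  refine ⟨_, hu.shift z.1, hshift.trans ?_⟩
  dsimp only at hulty
  rw [hVz] at hζV
  nlinarith

end FiniteDimensionalSuperposition

section Cylinder

open Set
open scoped NNReal ENNReal

/-- Keep the time and the first `n` coordinates. -/
def cylProj (n : ℕ) (z : ℝ × (ℕ → ℝ)) : ℝ × (Fin n → ℝ) :=
  (z.1, fun k => z.2 k)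

/-- Extension by zero of finitely many coordinates. -/
def cylLift (n : ℕ) (x : Fin n → ℝ) : ℕ → ℝ :=
  fun i => if h : i < n then x ⟨i, h⟩ else 0

lemma cylProj_cylLift (n : ℕ) (t : ℝ) (x : Fin n → ℝ) : cylProj n (t, cylLift n x) = (t, x) := by
  simp [cylProj, cylLift]

lemma continuous_cylProj (n : ℕ) : Continuous (cylProj n) := by
  unfold cylProj
  fun_prop

lemma dist_cylProj_mono {m n : ℕ} (h : m ≤ n) (z z' : ℝ × (ℕ → ℝ)) :
    dist (cylProj m z) (cylProj m z') ≤ dist (cylProj n z) (cylProj n z') := by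
  rw [Prod.dist_eq, Prod.dist_eq]
  refine max_le_max le_rfl ((dist_pi_le_iff dist_nonneg).2 fun k => ?_)
  exact dist_le_pi_dist (cylProj n z).2 (cylProj n z').2 (Fin.castLE h k)

/-- Bounded functions of time and the first `n` coordinates which are Lipschitz. -/
def IsCyl (n : ℕ) (w : ℝ × (ℕ → ℝ) → ℝ) : Prop :=
  (∃ C, ∀ z, |w z| ≤ C) ∧
    ∃ L : ℝ≥0, ∀ z z', |w z - w z'| ≤ L * dist (cylProj n z) (cylProj n z')

lemma IsCyl.mono {m n : ℕ} {w : ℝ × (ℕ → ℝ) → ℝ} (hw : IsCyl m w) (h : m ≤ n) : IsCyl n w :=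
  ⟨hw.1, hw.2.imp fun L hL z z' => (hL z z').trans
    (mul_le_mul_of_nonneg_left (dist_cylProj_mono h z z') L.2)⟩

lemma IsCyl.comp_cylLift {n : ℕ} {w : ℝ × (ℕ → ℝ) → ℝ} (hw : IsCyl n w) (z : ℝ × (ℕ → ℝ)) :
    w (z.1, cylLift n (cylProj n z).2) = w z := by
  obtain ⟨L, hL⟩ := hw.2
  have := hL (z.1, cylLift n (cylProj n z).2) z
  rw [cylProj_cylLift, show ((z.1, (cylProj n z).2) : ℝ × (Fin n → ℝ)) = cylProj n z from rfl,
    dist_self, mul_zero] at this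
  exact sub_eq_zero.1 (abs_nonpos_iff.1 this)

lemma IsCyl.continuous {n : ℕ} {w : ℝ × (ℕ → ℝ) → ℝ} (hw : IsCyl n w) : Continuous w := by
  obtain ⟨L, hL⟩ := hw.2
  have h : LipschitzWith L fun y : ℝ × (Fin n → ℝ) => w (y.1, cylLift n y.2) := by
    refine LipschitzWith.of_dist_le_mul fun y y' => ?_
    simpa [Real.dist_eq, cylProj_cylLift] using hL (y.1, cylLift n y.2) (y'.1, cylLift n y'.2)
  have e : w = (fun y : ℝ × (Fin n → ℝ) => w (y.1, cylLift n y.2)) ∘ cylProj n := by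
    ext z
    exact (hw.comp_cylLift z).symm
  rw [e]
  exact h.continuous.comp (continuous_cylProj n)

lemma IsCyl.sub_const {n : ℕ} {w : ℝ × (ℕ → ℝ) → ℝ} (hw : IsCyl n w) (c : ℝ) :
    IsCyl n fun z => w z - c := by
  obtain ⟨⟨C, hC⟩, L, hL⟩ := hw
  refine ⟨⟨C + |c|, fun z => (abs_sub _ _).trans (by linarith [hC z])⟩, L, fun z z' => ?_⟩
  simpa using hL z z'

lemma exists_cylProj_nhds {z : ℝ × (ℕ → ℝ)} {U : Set (ℝ × (ℕ → ℝ))} (hU : U ∈ 𝓝 z) :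
    ∃ n : ℕ, ∀ z', dist (cylProj n z') (cylProj n z) < 1 / ((n : ℝ) + 1) → z' ∈ U := by
  by_contra! hcon
  choose z' hz' hzU using hcon
  have h1 : Tendsto (fun n : ℕ => 1 / ((n : ℝ) + 1)) atTop (𝓝 0) :=
    tendsto_one_div_add_atTop_nhds_zero_nat
  have h2 : Tendsto z' atTop (𝓝 z) := by
    refine Prod.tendsto_iff _ _ |>.2 ⟨?_, tendsto_pi_nhds.2 fun i => ?_⟩
    · rw [tendsto_iff_dist_tendsto_zero]
      refine squeeze_zero (fun _ => dist_nonneg) (fun n => ?_) h1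
      exact (le_max_left _ _).trans (hz' n).le
    · rw [tendsto_iff_dist_tendsto_zero]
      refine squeeze_zero' (Eventually.of_forall fun _ => dist_nonneg) ?_ h1
      filter_upwards [eventually_gt_atTop i] with n hn
      exact ((dist_le_pi_dist (cylProj n (z' n)).2 (cylProj n z).2 ⟨i, hn⟩).trans
        (le_max_right _ _)).trans (hz' n).le
  obtain ⟨n, hn⟩ := (h2.eventually hU).exists
  exact hzU n hn

/-- A Moreau–Yosida regularization by cylinder functions. -/
def cylReg (q : ℝ × (ℕ → ℝ) → ℝ≥0∞) (n : ℕ) (z : ℝ × (ℕ → ℝ)) : ℝ :=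
  ⨅ z', ((min (n : ℝ≥0∞) (q z')).toReal + n * dist (cylProj n z') (cylProj n z))

variable {q : ℝ × (ℕ → ℝ) → ℝ≥0∞}

lemma bddBelow_cylReg (q : ℝ × (ℕ → ℝ) → ℝ≥0∞) (n : ℕ) (z : ℝ × (ℕ → ℝ)) :
    BddBelow (range fun z' => (min (n : ℝ≥0∞) (q z')).toReal +
      n * dist (cylProj n z') (cylProj n z)) :=
  ⟨0, by rintro _ ⟨z', rfl⟩; positivity⟩

lemma cylReg_nonneg (q : ℝ × (ℕ → ℝ) → ℝ≥0∞) (n : ℕ) (z : ℝ × (ℕ → ℝ)) : 0 ≤ cylReg q n z :=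
  le_ciInf fun _ => by positivity

lemma cylReg_le (q : ℝ × (ℕ → ℝ) → ℝ≥0∞) (n : ℕ) (z : ℝ × (ℕ → ℝ)) :
    cylReg q n z ≤ (min (n : ℝ≥0∞) (q z)).toReal :=
  (ciInf_le (bddBelow_cylReg q n z) z).trans (by simp)

lemma toReal_min_natCast_mono (a : ℝ≥0∞) {m n : ℕ} (h : m ≤ n) :
    (min (m : ℝ≥0∞) a).toReal ≤ (min (n : ℝ≥0∞) a).toReal :=
  ENNReal.toReal_mono (ne_top_of_le_ne_top (ENNReal.natCast_ne_top n) (min_le_left _ _))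
    (min_le_min_right _ (by exact_mod_cast h))

lemma monotone_cylReg (q : ℝ × (ℕ → ℝ) → ℝ≥0∞) (z : ℝ × (ℕ → ℝ)) :
    Monotone fun n => cylReg q n z := by
  intro m n h
  refine ciInf_mono (bddBelow_cylReg q m z) fun z' => add_le_add (toReal_min_natCast_mono _ h) ?_
  exact mul_le_mul (by exact_mod_cast h) (dist_cylProj_mono h _ _) dist_nonneg (by positivity)

lemma isCyl_cylReg (q : ℝ × (ℕ → ℝ) → ℝ≥0∞) (n : ℕ) : IsCyl n (cylReg q n) := by
  refine ⟨⟨n, fun z => ?_⟩, n, fun z z' => ?_⟩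
  · rw [abs_of_nonneg (cylReg_nonneg q n z)]
    refine (cylReg_le q n z).trans ?_
    exact ENNReal.toReal_le_of_le_ofReal (by positivity) (by simp)
  · have key : ∀ z z', cylReg q n z ≤ cylReg q n z' + n * dist (cylProj n z) (cylProj n z') := by
      intro z z'
      rw [← sub_le_iff_le_add]
      refine le_ciInf fun y => ?_
      rw [sub_le_iff_le_add]
      refine (ciInf_le (bddBelow_cylReg q n z) y).trans ?_
      rw [add_assoc, ← mul_add]
      gcongr
      rw [dist_comm (cylProj n z)]
      exact dist_triangle _ _ _
    rw [abs_sub_le_iff]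
    simp only [NNReal.coe_natCast]
    have h1 := key z z'
    have h2 := key z' z
    rw [dist_comm (cylProj n z')] at h2
    constructor <;> linarith

lemma iSup_cylReg (hq : LowerSemicontinuous q) (z : ℝ × (ℕ → ℝ)) :
    ⨆ n, ENNReal.ofReal (cylReg q n z) = q z := by
  refine le_antisymm (iSup_le fun n => ?_) (le_of_forall_lt fun c hc => ?_)
  · refine (ENNReal.ofReal_le_ofReal (cylReg_le q n z)).trans ?_
    rw [ENNReal.ofReal_toReal
      (ne_top_of_le_ne_top (ENNReal.natCast_ne_top n) (min_le_left _ _))]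
    exact min_le_right _ _
  · obtain ⟨c', hcc', hc'⟩ := exists_between hc
    have hc't : c' ≠ ⊤ := hc'.ne_top
    obtain ⟨n₀, hn₀⟩ := exists_cylProj_nhds (hq z c' hc')
    obtain ⟨k, hk⟩ := exists_nat_ge (c'.toReal * ((n₀ : ℝ) + 1))
    set n := max n₀ k with hn
    have hkn : (k : ℝ) ≤ n := by exact_mod_cast le_max_right _ _
    have hc0 : 0 ≤ c'.toReal := ENNReal.toReal_nonneg
    have hpos : (0 : ℝ) < n₀ + 1 := by positivity
    have hcn : c'.toReal ≤ n := by
      have : c'.toReal ≤ c'.toReal * ((n₀ : ℝ) + 1) := by nlinarith [Nat.cast_nonneg (α := ℝ) n₀]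
      linarith
    refine hcc'.trans_le (le_iSup_of_le n ?_)
    rw [← ENNReal.ofReal_toReal hc't]
    refine ENNReal.ofReal_le_ofReal (le_ciInf fun z' => ?_)
    by_cases hz' : dist (cylProj n z') (cylProj n z) < 1 / ((n₀ : ℝ) + 1)
    · have h1 : c' < q z' := hn₀ z' ((dist_cylProj_mono (le_max_left _ _) _ _).trans_lt hz')
      have h2 : c'.toReal ≤ (min (n : ℝ≥0∞) (q z')).toReal := by
        refine ENNReal.toReal_mono
          (ne_top_of_le_ne_top (ENNReal.natCast_ne_top n) (min_le_left _ _)) (le_min ?_ h1.le)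
        rw [← ENNReal.ofReal_toReal hc't, ← ENNReal.ofReal_natCast]
        exact ENNReal.ofReal_le_ofReal hcn
      have h3 : 0 ≤ n * dist (cylProj n z') (cylProj n z) := by positivity
      linarith
    · have h1 : c'.toReal ≤ n * dist (cylProj n z') (cylProj n z) := by
        calc c'.toReal = c'.toReal * ((n₀ : ℝ) + 1) * (1 / ((n₀ : ℝ) + 1)) := by field_simp
          _ ≤ n * dist (cylProj n z') (cylProj n z) :=
            mul_le_mul (hk.trans hkn) (not_lt.1 hz') (by positivity) (by positivity)
      have h2 : 0 ≤ (min (n : ℝ≥0∞) (q z')).toReal := ENNReal.toReal_nonneg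
      linarith

lemma exists_isCyl_integral_sub_le_of_continuous {M : Measure (ℝ × (ℕ → ℝ))} [IsFiniteMeasure M]
    {w : ℝ × (ℕ → ℝ) → ℝ} (hw : Continuous w) {C : ℝ} (hC : ∀ z, |w z| ≤ C) {ε : ℝ} (hε : 0 < ε) :
    ∃ n w', IsCyl n w' ∧ ∫ z, |w z - w' z| ∂M ≤ ε := by
  set q : ℝ × (ℕ → ℝ) → ℝ≥0∞ := fun z => ENNReal.ofReal (w z + C) with hq
  have hwC : ∀ z, 0 ≤ w z + C := fun z => by linarith [(abs_le.1 (hC z)).1]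
  have hql : LowerSemicontinuous q :=
    (ENNReal.continuous_ofReal.comp (hw.add continuous_const)).lowerSemicontinuous
  have hlim : ∀ z, Tendsto (fun n => cylReg q n z) atTop (𝓝 (w z + C)) := by
    intro z
    have h1 : Tendsto (fun n => ENNReal.ofReal (cylReg q n z)) atTop (𝓝 (q z)) := by
      rw [← iSup_cylReg hql z]
      exact tendsto_atTop_iSup fun m n h => ENNReal.ofReal_le_ofReal (monotone_cylReg q z h)
    have h2 := (ENNReal.tendsto_toReal (ENNReal.ofReal_ne_top)).comp h1
    simpa [Function.comp_def, ENNReal.toReal_ofReal, cylReg_nonneg, hwC, q] using h2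
  have hle : ∀ n z, cylReg q n z ≤ w z + C := fun n z =>
    (cylReg_le q n z).trans (ENNReal.toReal_le_of_le_ofReal (hwC z) (min_le_right _ _))
  have h1 : Tendsto (fun n => ∫ z, |w z - (cylReg q n z - C)| ∂M) atTop (𝓝 (∫ _, 0 ∂M)) := by
    refine tendsto_integral_of_dominated_convergence (fun _ => 2 * C) (fun n => ?_)
      (integrable_const _) (fun n => Eventually.of_forall fun z => ?_)
      (Eventually.of_forall fun z => ?_)
    · exact (hw.sub ((isCyl_cylReg q n).continuous.sub
        continuous_const)).abs.measurable.aestronglyMeasurable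
    · rw [Real.norm_eq_abs, abs_abs, abs_of_nonneg (by linarith [hle n z])]
      linarith [cylReg_nonneg q n z, (abs_le.1 (hC z)).2]
    · have := (((hlim z).sub_const C).const_sub (w z)).abs
      simpa using this
  rw [integral_zero] at h1
  obtain ⟨n, hn⟩ := (h1.eventually (gt_mem_nhds hε)).exists
  exact ⟨n, _, (isCyl_cylReg q n).sub_const C, hn.le⟩

lemma exists_isCyl_integral_sub_le {M : Measure (ℝ × (ℕ → ℝ))} [IsFiniteMeasure M]
    {v : ℝ × (ℕ → ℝ) → ℝ} (hv : Integrable v M) {ε : ℝ} (hε : 0 < ε) :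
    ∃ n w, IsCyl n w ∧ ∫ z, |v z - w z| ∂M ≤ ε := by
  obtain ⟨g, hg, hgi⟩ := hv.exists_boundedContinuous_integral_sub_le (half_pos hε)
  obtain ⟨n, w, hw, hwg⟩ := exists_isCyl_integral_sub_le_of_continuous (M := M) g.continuous
    (fun z => g.norm_coe_le_norm z) (half_pos hε)
  have hwi : Integrable w M := by
    obtain ⟨C, hC⟩ := hw.1
    exact Integrable.of_bound hw.continuous.measurable.aestronglyMeasurable C
      (Eventually.of_forall hC)
  refine ⟨n, w, hw, ?_⟩
  calc ∫ z, |v z - w z| ∂M ≤ ∫ z, (‖v z - g z‖ + |g z - w z|) ∂M :=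
        integral_mono (hv.sub hwi).abs ((hv.sub hgi).norm.add (hgi.sub hwi).abs)
          fun z => abs_sub_le _ _ _
    _ = ∫ z, ‖v z - g z‖ ∂M + ∫ z, |g z - w z| ∂M :=
        integral_add (hv.sub hgi).norm (hgi.sub hwi).abs
    _ ≤ ε := by linarith

end Cylinder

section ApproximateCurves

open Set ProbabilityTheory
open scoped NNReal ENNReal

lemma cylLift_of_lt {n i : ℕ} (h : i < n) (x : Fin n → ℝ) : cylLift n x i = x ⟨i, h⟩ := by
  simp [cylLift, h]

lemma continuous_cylLift (n : ℕ) : Continuous (cylLift n) := by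
  refine continuous_pi fun i => ?_
  by_cases h : i < n
  · simpa [cylLift, h] using continuous_apply (⟨i, h⟩ : Fin n)
  · simpa [cylLift, h] using continuous_const

lemma dist_cylLift_le (n : ℕ) (x x' : Fin n → ℝ) (i : ℕ) :
    dist (cylLift n x i) (cylLift n x' i) ≤ dist x x' := by
  by_cases h : i < n
  · simpa [cylLift, h] using dist_le_pi_dist x x' ⟨i, h⟩
  · simp [cylLift, h]

lemma LipschitzWith.exists_finset_sum {ι α : Type*} [PseudoMetricSpace α] {f : ι → α → ℝ}
    (s : Finset ι) (h : ∀ i ∈ s, ∃ L, LipschitzWith L (f i)) :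
    ∃ L, LipschitzWith L fun x => ∑ i ∈ s, f i x := by
  classical
  induction s using Finset.induction_on with
  | empty => exact ⟨0, by simp⟩
  | insert a s ha ih =>
    obtain ⟨L₁, h₁⟩ := h a (Finset.mem_insert_self a s)
    obtain ⟨L₂, h₂⟩ := ih fun i hi => h i (Finset.mem_insert_of_mem hi)
    refine ⟨L₁ + L₂, ?_⟩
    simpa [Finset.sum_insert ha] using h₁.add h₂

variable {T : ℝ} {m : Kernel ℝ (ℕ → ℝ)} [IsMarkovKernel m] {x₀ : ℕ → ℝ}
  {v : ℕ → ℝ × (ℕ → ℝ) → ℝ}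

/-- The running cost penalizing the deviation of the velocity from the given cylinder fields. -/
def cylCost (n N : ℕ) (ι : ℕ → ℕ) (w : ℕ → ℝ × (ℕ → ℝ) → ℝ) (r : ℝ × (ℕ → ℝ) → ℝ)
    (q : (ℝ × (Fin n → ℝ)) × (Fin n → ℝ)) : ℝ :=
  ∑ j ∈ Finset.range N, 2 ^ j * |cylLift n q.2 (ι j) - w j (q.1.1, cylLift n q.1.2)| +
    r (q.1.1, cylLift n q.1.2)

lemma IsCyl.lipschitzWith_lift {n : ℕ} {w : ℝ × (ℕ → ℝ) → ℝ} (hw : IsCyl n w) :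
    ∃ L, LipschitzWith L fun q : (ℝ × (Fin n → ℝ)) × (Fin n → ℝ) =>
      w (q.1.1, cylLift n q.1.2) := by
  obtain ⟨L, hL⟩ := hw.2
  refine ⟨L, LipschitzWith.of_dist_le_mul fun q q' => ?_⟩
  have h := hL (q.1.1, cylLift n q.1.2) (q'.1.1, cylLift n q'.1.2)
  rw [cylProj_cylLift, cylProj_cylLift] at h
  rw [Real.dist_eq]
  refine h.trans (mul_le_mul_of_nonneg_left ?_ L.2)
  exact le_max_left _ _

lemma lipschitzWith_cylCost {n N : ℕ} {ι : ℕ → ℕ} {w : ℕ → ℝ × (ℕ → ℝ) → ℝ}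
    {r : ℝ × (ℕ → ℝ) → ℝ} (hw : ∀ j < N, IsCyl n (w j)) (hr : IsCyl n r) :
    ∃ L, LipschitzWith L (cylCost n N ι w r) := by
  obtain ⟨L₁, h₁⟩ := LipschitzWith.exists_finset_sum (Finset.range N)
    (f := fun j (q : (ℝ × (Fin n → ℝ)) × (Fin n → ℝ)) =>
      2 ^ j * |cylLift n q.2 (ι j) - w j (q.1.1, cylLift n q.1.2)|) fun j hj => by
    obtain ⟨L, hL⟩ := (hw j (Finset.mem_range.1 hj)).lipschitzWith_lift
    have h1 : LipschitzWith 1 fun q : (ℝ × (Fin n → ℝ)) × (Fin n → ℝ) => cylLift n q.2 (ι j) :=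
      LipschitzWith.of_dist_le_mul fun q q' => by
        rw [NNReal.coe_one, one_mul]
        exact (dist_cylLift_le n _ _ _).trans (le_max_right _ _)
    have h2 := (lipschitzWith_smul ((2 : ℝ) ^ j)).comp
      (lipschitzWith_one_norm.comp (h1.sub hL))
    exact ⟨_, by simpa only [Function.comp_def, smul_eq_mul, Real.norm_eq_abs] using h2⟩
  obtain ⟨L₂, h₂⟩ := hr.lipschitzWith_lift
  exact ⟨L₁ + L₂, h₁.add h₂⟩

lemma cylCost_nonneg {n N : ℕ} {ι : ℕ → ℕ} {w : ℕ → ℝ × (ℕ → ℝ) → ℝ}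
    {r : ℝ × (ℕ → ℝ) → ℝ} (hr : ∀ z, 0 ≤ r z) (q : (ℝ × (Fin n → ℝ)) × (Fin n → ℝ)) :
    0 ≤ cylCost n N ι w r q :=
  add_nonneg (Finset.sum_nonneg fun j _ => by positivity) (hr _)

lemma cylCost_zero_le {n N : ℕ} {ι : ℕ → ℕ} {w : ℕ → ℝ × (ℕ → ℝ) → ℝ}
    {r : ℝ × (ℕ → ℝ) → ℝ} (hw : ∀ j < N, IsCyl n (w j)) (hr : IsCyl n r) :
    ∃ C, ∀ z, cylCost n N ι w r (z, 0) ≤ C := by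
  have h1 : ∀ j, ∃ C, j < N → ∀ z, |w j z| ≤ C := fun j => by
    by_cases hj : j < N
    · obtain ⟨C, hC⟩ := (hw j hj).1
      exact ⟨C, fun _ => hC⟩
    · exact ⟨0, fun h => absurd h hj⟩
  choose C hC using h1
  obtain ⟨C', hC'⟩ := hr.1
  refine ⟨∑ j ∈ Finset.range N, 2 ^ j * C j + C', fun z => add_le_add ?_
    ((le_abs_self _).trans (hC' _))⟩
  refine Finset.sum_le_sum fun j hj => mul_le_mul_of_nonneg_left ?_ (by positivity)
  have h0 : cylLift n (0 : Fin n → ℝ) (ι j) = 0 := by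
    by_cases h : ι j < n <;> simp [cylLift, h]
  simp only [h0, zero_sub, abs_neg]
  exact hC j (Finset.mem_range.1 hj) _

lemma integral_eval_fin {n : ℕ} {u : ℝ → Fin n → ℝ} (hu : IsControl u) (a b : ℝ) (k : Fin n) :
    (∫ s in a..b, u s) k = ∫ s in a..b, u s k :=
  ((ContinuousLinearMap.proj (R := ℝ) (φ := fun _ : Fin n => ℝ) k).intervalIntegral_comp_comm
    (hu.intervalIntegrable a b)).symm

theorem exists_approximate_curve (hT : 0 < T) (hv : ∀ i, Integrable (v i) (spaceTime T m))
    (hCE : ∀ n : ℕ, IsVelocity T m (fun x (k : Fin n) => x k) (fun k => x₀ k) (fun k z => v k z))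
    {N : ℕ} {D : ℕ → ℕ} {ι : ℕ → ℕ} {w : ℕ → ℝ × (ℕ → ℝ) → ℝ} (hw : ∀ j, IsCyl (D j) (w j))
    {R : ℕ} {r : ℝ × (ℕ → ℝ) → ℝ} (hr : IsCyl R r) (hr0 : ∀ z, 0 ≤ r z) {K K' : ℝ}
    (hK : ∑ j ∈ Finset.range N, 2 ^ j * ∫ z, |v (ι j) z - w j z| ∂(spaceTime T m) +
      ∫ z, r z ∂(spaceTime T m) ≤ K') (hKK' : K' < K) :
    ∃ y : ℝ → ℕ → ℝ, Continuous y ∧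
      (∀ j < N, ∀ t ∈ Icc 0 T,
        2 ^ j * |y t (ι j) - x₀ (ι j) - ∫ s in 0..t, w j (s, y s)| ≤ K) ∧
      ∫ s in Ioc 0 T, r (s, y s) ≤ K := by
  set n : ℕ := ∑ j ∈ Finset.range N, (D j + ι j + 1) + R with hn
  have hle : ∀ j < N, D j + ι j + 1 ≤ n := fun j hj => by
    have := Finset.single_le_sum (f := fun j => D j + ι j + 1) (fun _ _ => Nat.zero_le _)
      (Finset.mem_range.2 hj)
    omega
  have hιn : ∀ j < N, ι j < n := fun j hj => by have := hle j hj; omega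
  have hwn : ∀ j < N, IsCyl n (w j) := fun j hj => (hw j).mono (by have := hle j hj; omega)
  have hrn : IsCyl n r := hr.mono (by omega)
  obtain ⟨L, hL⟩ := lipschitzWith_cylCost (ι := ι) hwn hrn
  obtain ⟨C, hC⟩ := cylCost_zero_le (ι := ι) hwn hrn
  have hX : Measurable fun (x : ℕ → ℝ) (k : Fin n) => x k :=
    measurable_pi_lambda _ fun k => measurable_pi_apply _
  obtain ⟨u, hu, hcost⟩ := (hCE n).exists_control hT (fun k => hv k) hX hL
    (cylCost_nonneg hr0) hC (sub_pos.2 hKK')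
  have hwi : ∀ {l : ℕ} {w : ℝ × (ℕ → ℝ) → ℝ}, IsCyl l w → Integrable w (spaceTime T m) :=
    fun hw => by
      obtain ⟨C, hC⟩ := hw.1
      exact Integrable.of_bound hw.continuous.measurable.aestronglyMeasurable C
        (Eventually.of_forall hC)
  have hint : ∫ z, cylCost n N ι w r ((z.1, fun k : Fin n => z.2 k), fun k : Fin n => v k z)
      ∂(spaceTime T m) ≤ K' := by
    refine le_trans (le_of_eq ?_) hK
    have e : ∀ z : ℝ × (ℕ → ℝ),
        cylCost n N ι w r ((z.1, fun k : Fin n => z.2 k), fun k : Fin n => v k z) =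
        ∑ j ∈ Finset.range N, 2 ^ j * |v (ι j) z - w j z| + r z := by
      intro z
      rw [cylCost]
      congr 1
      · refine Finset.sum_congr rfl fun j hj => ?_
        have hj' := Finset.mem_range.1 hj
        rw [cylLift_of_lt (hιn j hj')]
        have := (hwn j hj').comp_cylLift z
        rw [cylProj] at this
        rw [this]
      · have := hrn.comp_cylLift z
        rwa [cylProj] at this
    simp_rw [e]
    have hterm : ∀ j, Integrable (fun z => 2 ^ j * |v (ι j) z - w j z|) (spaceTime T m) :=
      fun j => (((hv _).sub (hwi (hw j))).abs).const_mul _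
    rw [integral_add (integrable_finsetSum _ fun j _ => hterm j) (hwi hr),
      integral_finsetSum _ fun j _ => hterm j]
    simp_rw [integral_const_mul]
  have hcostK : controlCost (cylCost n N ι w r) T u (0, fun k => x₀ k) ≤ K := by linarith
  set y : ℝ → ℕ → ℝ := fun t => cylLift n ((fun k : Fin n => x₀ k) + ∫ s in 0..t, u s) with hy
  have hyc : Continuous y := (continuous_cylLift n).comp (continuous_const.add
    (hu.continuous_primitive.comp (continuous_const.prodMk continuous_id)))
  have hcy : ∀ {l : ℕ} {w : ℝ × (ℕ → ℝ) → ℝ}, IsCyl l w → Continuous fun s => w (s, y s) :=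
    fun hw => hw.continuous.comp (continuous_id.prodMk hyc)
  have hui : ∀ i, Measurable fun s => cylLift n (u s) i := fun i =>
    ((continuous_apply i).comp (continuous_cylLift n)).measurable.comp hu.1
  obtain ⟨Cu, hCu⟩ := hu.2
  have huii : ∀ i a b, IntegrableOn (fun s => cylLift n (u s) i) (Ioc a b) := fun i a b =>
    Integrable.of_bound (hui i).aestronglyMeasurable Cu (Eventually.of_forall fun s => by
      have h0 : cylLift n (0 : Fin n → ℝ) i = 0 := by
        by_cases h : i < n <;> simp [cylLift, h]
      have := dist_cylLift_le n (u s) 0 i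
      rw [h0, dist_zero_right, dist_zero_right] at this
      exact this.trans (hCu s))
  have hterm : ∀ j, IntegrableOn
      (fun s => 2 ^ j * |cylLift n (u s) (ι j) - w j (s, y s)|) (Ioc 0 T) := fun j =>
    ((huii _ _ _).sub ((hcy (hw j)).integrableOn_Ioc)).abs.const_mul _
  have hcost' : ∑ j ∈ Finset.range N,
      2 ^ j * (∫ s in Ioc 0 T, |cylLift n (u s) (ι j) - w j (s, y s)|) +
      ∫ s in Ioc 0 T, r (s, y s) ≤ K := by
    refine le_trans (le_of_eq ?_) hcostK
    simp_rw [controlCost, cylCost]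
    rw [integral_add (integrable_finsetSum _ fun j _ => hterm j) (hcy hr).integrableOn_Ioc,
      integral_finsetSum _ fun j _ => hterm j]
    simp_rw [integral_const_mul]
  have hr00 : 0 ≤ ∫ s in Ioc 0 T, r (s, y s) := integral_nonneg fun s => hr0 _
  have hs0 : ∀ j, 0 ≤ 2 ^ j * (∫ s in Ioc 0 T, |cylLift n (u s) (ι j) - w j (s, y s)|) :=
    fun j => mul_nonneg (by positivity) (integral_nonneg fun s => abs_nonneg _)
  refine ⟨y, hyc, fun j hj t ht => ?_, ?_⟩
  · have h1 := Finset.single_le_sum (fun j _ => hs0 j) (Finset.mem_range.2 hj)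
    refine le_trans (mul_le_mul_of_nonneg_left ?_ (by positivity)) (h1.trans (by linarith))
    have e1 : y t (ι j) - x₀ (ι j) = ∫ s in 0..t, cylLift n (u s) (ι j) := by
      simp only [hy, cylLift_of_lt (hιn j hj), Pi.add_apply, integral_eval_fin hu]
      ring
    rw [e1, ← intervalIntegral.integral_sub, intervalIntegral.integral_of_le ht.1]
    · refine (abs_integral_le_integral_abs).trans ?_
      exact setIntegral_mono_set ((huii _ _ _).sub ((hcy (hw j)).integrableOn_Ioc)).abs
        (Eventually.of_forall fun s => abs_nonneg _) (Ioc_subset_Ioc_right ht.2).eventuallyLE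
    · exact (intervalIntegrable_iff_integrableOn_Ioc_of_le ht.1).2 (huii _ _ _)
    · exact (hcy (hw j)).intervalIntegrable _ _
  · have := Finset.sum_nonneg (s := Finset.range N) fun j _ => hs0 j
    linarith

end ApproximateCurves

section Compactness

open Set

theorem exists_subseq_tendsto_of_asymptotically_equicontinuous {T : ℝ} (hT : 0 < T)
    (Y : ℕ → ℝ → ℕ → ℝ) (hb : ∀ i, ∃ R, ∀ᶠ N in atTop, ∀ t ∈ Icc 0 T, |Y N t i| ≤ R)
    (he : ∀ i, ∀ ε > 0, ∃ δ > 0, ∀ᶠ N in atTop, ∀ s ∈ Icc 0 T, ∀ t ∈ Icc 0 T,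
      |t - s| ≤ δ → |Y N t i - Y N s i| ≤ ε) :
    ∃ σ : ℕ → ℕ, StrictMono σ ∧ ∃ y : ℝ → ℕ → ℝ, Continuous y ∧
      ∀ t ∈ Icc 0 T, ∀ i, Tendsto (fun k => Y (σ k) t i) atTop (𝓝 (y t i)) := by
  choose R hR using hb
  have : Nonempty (Icc (0 : ℝ) T) := ⟨⟨0, le_refl _, hT.le⟩⟩
  set Q : ℕ → Icc (0 : ℝ) T := TopologicalSpace.denseSeq _ with hQ
  set Z : ℕ → (ℕ × ℕ → ℝ) := fun N p => max (-|R p.2|) (min |R p.2| (Y N (Q p.1) p.2)) with hZ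
  have hZmem : ∀ N, Z N ∈ Set.pi univ fun p : ℕ × ℕ => Icc (-|R p.2|) |R p.2| := fun N p _ =>
    ⟨le_max_left _ _, max_le (neg_le_self (abs_nonneg _)) (min_le_left _ _)⟩
  obtain ⟨z, -, σ, hσ, hz⟩ :=
    (isCompact_univ_pi fun p : ℕ × ℕ => isCompact_Icc (a := -|R p.2|) (b := |R p.2|)).tendsto_subseq
      hZmem
  have hzp : ∀ k i, Tendsto (fun l => Y (σ l) (Q k) i) atTop (𝓝 (z (k, i))) := fun k i => by
    refine Tendsto.congr' ?_ (tendsto_pi_nhds.1 hz (k, i))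
    filter_upwards [hσ.tendsto_atTop.eventually (hR i)] with l hl
    have := abs_le.1 ((hl _ (Q k).2).trans (le_abs_self _))
    simp [hZ, this.1, this.2]
  have hc : ∀ t ∈ Icc 0 T, ∀ i, ∃ a, Tendsto (fun k => Y (σ k) t i) atTop (𝓝 a) := by
    intro t ht i
    refine cauchySeq_tendsto_of_complete (Metric.cauchySeq_iff'.2 fun ε hε => ?_)
    obtain ⟨δ, hδ, hδ'⟩ := he i (ε / 4) (by positivity)
    obtain ⟨k, hk⟩ := (TopologicalSpace.denseRange_denseSeq (Icc (0 : ℝ) T)).exists_dist_lt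
      ⟨t, ht⟩ hδ
    have hk' : |t - Q k| ≤ δ := hk.le
    obtain ⟨N₁, h₁⟩ := eventually_atTop.1 (hσ.tendsto_atTop.eventually hδ')
    obtain ⟨N₂, h₂⟩ := Metric.cauchySeq_iff'.1 (hzp k i).cauchySeq (ε / 4) (by positivity)
    obtain ⟨N₃, h₃⟩ := Metric.cauchySeq_iff.1 (hzp k i).cauchySeq (ε / 4) (by positivity)
    refine ⟨max N₁ N₃, fun l hl => ?_⟩
    have a₁ := h₁ l ((le_max_left _ _).trans hl) _ (Q k).2 t ht hk'
    have a₂ := h₁ _ (le_max_left N₁ N₃) _ (Q k).2 t ht hk'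
    have a₃ := h₃ l ((le_max_right _ _).trans hl) _ (le_max_right N₁ N₃)
    rw [Real.dist_eq] at a₃ ⊢
    rw [abs_le] at a₁ a₂
    rw [abs_lt] at a₃ ⊢
    constructor <;> linarith
  choose! y₀ hy₀ using hc
  have hcont : ∀ i, Continuous fun s : Icc (0 : ℝ) T => y₀ s i := fun i => by
    refine Metric.continuous_iff.2 fun s ε hε => ?_
    obtain ⟨δ, hδ, hδ'⟩ := he i (ε / 2) (by positivity)
    refine ⟨δ, hδ, fun t ht => ?_⟩
    refine lt_of_le_of_lt ?_ (half_lt_self hε)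
    refine le_of_tendsto ((hy₀ t t.2 i).sub (hy₀ s s.2 i)).abs ?_
    filter_upwards [hσ.tendsto_atTop.eventually hδ'] with l hl
    exact hl s s.2 t t.2 (show |(t : ℝ) - s| ≤ δ from ht.le)
  refine ⟨σ, hσ, fun t => y₀ (projIcc 0 T hT.le t), continuous_pi fun i =>
    (hcont i).comp continuous_projIcc, fun t ht i => ?_⟩
  simpa only [projIcc_of_mem hT.le ht] using hy₀ t ht i

end Compactness

section LimitCurve

open Set ProbabilityTheory
open scoped NNReal ENNReal

variable {T : ℝ} {m : Kernel ℝ (ℕ → ℝ)} [IsMarkovKernel m] {x₀ : ℕ → ℝ}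
  {v : ℕ → ℝ × (ℕ → ℝ) → ℝ}

theorem exists_limit_curve (hT : 0 < T) (hv : ∀ i, Integrable (v i) (spaceTime T m))
    (hCE : ∀ n : ℕ, IsVelocity T m (fun x (k : Fin n) => x k) (fun k => x₀ k) (fun k z => v k z))
    {D : ℕ → ℕ} {ι : ℕ → ℕ} (hι : ∀ i k, ∃ j ≥ k, ι j = i) {w : ℕ → ℝ × (ℕ → ℝ) → ℝ}
    (hw : ∀ j, IsCyl (D j) (w j)) {r : ℕ → ℝ × (ℕ → ℝ) → ℝ} (hr : ∀ N, IsCyl N (r N))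
    (hr0 : ∀ N z, 0 ≤ r N z) (hrm : ∀ z, Monotone fun N => r N z) {K K' : ℝ}
    (hK : ∀ N, ∑ j ∈ Finset.range N, 2 ^ j * ∫ z, |v (ι j) z - w j z| ∂(spaceTime T m) +
      ∫ z, r N z ∂(spaceTime T m) ≤ K') (hKK' : K' < K) :
    ∃ y : ℝ → ℕ → ℝ, Continuous y ∧
      (∀ j, ∀ t ∈ Icc 0 T,
        |y t (ι j) - x₀ (ι j) - ∫ s in 0..t, w j (s, y s)| ≤ K / 2 ^ j) ∧
      ∀ N, ∫ s in Ioc 0 T, r N (s, y s) ≤ K := by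
  choose Y hYc hYw hYr using fun N =>
    exists_approximate_curve hT hv hCE (N := N) hw (hr N) (hr0 N) (hK N) hKK'
  choose W hW using fun j => (hw j).1
  have hcY : ∀ {l : ℕ} {w : ℝ × (ℕ → ℝ) → ℝ} {y : ℝ → ℕ → ℝ}, IsCyl l w → Continuous y →
      Continuous fun s => w (s, y s) :=
    fun hw hy => hw.continuous.comp (continuous_id.prodMk hy)
  have hYw' : ∀ N, ∀ j < N, ∀ t ∈ Icc 0 T,
      |Y N t (ι j) - x₀ (ι j) - ∫ s in 0..t, w j (s, Y N s)| ≤ K / 2 ^ j := by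
    intro N j hj t ht
    rw [le_div_iff₀ (by positivity), mul_comm]
    exact hYw N j hj t ht
  have hwint : ∀ j N s t, |∫ r in s..t, w j (r, Y N r)| ≤ W j * |t - s| := fun j N s t => by
    rw [← Real.norm_eq_abs]
    exact intervalIntegral.norm_integral_le_of_norm_le_const fun r _ => hW j _
  have hW0 : ∀ j, 0 ≤ W j := fun j => (abs_nonneg _).trans (hW j 0)
  obtain ⟨σ, hσ, y, hyc, hy⟩ := exists_subseq_tendsto_of_asymptotically_equicontinuous hT Y
    (fun i => by
      obtain ⟨j, -, rfl⟩ := hι i 0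
      refine ⟨|x₀ (ι j)| + W j * T + K / 2 ^ j, ?_⟩
      filter_upwards [eventually_gt_atTop j] with N hN t ht
      have h1 := abs_le.1 (hYw' N j hN t ht)
      have h2 := abs_le.1 (hwint j N 0 t)
      have h3 : W j * |t - 0| ≤ W j * T := by
        rw [sub_zero, abs_of_nonneg ht.1]
        exact mul_le_mul_of_nonneg_left ht.2 (hW0 j)
      have h4 := neg_abs_le (x₀ (ι j))
      have h5 := le_abs_self (x₀ (ι j))
      rw [abs_le]
      constructor <;> linarith)
    (fun i ε hε => by
      obtain ⟨k, hk⟩ := ((tendsto_const_nhds (x := K)).div_atTop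
        (tendsto_pow_atTop_atTop_of_one_lt (one_lt_two (α := ℝ)))).eventually
          (eventually_lt_nhds (show 0 < ε / 4 by positivity)) |>.exists_forall_of_atTop
      obtain ⟨j, hj, rfl⟩ := hι i k
      have hkj := hk j hj
      refine ⟨ε / 2 / (W j + 1), div_pos (by positivity) (by linarith [hW0 j]), ?_⟩
      filter_upwards [eventually_gt_atTop j] with N hN s hs t ht hst
      have h1 := abs_le.1 (hYw' N j hN t ht)
      have h2 := abs_le.1 (hYw' N j hN s hs)
      have h3 := abs_le.1 (hwint j N s t)
      have h4 : (∫ r in 0..t, w j (r, Y N r)) - ∫ r in 0..s, w j (r, Y N r) =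
          ∫ r in s..t, w j (r, Y N r) :=
        intervalIntegral.integral_interval_sub_left
          ((hcY (hw j) (hYc N)).intervalIntegrable _ _)
          ((hcY (hw j) (hYc N)).intervalIntegrable _ _)
      have h5 : W j * |t - s| ≤ ε / 2 := by
        rw [le_div_iff₀ (by linarith [hW0 j])] at hst
        nlinarith [abs_nonneg (t - s)]
      rw [abs_le]
      constructor <;> linarith)
  have hyp : ∀ t ∈ Icc 0 T, Tendsto (fun k => Y (σ k) t) atTop (𝓝 (y t)) := fun t ht =>
    tendsto_pi_nhds.2 (hy t ht)
  have hlim : ∀ {l : ℕ} {w : ℝ × (ℕ → ℝ) → ℝ}, IsCyl l w → ∀ t ∈ Icc 0 T,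
      Tendsto (fun k => ∫ s in 0..t, w (s, Y (σ k) s)) atTop (𝓝 (∫ s in 0..t, w (s, y s))) := by
    intro l w hw t ht
    obtain ⟨C, hC⟩ := hw.1
    refine intervalIntegral.tendsto_integral_filter_of_dominated_convergence (fun _ => C)
      (Eventually.of_forall fun k => (hcY hw (hYc _)).aestronglyMeasurable)
      (Eventually.of_forall fun k => Eventually.of_forall fun s _ => hC _)
      intervalIntegrable_const (Eventually.of_forall fun s hs => ?_)
    rw [uIoc_of_le ht.1] at hs
    exact (hw.continuous.tendsto (s, y s)).comp
      (tendsto_const_nhds.prodMk_nhds (hyp s ⟨hs.1.le, hs.2.trans ht.2⟩))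
  refine ⟨y, hyc, fun j t ht => ?_, fun M => ?_⟩
  · refine le_of_tendsto (((hy t ht (ι j)).sub_const _).sub (hlim (hw j) t ht)).abs ?_
    filter_upwards [hσ.tendsto_atTop.eventually (eventually_gt_atTop j)] with k hk
    exact hYw' _ j hk t ht
  · rw [← intervalIntegral.integral_of_le hT.le]
    refine le_of_tendsto (hlim (hr M) T ⟨hT.le, le_rfl⟩) ?_
    filter_upwards [hσ.tendsto_atTop.eventually (eventually_ge_atTop M)] with k hk
    refine le_trans ?_ (hYr (σ k))
    rw [intervalIntegral.integral_of_le hT.le]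
    exact setIntegral_mono (hcY (hr M) (hYc _)).integrableOn_Ioc
      (hcY (hr _) (hYc _)).integrableOn_Ioc fun s => hrm _ hk

end LimitCurve

section SolutionCurve

open Set ProbabilityTheory
open scoped NNReal ENNReal

variable {T : ℝ} {m : Kernel ℝ (ℕ → ℝ)} [IsMarkovKernel m] {x₀ : ℕ → ℝ}
  {v : ℕ → ℝ × (ℕ → ℝ) → ℝ}

instance (T : ℝ) (m : Kernel ℝ (ℕ → ℝ)) [IsMarkovKernel m] :
    IsFiniteMeasure (spaceTime T m) := by
  unfold spaceTime; infer_instance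

/-- A curve along which a lower semicontinuous majorant of the regularisation errors is integrable
solves the limiting integral equation. -/
theorem exists_curve_of_lowerSemicontinuous (hT : 0 < T) (hvm : ∀ i, Measurable (v i))
    (hv : ∀ i, Integrable (v i) (spaceTime T m))
    (hCE : ∀ n : ℕ, IsVelocity T m (fun x (k : Fin n) => x k) (fun k => x₀ k) (fun k z => v k z))
    {D : ℕ → ℕ} {ι : ℕ → ℕ} (hι : ∀ i k, ∃ j ≥ k, ι j = i) {w : ℕ → ℝ × (ℕ → ℝ) → ℝ}
    (hw : ∀ j, IsCyl (D j) (w j)) {δ : ℝ} (hδ : 0 < δ)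
    (hwδ : ∀ N, ∑ j ∈ Finset.range N, 2 ^ j * ∫ z, |v (ι j) z - w j z| ∂(spaceTime T m) ≤ δ)
    {q : ℝ × (ℕ → ℝ) → ℝ≥0∞} (hq : LowerSemicontinuous q)
    (hqi : ∫⁻ z, q z ∂(spaceTime T m) ≠ ⊤)
    (hle : ∀ z, ∑' j, ENNReal.ofReal |v (ι j) z - w j z| ≤ q z) :
    ∃ y : ℝ → ℕ → ℝ, Continuous y ∧ (∀ i, IntegrableOn (fun s => v i (s, y s)) (Ioc 0 T)) ∧
      (∀ i, ∀ t ∈ Icc 0 T, y t i - x₀ i = ∫ s in 0..t, v i (s, y s)) ∧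
      ∫⁻ s in Ioc 0 T, q (s, y s) ≤ ∫⁻ z, q z ∂(spaceTime T m) + ENNReal.ofReal (2 * δ) := by
  set I := (∫⁻ z, q z ∂(spaceTime T m)).toReal with hI
  have hIr : ∀ N, ∫ z, cylReg q N z ∂(spaceTime T m) ≤ I := fun N => by
    rw [integral_eq_lintegral_of_nonneg_ae (Eventually.of_forall (cylReg_nonneg q N))
      (isCyl_cylReg q N).continuous.measurable.aestronglyMeasurable]
    refine ENNReal.toReal_mono hqi (lintegral_mono fun z => ?_)
    rw [← iSup_cylReg hq z]
    exact le_iSup (fun n => ENNReal.ofReal (cylReg q n z)) N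
  have hI0 : 0 ≤ I := ENNReal.toReal_nonneg
  set K := I + 2 * δ with hKdef
  obtain ⟨y, hyc, hyw, hyr⟩ := exists_limit_curve hT hv hCE hι hw (isCyl_cylReg q)
    (cylReg_nonneg q) (monotone_cylReg q) (K' := I + δ) (K := K)
    (fun N => by linarith [hwδ N, hIr N]) (by linarith)
  have hcy : Continuous fun s => (s, y s) := continuous_id.prodMk hyc
  have hqy : ∫⁻ s in Ioc 0 T, q (s, y s) ≤ ENNReal.ofReal K := by
    simp_rw [← iSup_cylReg hq]
    have hm : ∀ n, Measurable fun s => ENNReal.ofReal (cylReg q n (s, y s)) := fun n =>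
      ((isCyl_cylReg q n).continuous.comp hcy).measurable.ennreal_ofReal
    rw [lintegral_iSup hm (fun k l hkl s => ENNReal.ofReal_le_ofReal (monotone_cylReg q _ hkl))]
    refine iSup_le fun n => ?_
    have hi : IntegrableOn (fun s => cylReg q n (s, y s)) (Ioc 0 T) :=
      ((isCyl_cylReg q n).continuous.comp hcy).integrableOn_Ioc
    rw [← ofReal_integral_eq_lintegral_ofReal hi (Eventually.of_forall fun s => cylReg_nonneg q n _)]
    exact ENNReal.ofReal_le_ofReal (hyr n)
  have hvy : ∀ i, Measurable fun s => v i (s, y s) := fun i => (hvm i).comp hcy.measurable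
  have hwy : ∀ j, Continuous fun s => w j (s, y s) := fun j => (hw j).continuous.comp hcy
  have hdm : ∀ j, Measurable fun s => v (ι j) (s, y s) - w j (s, y s) := fun j =>
    (hvy _).sub (hwy j).measurable
  have hsum : ∑' j, ∫⁻ s in Ioc 0 T, ENNReal.ofReal |v (ι j) (s, y s) - w j (s, y s)| ≠ ⊤ := by
    have hm : ∀ j, Measurable fun s => ENNReal.ofReal |v (ι j) (s, y s) - w j (s, y s)| :=
      fun j => (hdm j).norm.ennreal_ofReal
    rw [← lintegral_tsum fun j => (hm j).aemeasurable]
    exact ne_top_of_le_ne_top ENNReal.ofReal_ne_top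
      ((lintegral_mono fun s => hle (s, y s)).trans hqy)
  have hdi : ∀ j, IntegrableOn (fun s => v (ι j) (s, y s) - w j (s, y s)) (Ioc 0 T) := fun j => by
    refine ⟨(hdm j).aestronglyMeasurable, ?_⟩
    rw [hasFiniteIntegral_iff_norm]
    exact (ENNReal.ne_top_of_tsum_ne_top hsum j).lt_top
  have hvi : ∀ i, IntegrableOn (fun s => v i (s, y s)) (Ioc 0 T) := fun i => by
    obtain ⟨j, -, rfl⟩ := hι i 0
    exact ((hdi j).add (hwy j).integrableOn_Ioc).congr
      (Eventually.of_forall fun s => by simp)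
  have hlim : Tendsto (fun j => K / 2 ^ j +
      ∫ s in Ioc 0 T, |v (ι j) (s, y s) - w j (s, y s)|) atTop (𝓝 0) := by
    have h1 := (tendsto_const_nhds (x := K)).div_atTop
      (tendsto_pow_atTop_atTop_of_one_lt (one_lt_two (α := ℝ)))
    have h2 := (ENNReal.tendsto_toReal ENNReal.zero_ne_top).comp
      (Nat.cofinite_eq_atTop ▸ ENNReal.tendsto_cofinite_zero_of_tsum_ne_top hsum)
    have e : ∀ j, ∫ s in Ioc 0 T, |v (ι j) (s, y s) - w j (s, y s)| =
        (∫⁻ s in Ioc 0 T, ENNReal.ofReal |v (ι j) (s, y s) - w j (s, y s)|).toReal := fun j =>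
      integral_eq_lintegral_of_nonneg_ae (Eventually.of_forall fun s => abs_nonneg _)
        (hdi j).abs.aestronglyMeasurable
    simp_rw [e]
    simpa using h1.add h2
  refine ⟨y, hyc, hvi, fun i t ht => ?_, hqy.trans ?_⟩
  · have key : ∀ j, ι j = i → |y t i - x₀ i - ∫ s in 0..t, v i (s, y s)| ≤
        K / 2 ^ j + ∫ s in Ioc 0 T, |v (ι j) (s, y s) - w j (s, y s)| := by
      rintro j rfl
      have h1 := hyw j t ht
      have h2 : |∫ s in 0..t, (v (ι j) (s, y s) - w j (s, y s))| ≤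
          ∫ s in Ioc 0 T, |v (ι j) (s, y s) - w j (s, y s)| := by
        rw [intervalIntegral.integral_of_le ht.1]
        exact abs_integral_le_integral_abs.trans (setIntegral_mono_set (hdi j).abs
          (Eventually.of_forall fun s => abs_nonneg _) (Ioc_subset_Ioc_right ht.2).eventuallyLE)
      rw [intervalIntegral.integral_sub
        ((intervalIntegrable_iff_integrableOn_Ioc_of_le ht.1).2
          ((hvi _).mono_set (Ioc_subset_Ioc_right ht.2)))
        ((hwy j).intervalIntegrable _ _)] at h2
      rw [abs_le] at h1 h2 ⊢
      constructor <;> linarith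
    have h0 : |y t i - x₀ i - ∫ s in 0..t, v i (s, y s)| ≤ 0 := by
      refine le_of_forall_pos_lt_add fun ε hε => ?_
      obtain ⟨k, hk⟩ := (hlim.eventually (eventually_lt_nhds hε)).exists_forall_of_atTop
      obtain ⟨j, hj, hji⟩ := hι i k
      rw [zero_add]
      exact (key j hji).trans_lt (hk j hj)
    exact sub_eq_zero.1 (abs_nonpos_iff.1 h0)
  · rw [hKdef, ENNReal.ofReal_add hI0 (by positivity), hI, ENNReal.ofReal_toReal hqi]

/-- A superposition-type selection principle on `ℝ^∞`. -/
theorem exists_curve (hT : 0 < T) (hvm : ∀ i, Measurable (v i))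
    (hv : ∀ i, Integrable (v i) (spaceTime T m))
    (hCE : ∀ n : ℕ, IsVelocity T m (fun x (k : Fin n) => x k) (fun k => x₀ k) (fun k z => v k z))
    {f : ℝ × (ℕ → ℝ) → ℝ≥0∞} (hf : Measurable f) (hfi : ∫⁻ z, f z ∂(spaceTime T m) ≠ ⊤)
    {δ : ℝ} (hδ : 0 < δ) :
    ∃ y : ℝ → ℕ → ℝ, Continuous y ∧ y 0 = x₀ ∧
      (∀ i, IntegrableOn (fun s => v i (s, y s)) (Ioc 0 T)) ∧
      (∀ i, ∀ t ∈ Icc 0 T, y t i - x₀ i = ∫ s in 0..t, v i (s, y s)) ∧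
      ∫⁻ s in Ioc 0 T, f (s, y s) ≤ ∫⁻ z, f z ∂(spaceTime T m) + ENNReal.ofReal δ := by
  set δ' := δ / 4 with hδ'
  have hδ'0 : 0 < δ' := by positivity
  set ι : ℕ → ℕ := fun j => (Nat.unpair j).1
  have hι : ∀ i k, ∃ j ≥ k, ι j = i := fun i k =>
    ⟨Nat.pair i k, Nat.right_le_pair i k, by simp [ι]⟩
  choose D w hw hwe using fun j => exists_isCyl_integral_sub_le (hv (ι j))
    (show 0 < δ' / 2 / 2 ^ j / 2 ^ j by positivity)
  have hwm : ∀ j, Measurable (w j) := fun j => (hw j).continuous.measurable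
  have hgeo : ∀ N, ∑ j ∈ Finset.range N, δ' / 2 / 2 ^ j ≤ δ' := fun N =>
    ((summable_geometric_two' δ').sum_le_tsum _ fun j _ => by positivity).trans
      (tsum_geometric_two' δ').le
  have hwδ : ∀ N, ∑ j ∈ Finset.range N, 2 ^ j *
      ∫ z, |v (ι j) z - w j z| ∂(spaceTime T m) ≤ δ' := fun N => by
    refine (Finset.sum_le_sum fun j _ => ?_).trans (hgeo N)
    have := hwe j
    rwa [le_div_iff₀ (by positivity), mul_comm] at this
  have hem : ∀ j, Measurable fun z => ENNReal.ofReal |v (ι j) z - w j z| := fun j =>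
    ((hvm _).sub (hwm j)).norm.ennreal_ofReal
  set e : ℝ × (ℕ → ℝ) → ℝ≥0∞ := fun z => ∑' j, ENNReal.ofReal |v (ι j) z - w j z| with he
  have hemeas : Measurable e := Measurable.tsum hem
  have hei : ∫⁻ z, e z ∂(spaceTime T m) ≤ ENNReal.ofReal δ' := by
    rw [he, lintegral_tsum fun j => (hem j).aemeasurable]
    refine (ENNReal.tsum_le_tsum (g := fun j => ENNReal.ofReal (δ' / 2 / 2 ^ j)) fun j => ?_).trans ?_
    · have hwint : Integrable (w j) (spaceTime T m) := by
        obtain ⟨C, hC⟩ := (hw j).1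
        exact Integrable.of_bound (hwm j).aestronglyMeasurable C (Eventually.of_forall hC)
      have hdi : Integrable (fun z => |v (ι j) z - w j z|) (spaceTime T m) :=
        ((hv _).sub hwint).abs
      rw [← ofReal_integral_eq_lintegral_ofReal hdi
        (Eventually.of_forall fun _ => abs_nonneg _)]
      refine ENNReal.ofReal_le_ofReal ((hwe j).trans (div_le_self (by positivity) ?_))
      exact one_le_pow₀ one_le_two
    · rw [← ENNReal.ofReal_tsum_of_nonneg (fun j => by positivity) (summable_geometric_two' δ'),
        tsum_geometric_two']
  obtain ⟨q, hfq, hq, hqi⟩ := exists_le_lowerSemicontinuous_lintegral_ge (spaceTime T m)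
    (fun z => f z + e z) (hf.add hemeas) (ENNReal.ofReal_pos.2 hδ'0).ne'
  rw [lintegral_add_left hf] at hqi
  have hqi' : ∫⁻ z, q z ∂(spaceTime T m) ≤
      ∫⁻ z, f z ∂(spaceTime T m) + ENNReal.ofReal δ' + ENNReal.ofReal δ' :=
    hqi.trans (by gcongr)
  obtain ⟨y, hyc, hyi, hye, hyq⟩ := exists_curve_of_lowerSemicontinuous hT hvm hv hCE hι hw hδ'0 hwδ
    hq (ne_top_of_le_ne_top (by finiteness) hqi') fun z => le_add_self.trans (hfq z)
  refine ⟨y, hyc, funext fun i => ?_, hyi, hye, ?_⟩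
  · have := hye i 0 ⟨le_rfl, hT.le⟩
    rw [intervalIntegral.integral_same] at this
    linarith
  · calc ∫⁻ s in Ioc 0 T, f (s, y s) ≤ ∫⁻ s in Ioc 0 T, q (s, y s) :=
          lintegral_mono fun s => le_self_add.trans (hfq _)
      _ ≤ _ := hyq.trans (add_le_add_left hqi' _)
      _ = _ := by
        rw [add_assoc, add_assoc, ← ENNReal.ofReal_add hδ'0.le (by positivity),
          ← ENNReal.ofReal_add hδ'0.le (by positivity)]
        congr 2
        rw [hδ']; ring

end SolutionCurve

section Cutoff

/-- Smooth cutoff functions on `ℝ^d`, increasing to `1`. -/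
def cutoff (d n : ℕ) (x : Rd d) : ℝ :=
  (⟨1, 2, one_pos, one_lt_two⟩ : ContDiffBump (0 : Rd d)) (((n : ℝ) + 1)⁻¹ • x)

variable {d : ℕ}

lemma isC2c_cutoff (d n : ℕ) : IsC2c (cutoff d n) := by
  refine ⟨(ContDiffBump.contDiff _).comp (contDiff_const_smul _), ?_⟩
  exact (ContDiffBump.hasCompactSupport _).comp_smul (by positivity)

lemma continuous_cutoff (d n : ℕ) : Continuous (cutoff d n) := (isC2c_cutoff d n).1.continuous

lemma cutoff_nonneg (n : ℕ) (x : Rd d) : 0 ≤ cutoff d n x := ContDiffBump.nonneg _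

lemma cutoff_le_one (n : ℕ) (x : Rd d) : cutoff d n x ≤ 1 := ContDiffBump.le_one _

lemma abs_cutoff_le_one (n : ℕ) (x : Rd d) : |cutoff d n x| ≤ 1 := by
  rw [abs_of_nonneg (cutoff_nonneg n x)]
  exact cutoff_le_one n x

lemma cutoff_eq_one {n : ℕ} {x : Rd d} (h : ‖x‖ ≤ n + 1) : cutoff d n x = 1 := by
  refine ContDiffBump.one_of_mem_closedBall _ ?_
  rw [mem_closedBall_zero_iff, norm_smul, norm_inv, Real.norm_of_nonneg (by positivity)]
  exact (inv_mul_le_one₀ (by positivity)).2 h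

lemma eventually_cutoff_eventuallyEq (x : Rd d) :
    ∀ᶠ n : ℕ in atTop, cutoff d n =ᶠ[𝓝 x] fun _ => 1 := by
  filter_upwards [eventually_ge_atTop ⌈‖x‖⌉₊] with n hn
  have h : ‖x‖ < n + 1 := by
    have := Nat.le_of_ceil_le hn
    linarith
  filter_upwards [continuous_norm.continuousAt.eventually_lt continuousAt_const h] with z hz
  exact cutoff_eq_one hz.le

lemma tendsto_cutoff (x : Rd d) : Tendsto (fun n => cutoff d n x) atTop (𝓝 1) :=
  tendsto_const_nhds.congr' (by
    filter_upwards [eventually_cutoff_eventuallyEq x] with n hn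
    exact hn.eq_of_nhds.symm)

lemma eventually_pd_cutoff (x : Rd d) : ∀ᶠ n : ℕ in atTop, ∀ i, pd (cutoff d n) i x = 0 := by
  filter_upwards [eventually_cutoff_eventuallyEq x] with n hn i
  simp [pd, hn.fderiv_eq]

lemma eventually_pd2_cutoff (x : Rd d) : ∀ᶠ n : ℕ in atTop, ∀ i j, pd2 (cutoff d n) i j x = 0 := by
  filter_upwards [eventually_cutoff_eventuallyEq x] with n hn i j
  have h : (fun y => pd (cutoff d n) j y) =ᶠ[𝓝 x] fun _ => 0 := by
    filter_upwards [hn.eventuallyEq_nhds] with z hz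
    simp [pd, hz.fderiv_eq]
  simp [pd2, h.fderiv_eq]

lemma IsC2c.contDiff_pd {φ : Rd d → ℝ} (hφ : IsC2c φ) (i : Fin d) : ContDiff ℝ 1 (pd φ i) :=
  (hφ.1.fderiv_right (m := 1) (by norm_num)).clm_apply contDiff_const

lemma IsC2c.hasCompactSupport_pd {φ : Rd d → ℝ} (hφ : IsC2c φ) (i : Fin d) :
    HasCompactSupport (pd φ i) := hφ.2.fderiv_apply (𝕜 := ℝ) _

lemma IsC2c.continuous_pd2 {φ : Rd d → ℝ} (hφ : IsC2c φ) (i j : Fin d) :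
    Continuous (pd2 φ i j) :=
  ((hφ.contDiff_pd j).continuous_fderiv one_ne_zero).clm_apply continuous_const

lemma IsC2c.hasCompactSupport_pd2 {φ : Rd d → ℝ} (hφ : IsC2c φ) (i j : Fin d) :
    HasCompactSupport (pd2 φ i j) := (hφ.hasCompactSupport_pd j).fderiv_apply (𝕜 := ℝ) _

lemma exists_bound_finset {ι α : Type*} [Finite ι] {f : ι → α → ℝ}
    (h : ∀ i, ∃ C, ∀ x, |f i x| ≤ C) : ∃ C, ∀ i x, |f i x| ≤ C := by
  choose C hC using h
  obtain ⟨M, hM⟩ := (Set.finite_range C).bddAbove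
  exact ⟨M, fun i x => (hC i x).trans (hM ⟨i, rfl⟩)⟩

lemma IsC2c.exists_bound {φ : Rd d → ℝ} (hφ : IsC2c φ) :
    ∃ M, (∀ x, |φ x| ≤ M) ∧ (∀ i x, |pd φ i x| ≤ M) ∧ ∀ i j x, |pd2 φ i j x| ≤ M := by
  obtain ⟨M₀, h₀⟩ := hφ.2.exists_bound_of_continuous hφ.1.continuous
  obtain ⟨M₁, h₁⟩ := exists_bound_finset (f := pd φ) fun i =>
    (hφ.hasCompactSupport_pd i).exists_bound_of_continuous (hφ.contDiff_pd i).continuous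
  obtain ⟨M₂, h₂⟩ := exists_bound_finset (f := fun p : Fin d × Fin d => pd2 φ p.1 p.2) fun p =>
    (hφ.hasCompactSupport_pd2 p.1 p.2).exists_bound_of_continuous (hφ.continuous_pd2 p.1 p.2)
  exact ⟨max M₀ (max M₁ M₂), fun x => (h₀ x).trans (le_max_left _ _),
    fun i x => (h₁ i x).trans ((le_max_left _ _).trans (le_max_right _ _)),
    fun i j x => (h₂ (i, j) x).trans ((le_max_right _ _).trans (le_max_right _ _))⟩

lemma pd_comp_smul (φ : Rd d → ℝ) (c : ℝ) (i : Fin d) (x : Rd d) :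
    pd (fun y => φ (c • y)) i x = c * pd φ i (c • x) := by
  rw [pd, fderiv_comp_smul]
  rfl

lemma exists_bound_cutoff (d : ℕ) :
    ∃ M, ∀ n, (∀ i x, |pd (cutoff d n) i x| ≤ M) ∧ ∀ i j x, |pd2 (cutoff d n) i j x| ≤ M := by
  have h0 : cutoff d 0 = (⟨1, 2, one_pos, one_lt_two⟩ : ContDiffBump (0 : Rd d)) := by
    ext x; simp [cutoff]
  obtain ⟨M, -, h₁, h₂⟩ := (isC2c_cutoff d 0).exists_bound
  have hc : ∀ n : ℕ, |((n : ℝ) + 1)⁻¹| ≤ 1 := fun n => by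
    rw [abs_of_nonneg (by positivity)]
    exact inv_le_one_of_one_le₀ (by linarith [n.cast_nonneg (α := ℝ)])
  have hpd : ∀ n i, pd (cutoff d n) i =
      fun x => ((n : ℝ) + 1)⁻¹ * pd (cutoff d 0) i (((n : ℝ) + 1)⁻¹ • x) := fun n i => by
    ext x
    rw [← pd_comp_smul, h0]
    rfl
  refine ⟨M, fun n => ⟨fun i x => ?_, fun i j x => ?_⟩⟩
  · rw [hpd, abs_mul]
    exact (mul_le_of_le_one_left (abs_nonneg _) (hc n)).trans (h₁ i _)
  · have e : pd2 (cutoff d n) i j x = ((n : ℝ) + 1)⁻¹ *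
        (((n : ℝ) + 1)⁻¹ * pd2 (cutoff d 0) i j (((n : ℝ) + 1)⁻¹ • x)) := by
      have hd : Differentiable ℝ fun y : Rd d => pd (cutoff d 0) j (((n : ℝ) + 1)⁻¹ • y) :=
        (((isC2c_cutoff d 0).contDiff_pd j).comp (contDiff_const_smul _)).differentiable one_ne_zero
      change fderiv ℝ (pd (cutoff d n) j) x (Pi.single i 1) = _
      rw [hpd, fderiv_const_mul (hd x)]
      exact congrArg _ (pd_comp_smul (pd (cutoff d 0) j) _ i x)
    rw [e, abs_mul, abs_mul]
    exact (mul_le_of_le_one_left (by positivity) (hc n)).trans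
      ((mul_le_of_le_one_left (abs_nonneg _) (hc n)).trans (h₂ i j _))

end Cutoff

section VagueTopology

open Set ContinuousLinearMap
open scoped Convolution NNReal ENNReal CompactlySupported BoundedContinuousFunction

variable {d : ℕ} {g : ℕ → Rd d → ℝ}

instance (μ : SP d) : IsFiniteMeasure μ.1 := ⟨μ.2.trans_lt ENNReal.one_lt_top⟩

lemma SP.integrable (μ : SP d) {f : Rd d → ℝ} (hf : Continuous f) (hc : HasCompactSupport f) :
    Integrable f μ.1 := hf.integrable_of_hasCompactSupport hc

lemma SP.real_univ_le_one (μ : SP d) : μ.1.real univ ≤ 1 :=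
  ENNReal.toReal_le_of_le_ofReal zero_le_one (by simpa using μ.2)

lemma SP.abs_integral_le (μ : SP d) {f : Rd d → ℝ} {M : ℝ} (h0 : 0 ≤ M) (hM : ∀ x, |f x| ≤ M) :
    |∫ x, f x ∂μ.1| ≤ M := by
  rw [← Real.norm_eq_abs]
  exact (norm_integral_le_of_norm_le_const (Eventually.of_forall hM)).trans
    (mul_le_of_le_one_right h0 μ.real_univ_le_one)

lemma SP.abs_integral_sub_le (μ : SP d) {f h : Rd d → ℝ} (hf : Integrable f μ.1)
    (hh : Integrable h μ.1) {M : ℝ} (h0 : 0 ≤ M) (hM : ∀ x, |f x - h x| ≤ M) :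
    |∫ x, f x ∂μ.1 - ∫ x, h x ∂μ.1| ≤ M := by
  rw [← integral_sub hf hh]
  exact μ.abs_integral_le h0 hM

lemma SP.continuous_integral {f : Rd d → ℝ} (hf : Continuous f) (hc : HasCompactSupport f) :
    Continuous fun μ : SP d => ∫ x, f x ∂μ.1 :=
  continuous_iInf_dom (i := ⟨f, hf, hc⟩) continuous_induced_dom

lemma GFamily.integrable (hg : GFamily d g) (i : ℕ) (μ : SP d) : Integrable (g i) μ.1 :=
  μ.integrable (hg.1 i).1.continuous (hg.1 i).2

lemma exists_isC2c_close {f : Rd d → ℝ} (hf : Continuous f) (hc : HasCompactSupport f) {ε : ℝ}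
    (hε : 0 < ε) : ∃ φ, IsC2c φ ∧ ∀ x, |φ x - f x| ≤ ε := by
  have hu := hf.uniformContinuous_of_tendsto_cocompact hc.is_zero_at_infty
  obtain ⟨δ, hδ, hδ'⟩ := Metric.uniformContinuous_iff.1 hu ε hε
  let ρ : ContDiffBump (0 : Rd d) := ⟨δ / 2, δ, by positivity, by linarith⟩
  have h1 : ContDiff ℝ 2 (ρ.normed volume) := ρ.contDiff_normed
  have h2 : HasCompactSupport (ρ.normed volume) := ρ.hasCompactSupport_normed
  have h3 : ∀ x, dist ((ρ.normed volume ⋆[lsmul ℝ ℝ, volume] f) x) (f x) ≤ ε := fun x =>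
    ρ.dist_normed_convolution_le hf.aestronglyMeasurable fun z hz => (hδ' hz).le
  generalize ρ.normed volume = k at h1 h2 h3
  exact ⟨k ⋆[lsmul ℝ ℝ, volume] f,
    ⟨h2.contDiff_convolution_left (lsmul ℝ ℝ : ℝ →L[ℝ] ℝ →L[ℝ] ℝ) h1 hf.locallyIntegrable,
      h2.convolution (lsmul ℝ ℝ : ℝ →L[ℝ] ℝ →L[ℝ] ℝ) hc⟩, h3⟩

lemma GFamily.exists_close (hg : GFamily d g) {f : Rd d → ℝ} (hf : Continuous f)
    (hc : HasCompactSupport f) {ε : ℝ} (hε : 0 < ε) : ∃ i, ∀ x, |g i x - f x| ≤ ε := by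
  obtain ⟨φ, hφ, h⟩ := exists_isC2c_close hf hc (half_pos hε)
  obtain ⟨i, hi, -⟩ := hg.2.2 φ hφ _ (half_pos hε)
  exact ⟨i, fun x => (abs_sub_le _ (φ x) _).trans (by linarith [hi x, h x])⟩

lemma GFamily.exists_integral_close (hg : GFamily d g) {f : Rd d → ℝ} (hf : Continuous f)
    (hc : HasCompactSupport f) {ε : ℝ} (hε : 0 < ε) :
    ∃ i, ∀ μ : SP d, |∫ x, g i x ∂μ.1 - ∫ x, f x ∂μ.1| ≤ ε := by
  obtain ⟨i, hi⟩ := hg.exists_close hf hc hε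
  exact ⟨i, fun μ => μ.abs_integral_sub_le (hg.integrable i μ) (μ.integrable hf hc) hε.le hi⟩

lemma GFamily.continuous_Gmap (hg : GFamily d g) : Continuous (Gmap g) :=
  continuous_pi fun i => SP.continuous_integral (hg.1 i).1.continuous (hg.1 i).2

lemma GFamily.isInducing_Gmap (hg : GFamily d g) : IsInducing (Gmap g) := by
  refine ⟨le_antisymm (continuous_iff_le_induced.1 hg.continuous_Gmap) ?_⟩
  refine le_iInf fun ⟨f, hf, hc⟩ => ?_
  rw [← continuous_iff_le_induced]
  let _ : TopologicalSpace (SP d) := TopologicalSpace.induced (Gmap g) inferInstance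
  have hG : Continuous (Gmap g) := continuous_induced_dom
  refine continuous_of_uniform_approx_of_continuous fun u hu => ?_
  obtain ⟨ε, hε, hεu⟩ := Metric.mem_uniformity_dist.1 hu
  obtain ⟨i, hi⟩ := hg.exists_integral_close hf hc (half_pos hε)
  refine ⟨fun μ => ∫ x, g i x ∂μ.1, (continuous_apply i).comp hG, fun μ => ?_⟩
  refine hεu ?_
  rw [dist_comm, Real.dist_eq]
  exact (hi μ).trans_lt (half_lt_self hε)

lemma SP.ext_of_integral {μ ν : SP d} (h : ∀ f : Rd d → ℝ, Continuous f → HasCompactSupport f →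
    ∫ x, f x ∂μ.1 = ∫ x, f x ∂ν.1) : μ = ν :=
  Subtype.ext (Measure.ext_of_integral_eq_on_compactlySupported fun f =>
    h f f.continuous f.hasCompactSupport)

lemma GFamily.injective_Gmap (hg : GFamily d g) : Function.Injective (Gmap g) := by
  refine fun μ ν h => SP.ext_of_integral fun f hf hc => ?_
  refine eq_of_forall_dist_le fun ε hε => ?_
  obtain ⟨i, hi⟩ := hg.exists_integral_close hf hc (half_pos hε)
  have h1 := hi μ
  have h2 := hi ν
  have h3 : ∫ x, g i x ∂μ.1 = ∫ x, g i x ∂ν.1 := congrFun h i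
  rw [h3] at h1
  rw [Real.dist_eq]
  rw [abs_le] at h1 h2 ⊢
  constructor <;> linarith

/-- A pointwise limit of the integrals against subprobability measures is represented by a
subprobability measure. -/
lemma SP.exists_of_tendsto {μ : ℕ → SP d} (h : ∀ f : Rd d → ℝ, Continuous f →
    HasCompactSupport f → ∃ l, Tendsto (fun n => ∫ x, f x ∂(μ n).1) atTop (𝓝 l)) :
    ∃ ν : SP d, ∀ f : Rd d → ℝ, Continuous f → HasCompactSupport f →
      Tendsto (fun n => ∫ x, f x ∂(μ n).1) atTop (𝓝 (∫ x, f x ∂ν.1)) := by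
  choose L hL using fun f : C_c(Rd d, ℝ) => h f f.continuous f.hasCompactSupport
  have hi : ∀ n (f : C_c(Rd d, ℝ)), Integrable f (μ n).1 := fun n f =>
    (μ n).integrable f.continuous f.hasCompactSupport
  let Λ : C_c(Rd d, ℝ) →ₚ[ℝ] ℝ := PositiveLinearMap.mk₀
    { toFun := L
      map_add' := fun f k => tendsto_nhds_unique (hL (f + k))
        (((hL f).add (hL k)).congr fun n => (integral_add (hi n f) (hi n k)).symm)
      map_smul' := fun c f => tendsto_nhds_unique (hL (c • f))
        (((hL f).const_mul c).congr fun n => (integral_const_mul c _).symm) }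
    fun f hf => ge_of_tendsto' (hL f) fun n => integral_nonneg fun x => hf x
  have hle : RealRMK.rieszMeasure Λ univ ≤ 1 := by
    rw [← Metric.iUnion_closedBall_nat (0 : Rd d), Monotone.measure_iUnion fun m n hmn =>
      Metric.closedBall_subset_closedBall (Nat.cast_le.2 hmn)]
    refine iSup_le fun n => ?_
    let k : C_c(Rd d, ℝ) := ⟨⟨cutoff d n, continuous_cutoff d n⟩, (isC2c_cutoff d n).2⟩
    refine (RealRMK.rieszMeasure_le_of_eq_one Λ (f := k) (cutoff_nonneg n)
      (isCompact_closedBall 0 (n : ℝ)) fun x hx => cutoff_eq_one ?_).trans ?_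
    · linarith [mem_closedBall_zero_iff.1 hx]
    · refine ENNReal.ofReal_le_one.2 (le_of_tendsto' (hL k) fun m => ?_)
      exact (le_abs_self _).trans
        ((μ m).abs_integral_le zero_le_one fun x => abs_cutoff_le_one n x)
  refine ⟨⟨RealRMK.rieszMeasure Λ, hle⟩, fun f hf hc => ?_⟩
  have := RealRMK.integral_rieszMeasure Λ ⟨⟨f, hf⟩, hc⟩
  refine Eq.subst (motive := fun l => Tendsto _ _ (𝓝 l)) this.symm (hL ⟨⟨f, hf⟩, hc⟩)

lemma GFamily.isClosedEmbedding_Gmap (hg : GFamily d g) : IsClosedEmbedding (Gmap g) := by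
  refine ⟨⟨hg.isInducing_Gmap, hg.injective_Gmap⟩, isClosed_of_closure_subset fun y hy => ?_⟩
  obtain ⟨z, hz, hzy⟩ := mem_closure_iff_seq_limit.1 hy
  choose μ hμ using hz
  obtain ⟨ν, hν⟩ := SP.exists_of_tendsto (μ := μ) fun f hf hc => by
    refine cauchySeq_tendsto_of_complete (Metric.cauchySeq_iff.2 fun ε hε => ?_)
    obtain ⟨i, hi⟩ := hg.exists_integral_close hf hc (show 0 < ε / 4 by positivity)
    obtain ⟨N, hN⟩ := Metric.cauchySeq_iff.1 (tendsto_pi_nhds.1 hzy i).cauchySeq (ε / 4)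
      (by positivity)
    refine ⟨N, fun m hm n hn => ?_⟩
    have h1 := hi (μ m)
    have h2 := hi (μ n)
    have h3 := hN m hm n hn
    rw [← hμ, ← hμ, Real.dist_eq, Gmap, Gmap, abs_lt] at h3
    rw [abs_le] at h1 h2
    rw [Real.dist_eq, abs_lt]
    constructor <;> linarith
  refine ⟨ν, tendsto_nhds_unique (tendsto_pi_nhds.2 fun i => ?_) hzy⟩
  simp_rw [← hμ]
  exact hν _ (hg.1 i).1.continuous (hg.1 i).2

end VagueTopology

section MeasurabilityOfMeasures

open Set ProbabilityTheory
open scoped NNReal ENNReal BoundedContinuousFunction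

variable {d : ℕ} {g : ℕ → Rd d → ℝ}

/-- A family of finite measures whose integrals against bounded continuous functions are measurable
is measurable. -/
lemma measurable_of_measurable_integral {α X : Type*} [MeasurableSpace α] [TopologicalSpace X]
    [MeasurableSpace X] [BorelSpace X] [HasOuterApproxClosed X] {m : α → Measure X}
    [∀ a, IsFiniteMeasure (m a)]
    (h : ∀ f : X →ᵇ ℝ, Measurable fun a => ∫ x, f x ∂(m a)) : Measurable m := by
  have key : ∀ F : Set X, IsClosed F → Measurable fun a => m a F := by
    intro F hF
    refine measurable_of_tendsto_metrizable (f := fun n a => ∫⁻ x, hF.apprSeq n x ∂(m a))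
      (fun n => ?_) (tendsto_pi_nhds.2 fun a => HasOuterApproxClosed.tendsto_lintegral_apprSeq hF _)
    let k : X →ᵇ ℝ := BoundedContinuousFunction.ofNormedAddCommGroup
      (fun x => (hF.apprSeq n x : ℝ)) (NNReal.continuous_coe.comp (hF.apprSeq n).continuous) 1
      fun x => by simpa using HasOuterApproxClosed.apprSeq_apply_le_one hF n x
    have hk : (fun a => ∫⁻ x, hF.apprSeq n x ∂(m a)) = fun a => ENNReal.ofReal (∫ x, k x ∂(m a)) := by
      funext a
      rw [ofReal_integral_eq_lintegral_ofReal (k.integrable _)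
        (Eventually.of_forall fun x => NNReal.coe_nonneg _)]
      exact lintegral_congr fun x => (ENNReal.ofReal_coe_nnreal).symm
    rw [hk]
    exact ENNReal.measurable_ofReal.comp (h k)
  refine Measurable.measure_of_isPiSystem (S := {s | IsClosed s})
    (by rw [BorelSpace.measurable_eq (α := X), borel_eq_generateFrom_isClosed]) isPiSystem_isClosed
    (fun s hs => key s hs) (key _ isClosed_univ)

lemma SP.measurable_val : Measurable fun μ : SP d => μ.1 := by
  refine measurable_of_measurable_integral fun f => ?_
  refine measurable_of_tendsto_metrizable
    (f := fun n (μ : SP d) => ∫ x, f x * cutoff d n x ∂μ.1) (fun n => ?_)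
    (tendsto_pi_nhds.2 fun μ => ?_)
  · exact (SP.continuous_integral (f.continuous.mul (continuous_cutoff d n))
      ((isC2c_cutoff d n).2.mul_left)).measurable
  · refine tendsto_integral_of_dominated_convergence (fun x => ‖f x‖)
      (fun n => (f.continuous.mul (continuous_cutoff d n)).aestronglyMeasurable)
      (f.integrable μ.1).norm (fun n => Eventually.of_forall fun x => ?_)
      (Eventually.of_forall fun x => ?_)
    · rw [norm_mul]
      exact mul_le_of_le_one_right (norm_nonneg _) (abs_cutoff_le_one n x)
    · simpa using (tendsto_cutoff x).const_mul (f x)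

variable (d) in
/-- The tautological kernel from subprobability measures to the underlying space. -/
def SP.kernel : Kernel (SP d) (Rd d) := ⟨fun μ => μ.1, SP.measurable_val⟩

instance : IsFiniteKernel (SP.kernel d) := ⟨1, ENNReal.one_lt_top, fun μ => μ.2⟩

lemma GFamily.secondCountableTopology (hg : GFamily d g) : SecondCountableTopology (SP d) :=
  hg.isInducing_Gmap.secondCountableTopology

lemma GFamily.metrizableSpace (hg : GFamily d g) : TopologicalSpace.MetrizableSpace (SP d) :=
  hg.isClosedEmbedding_Gmap.isEmbedding.metrizableSpace

lemma GFamily.measurableEmbedding_Gmap (hg : GFamily d g) : MeasurableEmbedding (Gmap g) :=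
  hg.isClosedEmbedding_Gmap.measurableEmbedding

/-- A left inverse of the global chart `Gmap g`. -/
def Gmap.inv (g : ℕ → Rd d → ℝ) : (ℕ → ℝ) → SP d :=
  Function.extend (Gmap g) id fun _ => ⟨0, by simp⟩

lemma GFamily.measurable_inv (hg : GFamily d g) : Measurable (Gmap.inv g) :=
  hg.measurableEmbedding_Gmap.measurable_extend measurable_id measurable_const

lemma GFamily.inv_Gmap (hg : GFamily d g) (μ : SP d) : Gmap.inv g (Gmap g μ) = μ :=
  hg.injective_Gmap.extend_apply _ _ _

/-- The total absolute size of the coefficients integrated against the measure variable. -/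
def coeffSize (a : ℝ → SP d → Rd d → Fin d → Fin d → ℝ) (b : ℝ → SP d → Rd d → Fin d → ℝ)
    (z : ℝ × SP d) : ℝ≥0∞ :=
  ∫⁻ x, ENNReal.ofReal ((∑ i, |b z.1 z.2 x i|) + ∑ i, ∑ j, |a z.1 z.2 x i j|) ∂z.2.1

/-- The drift of the coordinate `μ ↦ ∫ φ dμ`. -/
def meanLop (a : ℝ → SP d → Rd d → Fin d → Fin d → ℝ) (b : ℝ → SP d → Rd d → Fin d → ℝ)
    (φ : Rd d → ℝ) (z : ℝ × SP d) : ℝ :=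
  ∫ x, Lop a b z.1 z.2 φ x ∂z.2.1

variable {a : ℝ → SP d → Rd d → Fin d → Fin d → ℝ} {b : ℝ → SP d → Rd d → Fin d → ℝ}
  {φ ψ : Rd d → ℝ}

lemma IsC2c.measurable_Lop (hab : GoodCoeffs d a b) (hφ : IsC2c φ) :
    Measurable fun p : ℝ × SP d × Rd d => Lop a b p.1 p.2.1 φ p.2.2 := by
  unfold Lop
  refine (Finset.measurable_sum _ fun i _ => Finset.measurable_sum _ fun j _ => ?_).add
    (Finset.measurable_sum _ fun i _ => ?_)
  · exact (hab.1 i j).mul ((hφ.continuous_pd2 i j).measurable.comp (by fun_prop))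
  · exact (hab.2.1 i).mul ((hφ.contDiff_pd i).continuous.measurable.comp (by fun_prop))

lemma GoodCoeffs.measurable_size (hab : GoodCoeffs d a b) : Measurable fun p : ℝ × SP d × Rd d =>
    (∑ i, |b p.1 p.2.1 p.2.2 i|) + ∑ i, ∑ j, |a p.1 p.2.1 p.2.2 i j| :=
  (Finset.measurable_sum _ fun i _ => measurable_abs.comp (hab.2.1 i)).add
    (Finset.measurable_sum _ fun i _ => Finset.measurable_sum _ fun j _ =>
      measurable_abs.comp (hab.1 i j))

lemma GoodCoeffs.measurable_coeffSize (hab : GoodCoeffs d a b) : Measurable (coeffSize a b) :=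
  Measurable.lintegral_kernel_prod_right' (κ := (SP.kernel d).prodMkLeft ℝ)
    (f := fun q : (ℝ × SP d) × Rd d =>
      ENNReal.ofReal ((∑ i, |b q.1.1 q.1.2 q.2 i|) + ∑ i, ∑ j, |a q.1.1 q.1.2 q.2 i j|))
    (ENNReal.measurable_ofReal.comp
      (hab.measurable_size.comp (f := fun q : (ℝ × SP d) × Rd d => (q.1.1, q.1.2, q.2))
        (by fun_prop)))

lemma IsC2c.measurable_meanLop (hab : GoodCoeffs d a b) (hφ : IsC2c φ) :
    Measurable (meanLop a b φ) :=
  (StronglyMeasurable.integral_kernel_prod_right' (κ := (SP.kernel d).prodMkLeft ℝ)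
    (f := fun q : (ℝ × SP d) × Rd d => Lop a b q.1.1 q.1.2 φ q.2)
    ((hφ.measurable_Lop hab).comp (f := fun q : (ℝ × SP d) × Rd d => (q.1.1, q.1.2, q.2))
        (by fun_prop)).stronglyMeasurable).measurable

lemma abs_Lop_le {M : ℝ} {x : Rd d} (h1 : ∀ i, |pd φ i x| ≤ M) (h2 : ∀ i j, |pd2 φ i j x| ≤ M)
    (t : ℝ) (μ : SP d) :
    |Lop a b t μ φ x| ≤ M * ((∑ i, |b t μ x i|) + ∑ i, ∑ j, |a t μ x i j|) := by
  rw [mul_add, Finset.mul_sum, Finset.mul_sum, add_comm]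
  refine (abs_add_le _ _).trans (add_le_add ?_ ?_)
  · refine (Finset.abs_sum_le_sum_abs _ _).trans (Finset.sum_le_sum fun i _ => ?_)
    rw [Finset.mul_sum]
    refine (Finset.abs_sum_le_sum_abs _ _).trans (Finset.sum_le_sum fun j _ => ?_)
    rw [abs_mul, mul_comm]
    exact mul_le_mul_of_nonneg_right (h2 i j) (abs_nonneg _)
  · refine (Finset.abs_sum_le_sum_abs _ _).trans (Finset.sum_le_sum fun i _ => ?_)
    rw [abs_mul, mul_comm]
    exact mul_le_mul_of_nonneg_right (h1 i) (abs_nonneg _)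

lemma pd_sub (hφ : IsC2c φ) (hψ : IsC2c ψ) (i : Fin d) (y : Rd d) :
    pd (fun y => φ y - ψ y) i y = pd φ i y - pd ψ i y := by
  unfold pd
  rw [fderiv_fun_sub (hφ.1.differentiable two_ne_zero y) (hψ.1.differentiable two_ne_zero y)]
  rfl

lemma pd2_sub (hφ : IsC2c φ) (hψ : IsC2c ψ) (i j : Fin d) (x : Rd d) :
    pd2 (fun y => φ y - ψ y) i j x = pd2 φ i j x - pd2 ψ i j x := by
  unfold pd2
  simp only [pd_sub hφ hψ]
  rw [fderiv_fun_sub ((hφ.contDiff_pd j).differentiable one_ne_zero x)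
    ((hψ.contDiff_pd j).differentiable one_ne_zero x)]
  rfl

lemma Lop_sub (hφ : IsC2c φ) (hψ : IsC2c ψ) (t : ℝ) (μ : SP d) (x : Rd d) :
    Lop a b t μ (fun y => φ y - ψ y) x = Lop a b t μ φ x - Lop a b t μ ψ x := by
  simp only [Lop, pd_sub hφ hψ, pd2_sub hφ hψ, mul_sub, Finset.sum_sub_distrib]
  ring

lemma lintegral_enorm_Lop_le {M : ℝ} (hM : 0 ≤ M) (h1 : ∀ i x, |pd φ i x| ≤ M)
    (h2 : ∀ i j x, |pd2 φ i j x| ≤ M) (t : ℝ) (μ : SP d) (ρ : Measure (Rd d)) :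
    ∫⁻ x, ‖Lop a b t μ φ x‖ₑ ∂ρ ≤ ENNReal.ofReal M *
      ∫⁻ x, ENNReal.ofReal ((∑ i, |b t μ x i|) + ∑ i, ∑ j, |a t μ x i j|) ∂ρ := by
  rw [← lintegral_const_mul' _ _ ENNReal.ofReal_ne_top]
  refine lintegral_mono fun x => ?_
  rw [← ENNReal.ofReal_mul hM, Real.enorm_eq_ofReal_abs]
  exact ENNReal.ofReal_le_ofReal (abs_Lop_le (fun i => h1 i x) (fun i j => h2 i j x) _ _)

lemma enorm_meanLop_le {M : ℝ} (hM : 0 ≤ M) (h1 : ∀ i x, |pd φ i x| ≤ M)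
    (h2 : ∀ i j x, |pd2 φ i j x| ≤ M) (z : ℝ × SP d) :
    ‖meanLop a b φ z‖ₑ ≤ ENNReal.ofReal M * coeffSize a b z :=
  (enorm_integral_le_lintegral_enorm _).trans (lintegral_enorm_Lop_le hM h1 h2 _ _ _)

lemma IsC2c.integrable_Lop (hab : GoodCoeffs d a b) (hφ : IsC2c φ) {z : ℝ × SP d}
    (hz : coeffSize a b z ≠ ∞) : Integrable (Lop a b z.1 z.2 φ) z.2.1 := by
  obtain ⟨M, h0, h1, h2⟩ := hφ.exists_bound
  have hM : 0 ≤ M := (abs_nonneg _).trans (h0 0)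
  refine ⟨((hφ.measurable_Lop hab).comp (f := fun x : Rd d => (z.1, z.2, x))
    (by fun_prop)).aestronglyMeasurable, ?_⟩
  exact (lintegral_enorm_Lop_le hM h1 h2 _ _ _).trans_lt
    (ENNReal.mul_lt_top ENNReal.ofReal_lt_top hz.lt_top)

lemma abs_meanLop_sub_le (hab : GoodCoeffs d a b) (hφ : IsC2c φ) (hψ : IsC2c ψ) {ε : ℝ}
    (hε : 0 ≤ ε) (h : C2Close φ ψ ε) {z : ℝ × SP d} (hz : coeffSize a b z ≠ ∞) :
    |meanLop a b φ z - meanLop a b ψ z| ≤ ε * (coeffSize a b z).toReal := by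
  have h1 : meanLop a b (fun y => φ y - ψ y) z = meanLop a b φ z - meanLop a b ψ z := by
    unfold meanLop
    simp_rw [Lop_sub hφ hψ]
    exact integral_sub (hφ.integrable_Lop hab hz) (hψ.integrable_Lop hab hz)
  have h2 := enorm_meanLop_le (a := a) (b := b) (φ := fun y => φ y - ψ y) hε
    (fun i x => by rw [pd_sub hφ hψ]; exact h.2.1 i x)
    (fun i j x => by rw [pd2_sub hφ hψ]; exact h.2.2 i j x) z
  have h3 := ENNReal.toReal_mono (ENNReal.mul_ne_top ENNReal.ofReal_ne_top hz) h2
  rwa [toReal_enorm, Real.norm_eq_abs, ENNReal.toReal_mul, ENNReal.toReal_ofReal hε, h1] at h3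

lemma IsC2c.integrable_meanLop (hab : GoodCoeffs d a b) (hφ : IsC2c φ) {ρ : Measure (ℝ × SP d)}
    (hρ : ∫⁻ z, coeffSize a b z ∂ρ ≠ ∞) : Integrable (meanLop a b φ) ρ := by
  obtain ⟨M, h0, h1, h2⟩ := hφ.exists_bound
  have hM : 0 ≤ M := (abs_nonneg _).trans (h0 0)
  refine ⟨(hφ.measurable_meanLop hab).aestronglyMeasurable, ?_⟩
  refine (lintegral_mono (enorm_meanLop_le hM h1 h2)).trans_lt ?_
  rw [lintegral_const_mul' _ _ ENNReal.ofReal_ne_top]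
  exact ENNReal.mul_lt_top ENNReal.ofReal_lt_top hρ.lt_top

end MeasurabilityOfMeasures

section ChainRule

open Set
open scoped NNReal

variable {n : ℕ} {h : (Fin n → ℝ) → ℝ}

lemma fderiv_apply_eq_sum_pd (h : (Fin n → ℝ) → ℝ) (x v : Fin n → ℝ) :
    fderiv ℝ h x v = ∑ k, pd h k x * v k := by
  conv_lhs => rw [← Finset.univ_sum_single v]
  rw [map_sum]
  refine Finset.sum_congr rfl fun k _ => ?_
  have h1 : Pi.single k (v k) = v k • (Pi.single k 1 : Fin n → ℝ) := by
    rw [← Pi.single_smul, smul_eq_mul, mul_one]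
  rw [h1, map_smul, smul_eq_mul, mul_comm, pd]

lemma IsC2b.exists_dist_le (hh : IsC2b h) :
    ∃ C, ∀ x y, dist (h x) (h y) ≤ C * ∑ k, dist (x k) (y k) := by
  obtain ⟨hc, M, hM⟩ := hh
  have hM0 : 0 ≤ M := (abs_nonneg _).trans (hM 0).1
  have hb : ∀ x, ‖fderiv ℝ h x‖ ≤ ∑ _k : Fin n, M := fun x => by
    refine ContinuousLinearMap.opNorm_le_bound _ (Finset.sum_nonneg fun _ _ => hM0) fun v => ?_
    rw [fderiv_apply_eq_sum_pd, Finset.sum_mul]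
    refine (norm_sum_le _ _).trans (Finset.sum_le_sum fun k _ => ?_)
    rw [norm_mul]
    exact mul_le_mul ((hM x).2.1 k) (norm_le_pi_norm v k) (norm_nonneg _) hM0
  refine ⟨∑ _k : Fin n, M, fun x y => ?_⟩
  have h1 := convex_univ.norm_image_sub_le_of_norm_fderiv_le (𝕜 := ℝ)
    (fun x _ => hc.differentiable two_ne_zero x) (fun x _ => hb x) (mem_univ y) (mem_univ x)
  rw [← dist_eq_norm, ← dist_eq_norm] at h1
  refine h1.trans (mul_le_mul_of_nonneg_left ?_ (Finset.sum_nonneg fun _ _ => hM0))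
  refine (dist_pi_le_iff (Finset.sum_nonneg fun _ _ => dist_nonneg)).2 fun k => ?_
  exact Finset.single_le_sum (f := fun k => dist (x k) (y k)) (fun _ _ => dist_nonneg)
    (Finset.mem_univ k)

lemma IsC2b.absolutelyContinuousOnInterval_comp (hh : IsC2b h) {y : ℝ → Fin n → ℝ} {a b : ℝ}
    (hy : ∀ k, AbsolutelyContinuousOnInterval (fun t => y t k) a b) :
    AbsolutelyContinuousOnInterval (fun t => h (y t)) a b := by
  obtain ⟨C, hC⟩ := hh.exists_dist_le
  have h1 := (tendsto_finsetSum Finset.univ fun k _ => hy k).const_mul C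
  rw [Finset.sum_const_zero, mul_zero] at h1
  refine squeeze_zero (fun E => Finset.sum_nonneg fun _ _ => dist_nonneg) (fun E => ?_) h1
  rw [Finset.sum_comm, Finset.mul_sum]
  exact Finset.sum_le_sum fun i _ => hC _ _

/-- Product and chain rule for primitives of integrable functions. -/
lemma IsC2b.mul_comp_sub_eq_integral (hh : IsC2b h) {T : ℝ} {A α : ℝ → ℝ} {y β : ℝ → Fin n → ℝ}
    (hα : IntegrableOn α (Ioc 0 T)) (hβ : ∀ k, IntegrableOn (fun s => β s k) (Ioc 0 T))
    (hA : ∀ t ∈ Icc 0 T, A t - A 0 = ∫ s in 0..t, α s)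
    (hy : ∀ k, ∀ t ∈ Icc 0 T, y t k - y 0 k = ∫ s in 0..t, β s k) {t : ℝ} (ht : t ∈ Icc 0 T) :
    A t * h (y t) - A 0 * h (y 0) =
      ∫ s in 0..t, (h (y s) * α s + A s * ∑ k, pd h k (y s) * β s k) := by
  have hi : ∀ {f : ℝ → ℝ}, IntegrableOn f (Ioc 0 T) → IntervalIntegrable f volume 0 t :=
    fun {f} hf => (intervalIntegrable_iff_integrableOn_Ioc_of_le ht.1).2
      (hf.mono_set (Ioc_subset_Ioc_right ht.2))
  have h0 : (0 : ℝ) ∈ uIcc 0 t := left_mem_uIcc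
  let A' : ℝ → ℝ := fun u => A 0 + ∫ s in 0..u, α s
  let y' : ℝ → Fin n → ℝ := fun u k => y 0 k + ∫ s in 0..u, β s k
  have hAc : ∀ c : ℝ, AbsolutelyContinuousOnInterval (fun _ => c) 0 t := fun c =>
    ((LipschitzWith.const c).lipschitzOnWith (s := uIcc 0 t)).absolutelyContinuousOnInterval
  have hA' : AbsolutelyContinuousOnInterval A' 0 t :=
    (hAc _).fun_add ((hi hα).absolutelyContinuousOnInterval_intervalIntegral h0)
  have hy' : ∀ k, AbsolutelyContinuousOnInterval (fun u => y' u k) 0 t := fun k =>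
    (hAc _).fun_add ((hi (hβ k)).absolutelyContinuousOnInterval_intervalIntegral h0)
  have hAA : ∀ u ∈ Icc 0 T, A u = A' u := fun u hu => by
    simp only [A', ← hA u hu]; ring
  have hyy : ∀ u ∈ Icc 0 T, y u = y' u := fun u hu => by
    funext k; simp only [y', ← hy k u hu]; ring
  have h0T : (0 : ℝ) ∈ Icc 0 T := ⟨le_rfl, ht.1.trans ht.2⟩
  have hprod := (hA'.fun_mul (hh.absolutelyContinuousOnInterval_comp hy')).integral_deriv_eq_sub
  rw [hAA t ht, hAA 0 h0T, hyy t ht, hyy 0 h0T, ← hprod]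
  refine intervalIntegral.integral_congr_ae ?_
  have hβ' : ∀ᵐ s, ∀ k, s ∈ uIcc 0 t → ∀ c ∈ uIcc 0 t,
      HasDerivAt (fun u => ∫ s in c..u, β s k) (β s k) s :=
    ae_all_iff.2 fun k => (hi (hβ k)).ae_hasDerivAt_integral
  filter_upwards [(hi hα).ae_hasDerivAt_integral, hβ'] with s hs1 hs2 hs
  have hs' := uIoc_subset_uIcc hs
  have hsT : s ∈ Icc 0 T := by
    rw [uIcc_of_le ht.1] at hs'
    exact ⟨hs'.1, hs'.2.trans ht.2⟩
  have d1 : HasDerivAt A' (α s) s := (hs1 hs' 0 h0).const_add _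
  have d2 : HasDerivAt y' (β s) s := hasDerivAt_pi.2 fun k => (hs2 k hs' 0 h0).const_add _
  have d3 := (hh.1.differentiable two_ne_zero (y' s)).hasFDerivAt.comp_hasDerivAt s d2
  rw [fderiv_apply_eq_sum_pd] at d3
  rw [hAA s hsT, hyy s hsT]
  refine (d1.mul d3).deriv.trans ?_
  simp only [Function.comp]
  ring

end ChainRule

section Curves

open Set ProbabilityTheory
open scoped NNReal ENNReal

variable {d : ℕ} {T : ℝ} {μ ν : ℝ → SP d}
  {a : ℝ → SP d → Rd d → Fin d → Fin d → ℝ} {b : ℝ → SP d → Rd d → Fin d → ℝ}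

lemma WeaklyContinuousOn.continuousOn {s : Set ℝ} (hν : WeaklyContinuousOn ν s) :
    ContinuousOn ν s := by
  rw [continuousOn_iff_continuous_domRestrict]
  refine continuous_iInf_rng.2 fun ⟨f, hf, hc⟩ => continuous_induced_rng.2 ?_
  obtain ⟨M, hM⟩ := hc.exists_bound_of_continuous hf
  exact continuousOn_iff_continuous_domRestrict.1 (hν f hf ⟨M, hM⟩)

lemma ContinuousOn.comp_projIcc {X : Type*} [TopologicalSpace X] {γ : ℝ → X}
    (hγ : ContinuousOn γ (Icc 0 T)) (hT : 0 ≤ T) :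
    Continuous fun t => γ (projIcc 0 T hT t) :=
  (continuousOn_iff_continuous_domRestrict.1 hγ).comp continuous_projIcc

lemma projIcc_coe_of_mem (hT : 0 ≤ T) {t : ℝ} (ht : t ∈ Icc 0 T) :
    (projIcc 0 T hT t : ℝ) = t := by
  rw [projIcc_of_mem hT ht]

/-- The kernel of the measures along a measurable curve. -/
def curveKernel (hν : Measurable ν) : Kernel ℝ (Rd d) :=
  ⟨fun t => (ν t).1, SP.measurable_val.comp hν⟩

instance (hν : Measurable ν) : IsFiniteKernel (curveKernel hν) :=
  ⟨1, ENNReal.one_lt_top, fun t => (ν t).2⟩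

lemma measurable_lintegral_curve (hμ : Measurable μ) (hν : Measurable ν)
    {u : ℝ × SP d × Rd d → ℝ≥0∞} (hu : Measurable u) :
    Measurable fun t => ∫⁻ x, u (t, μ t, x) ∂(ν t).1 :=
  Measurable.lintegral_kernel_prod_right' (κ := curveKernel hν)
    (f := fun q : ℝ × Rd d => u (q.1, μ q.1, q.2)) (hu.comp (by fun_prop))

lemma measurable_integral_curve (hμ : Measurable μ) (hν : Measurable ν)
    {u : ℝ × SP d × Rd d → ℝ} (hu : Measurable u) :
    Measurable fun t => ∫ x, u (t, μ t, x) ∂(ν t).1 :=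
  (StronglyMeasurable.integral_kernel_prod_right' (κ := curveKernel hν)
    (f := fun q : ℝ × Rd d => u (q.1, μ q.1, q.2))
    (hu.comp (by fun_prop)).stronglyMeasurable).measurable

lemma aemeasurable_lintegral_curve (hT : 0 ≤ T) (hμ : ContinuousOn μ (Icc 0 T))
    (hν : ContinuousOn ν (Icc 0 T)) {u : ℝ × SP d × Rd d → ℝ≥0∞} (hu : Measurable u) :
    AEMeasurable (fun t => ∫⁻ x, u (t, μ t, x) ∂(ν t).1) (volume.restrict (Ioc 0 T)) := by
  refine ⟨_, measurable_lintegral_curve (hμ.comp_projIcc hT).measurable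
    (hν.comp_projIcc hT).measurable hu, ?_⟩
  filter_upwards [ae_restrict_mem measurableSet_Ioc] with t ht
  rw [projIcc_coe_of_mem hT (Ioc_subset_Icc_self ht)]

lemma aemeasurable_integral_curve (hT : 0 ≤ T) (hμ : ContinuousOn μ (Icc 0 T))
    (hν : ContinuousOn ν (Icc 0 T)) {u : ℝ × SP d × Rd d → ℝ} (hu : Measurable u) :
    AEMeasurable (fun t => ∫ x, u (t, μ t, x) ∂(ν t).1) (volume.restrict (Ioc 0 T)) := by
  refine ⟨_, measurable_integral_curve (hμ.comp_projIcc hT).measurable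
    (hν.comp_projIcc hT).measurable hu, ?_⟩
  filter_upwards [ae_restrict_mem measurableSet_Ioc] with t ht
  rw [projIcc_coe_of_mem hT (Ioc_subset_Icc_self ht)]

lemma sum_abs_coeff_le (u : Fin d → ℝ) (w : Fin d → Fin d → ℝ) :
    (∑ i, |u i|) + ∑ i, ∑ j, |w i j| ≤ ∑ i, ∑ j, (|w i j| + |u i|) := by
  simp_rw [Finset.sum_add_distrib]
  rw [add_comm]
  refine add_le_add le_rfl (Finset.sum_le_sum fun i _ => ?_)
  exact Finset.single_le_sum (f := fun _ : Fin d => |u i|) (fun _ _ => abs_nonneg _)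
    (Finset.mem_univ i)

lemma lintegral_sum_coeff_lt_top (hT : 0 ≤ T) (hab : GoodCoeffs d a b)
    (hμ : ContinuousOn μ (Icc 0 T)) (hν : ContinuousOn ν (Icc 0 T))
    (h : ∀ i j, ∫⁻ t in Ioc 0 T,
      ∫⁻ x, ENNReal.ofReal (|a t (μ t) x i j| + |b t (μ t) x i|) ∂(ν t).1 < ⊤) :
    ∫⁻ t in Ioc 0 T, ∫⁻ x, ENNReal.ofReal (∑ i, ∑ j, (|a t (μ t) x i j| + |b t (μ t) x i|))
      ∂(ν t).1 < ⊤ := by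
  have hm : ∀ i j, Measurable fun p : ℝ × SP d × Rd d =>
      ENNReal.ofReal (|a p.1 p.2.1 p.2.2 i j| + |b p.1 p.2.1 p.2.2 i|) := fun i j =>
    ENNReal.measurable_ofReal.comp
      ((measurable_abs.comp (hab.1 i j)).add (measurable_abs.comp (hab.2.1 i)))
  have hx : ∀ t i j, Measurable fun x : Rd d =>
      ENNReal.ofReal (|a t (μ t) x i j| + |b t (μ t) x i|) := fun t i j =>
    (hm i j).comp (f := fun x : Rd d => (t, μ t, x)) (by fun_prop)
  have h1 : ∀ t, ∫⁻ x, ENNReal.ofReal (∑ i, ∑ j, (|a t (μ t) x i j| + |b t (μ t) x i|)) ∂(ν t).1 =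
      ∑ i, ∑ j, ∫⁻ x, ENNReal.ofReal (|a t (μ t) x i j| + |b t (μ t) x i|) ∂(ν t).1 := fun t => by
    have h2 : ∀ x, ENNReal.ofReal (∑ i, ∑ j, (|a t (μ t) x i j| + |b t (μ t) x i|)) =
        ∑ i, ∑ j, ENNReal.ofReal (|a t (μ t) x i j| + |b t (μ t) x i|) := fun x => by
      rw [ENNReal.ofReal_sum_of_nonneg fun i _ => Finset.sum_nonneg fun j _ => by positivity]
      refine Finset.sum_congr rfl fun i _ => ?_
      rw [ENNReal.ofReal_sum_of_nonneg fun j _ => by positivity]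
    simp_rw [h2]
    rw [lintegral_finsetSum _ fun i _ => Finset.measurable_sum _ fun j _ => hx t i j]
    exact Finset.sum_congr rfl fun i _ => lintegral_finsetSum _ fun j _ => hx t i j
  simp_rw [h1]
  have h3 : ∀ i j, AEMeasurable (fun t =>
      ∫⁻ x, ENNReal.ofReal (|a t (μ t) x i j| + |b t (μ t) x i|) ∂(ν t).1)
      (volume.restrict (Ioc 0 T)) := fun i j => aemeasurable_lintegral_curve hT hμ hν (hm i j)
  rw [lintegral_finsetSum' _ fun i _ => Finset.aemeasurable_fun_sum _ fun j _ => h3 i j]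
  refine ENNReal.sum_lt_top.2 fun i _ => ?_
  rw [lintegral_finsetSum' _ fun j _ => h3 i j]
  exact ENNReal.sum_lt_top.2 fun j _ => h i j

lemma lintegral_size_lt_top
    (h : ∫⁻ t in Ioc 0 T, ∫⁻ x, ENNReal.ofReal (∑ i, ∑ j, (|a t (μ t) x i j| + |b t (μ t) x i|))
      ∂(ν t).1 < ⊤) :
    ∫⁻ t in Ioc 0 T, ∫⁻ x, ENNReal.ofReal
      ((∑ i, |b t (μ t) x i|) + ∑ i, ∑ j, |a t (μ t) x i j|) ∂(ν t).1 < ⊤ :=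
  (lintegral_mono fun _ => lintegral_mono fun _ =>
    ENNReal.ofReal_le_ofReal (sum_abs_coeff_le _ _)).trans_lt h

variable {φ : Rd d → ℝ}

lemma IsC2c.ae_integrable_Lop_curve (hT : 0 ≤ T) (hab : GoodCoeffs d a b) (hφ : IsC2c φ)
    (hμ : ContinuousOn μ (Icc 0 T)) (hν : ContinuousOn ν (Icc 0 T))
    (h : ∫⁻ t in Ioc 0 T, ∫⁻ x, ENNReal.ofReal
      ((∑ i, |b t (μ t) x i|) + ∑ i, ∑ j, |a t (μ t) x i j|) ∂(ν t).1 < ⊤) :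
    ∀ᵐ t ∂(volume.restrict (Ioc 0 T)), Integrable (fun x => Lop a b t (μ t) φ x) (ν t).1 := by
  obtain ⟨M, h0, h1, h2⟩ := hφ.exists_bound
  have hM : 0 ≤ M := (abs_nonneg _).trans (h0 0)
  filter_upwards [ae_lt_top' (aemeasurable_lintegral_curve hT hμ hν
    (ENNReal.measurable_ofReal.comp hab.measurable_size)) h.ne] with t ht
  refine ⟨((hφ.measurable_Lop hab).comp (f := fun x : Rd d => (t, μ t, x))
    (by fun_prop)).aestronglyMeasurable, ?_⟩
  exact (lintegral_enorm_Lop_le hM h1 h2 t _ _).trans_lt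
    (ENNReal.mul_lt_top ENNReal.ofReal_lt_top ht)

lemma IsC2c.integrableOn_integral_Lop_curve (hT : 0 ≤ T) (hab : GoodCoeffs d a b) (hφ : IsC2c φ)
    (hμ : ContinuousOn μ (Icc 0 T)) (hν : ContinuousOn ν (Icc 0 T))
    (h : ∫⁻ t in Ioc 0 T, ∫⁻ x, ENNReal.ofReal
      ((∑ i, |b t (μ t) x i|) + ∑ i, ∑ j, |a t (μ t) x i j|) ∂(ν t).1 < ⊤) :
    IntegrableOn (fun t => ∫ x, Lop a b t (μ t) φ x ∂(ν t).1) (Ioc 0 T) := by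
  obtain ⟨M, h0, h1, h2⟩ := hφ.exists_bound
  have hM : 0 ≤ M := (abs_nonneg _).trans (h0 0)
  refine ⟨(aemeasurable_integral_curve hT hμ hν (hφ.measurable_Lop hab)).aestronglyMeasurable, ?_⟩
  refine (lintegral_mono fun t => (enorm_integral_le_lintegral_enorm _).trans
    (lintegral_enorm_Lop_le hM h1 h2 t _ _)).trans_lt ?_
  rw [lintegral_const_mul' _ _ ENNReal.ofReal_ne_top]
  exact ENNReal.mul_lt_top ENNReal.ofReal_lt_top h

end Curves

section Existence

open Set ProbabilityTheory
open scoped NNReal ENNReal BoundedContinuousFunction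

variable {d : ℕ} {T : ℝ} {μ ν : ℝ → SP d} {g : ℕ → Rd d → ℝ}
  {a : ℝ → SP d → Rd d → Fin d → Fin d → ℝ} {b : ℝ → SP d → Rd d → Fin d → ℝ}

lemma GFamily.lintegral_prod_dirac (hg : GFamily d g) (ρ : Measure (Rd d)) [SFinite ρ] (m : SP d)
    (f : Rd d × SP d → ℝ≥0∞) :
    ∫⁻ p, f p ∂(ρ.prod (Measure.dirac m)) = ∫⁻ x, f (x, m) ∂ρ := by
  have := hg.metrizableSpace
  rw [Measure.prod_dirac]
  exact (measurableEmbedding_prod_mk_right m).lintegral_map _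

lemma GFamily.integral_prod_dirac (hg : GFamily d g) (ρ : Measure (Rd d)) [SFinite ρ] (m : SP d)
    (f : Rd d × SP d → ℝ) :
    ∫ p, f p ∂(ρ.prod (Measure.dirac m)) = ∫ x, f (x, m) ∂ρ := by
  have := hg.metrizableSpace
  rw [Measure.prod_dirac]
  exact (measurableEmbedding_prod_mk_right m).integral_map _

lemma measurableSet_isProbability : MeasurableSet {p : Rd d × SP d | p.2.1 univ = 1} :=
  ((Measure.measurable_coe MeasurableSet.univ).comp (SP.measurable_val.comp measurable_snd))
    (measurableSet_singleton 1)

lemma GFamily.continuousOn_integral_prod_dirac (hg : GFamily d g) (hT : 0 ≤ T)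
    (hμ : ContinuousOn μ (Icc 0 T)) (hν : WeaklyContinuousOn ν (Icc 0 T))
    (hν1 : ∀ t ∈ Icc 0 T, (ν t).1 univ = 1) {Φ : Rd d × SP d → ℝ} (hΦ : Continuous Φ)
    (hb : ∃ M, ∀ p, |Φ p| ≤ M) :
    ContinuousOn (fun t => ∫ p, Φ p ∂((ν t).1.prod (Measure.dirac (μ t)))) (Icc 0 T) := by
  have := hg.metrizableSpace
  have := hg.secondCountableTopology
  obtain ⟨M, hM⟩ := hb
  let k : Rd d × SP d →ᵇ ℝ := BoundedContinuousFunction.ofNormedAddCommGroup Φ hΦ M hM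
  let N : ℝ → ProbabilityMeasure (Rd d) := fun t =>
    ⟨(ν (projIcc 0 T hT t)).1, ⟨hν1 _ (projIcc 0 T hT t).2⟩⟩
  have hN : Continuous N := ProbabilityMeasure.continuous_iff_forall_continuous_integral.2 fun f =>
    (hν f f.continuous ⟨‖f‖, f.norm_coe_le_norm⟩).comp_projIcc hT
  have hprod := ProbabilityMeasure.continuous_prod.comp
    (hN.prodMk (continuous_diracProba.comp (hμ.comp_projIcc hT)))
  have h := ProbabilityMeasure.continuous_iff_forall_continuous_integral.1 hprod k
  refine h.continuousOn.congr fun t ht => ?_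
  simp only [Function.comp, N, k, projIcc_coe_of_mem hT ht]
  rfl

lemma IsSubprobSolution.lintegral_size_lt_top (hT : 0 ≤ T) (hab : GoodCoeffs d a b)
    (hμ : IsSubprobSolution d T a b μ) : ∫⁻ t in Ioc 0 T, coeffSize a b (t, μ t) < ⊤ :=
  _root_.lintegral_size_lt_top (lintegral_sum_coeff_lt_top hT hab hμ.1 hμ.1 hμ.2.1)

theorem isProdCESolution_prod_dirac (hT : 0 ≤ T) (hab : GoodCoeffs d a b) (hg : GFamily d g)
    (hμ : IsProbSolution d T a b μ) (hν : IsLinearizedSolution d T a b μ ν) :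
    IsProdCESolution d T a b g fun t => (ν t).1.prod (Measure.dirac (μ t)) := by
  have hμc := hμ.1.1
  have hνc := hν.2.1.continuousOn
  have hsum := lintegral_sum_coeff_lt_top hT hab hμc hνc hν.2.2.1
  have hsize := lintegral_size_lt_top hsum
  have hμsize := hμ.1.lintegral_size_lt_top hT hab
  refine ⟨fun t ht => ⟨?_, ?_⟩, fun Φ hΦ hb =>
    hg.continuousOn_integral_prod_dirac hT hμc hν.2.1 hν.1 hΦ hb, ?_, ?_,
    fun φ hφ n f hf t ht => ?_⟩
  · have : IsProbabilityMeasure (ν t).1 := ⟨hν.1 t ht⟩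
    infer_instance
  · beta_reduce
    rw [Measure.prod_dirac, Measure.map_apply (by fun_prop) measurableSet_isProbability]
    have : (fun x : Rd d => (x, μ t)) ⁻¹' {p | p.2.1 univ = 1} = univ :=
      eq_univ_of_forall fun x => hμ.2.1 t ht
    rw [this, hν.1 t ht]
  · simp_rw [hg.lintegral_prod_dirac]
    exact hsum
  · refine lt_of_eq_of_lt (setLIntegral_congr_fun measurableSet_Ioc fun t ht => ?_) hμsize
    have : IsProbabilityMeasure (ν t).1 := ⟨hν.1 t (Ioc_subset_Icc_self ht)⟩
    have hsnd : ((ν t).1.prod (Measure.dirac (μ t))).map Prod.snd = Measure.dirac (μ t) :=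
      Measure.snd_prod
    beta_reduce
    rw [hsnd]
    exact lintegral_dirac' _ (hab.measurable_coeffSize.comp (f := fun m => (t, m)) (by fun_prop))
  · simp_rw [hg.integral_prod_dirac]
    have hrule := hf.mul_comp_sub_eq_integral (A := fun t => ∫ x, φ x ∂(ν t).1)
      (y := fun t (k : Fin n) => ∫ x, g k x ∂(μ t).1)
      (hφ.integrableOn_integral_Lop_curve hT hab hμc hνc hsize)
      (fun k => (hg.1 k).integrableOn_integral_Lop_curve hT hab hμc hμc hμsize)
      (hν.2.2.2 φ hφ) (fun k => hμ.1.2.2 _ (hg.1 k)) ht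
    simp_rw [integral_mul_const]
    refine hrule.trans (intervalIntegral.integral_congr_ae ?_)
    rw [uIoc_of_le ht.1]
    have hae := hφ.ae_integrable_Lop_curve hT hab hμc hνc hsize
    rw [ae_restrict_iff' measurableSet_Ioc] at hae
    filter_upwards [hae] with s hs hst
    have hsT := hs ⟨hst.1, hst.2.trans ht.2⟩
    have hφi : Integrable φ (ν s).1 := (ν s).integrable hφ.1.continuous hφ.2
    rw [integral_add (hsT.const_mul _) (hφi.mul_const _), integral_const_mul, integral_mul_const]
    rfl

end Existence

section ProductSolutions

open Set ProbabilityTheory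
open scoped NNReal ENNReal BoundedContinuousFunction

variable {d : ℕ} {T : ℝ} {g : ℕ → Rd d → ℝ} {Λ Λ' : ℝ → Measure (Rd d × SP d)}
  {M : Kernel ℝ (Rd d × SP d)}
  {a : ℝ → SP d → Rd d → Fin d → Fin d → ℝ} {b : ℝ → SP d → Rd d → Fin d → ℝ} {φ : Rd d → ℝ}

lemma IsProdCESolution.congr (hT : 0 ≤ T) (h : IsProdCESolution d T a b g Λ)
    (hΛ : ∀ t ∈ Icc 0 T, Λ' t = Λ t) : IsProdCESolution d T a b g Λ' := by
  obtain ⟨h1, h2, h3, h4, h5⟩ := h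
  have hΛ' : ∀ t ∈ Ioc 0 T, Λ' t = Λ t := fun t ht => hΛ t (Ioc_subset_Icc_self ht)
  refine ⟨fun t ht => by rw [hΛ t ht]; exact h1 t ht, fun Φ hc hb =>
    (h2 Φ hc hb).congr fun t ht => by simp only [hΛ t ht], ?_, ?_, fun φ hφ n f hf t ht => ?_⟩
  · rwa [setLIntegral_congr_fun measurableSet_Ioc fun t ht => by rw [hΛ' t ht]]
  · rwa [setLIntegral_congr_fun measurableSet_Ioc fun t ht => by rw [hΛ' t ht]]
  · rw [hΛ t ht, hΛ 0 ⟨le_rfl, hT⟩, h5 φ hφ n f hf t ht]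
    refine intervalIntegral.integral_congr fun s hs => ?_
    rw [uIcc_of_le ht.1] at hs
    simp only [hΛ s ⟨hs.1, hs.2.trans ht.2⟩]

lemma IsProdCESolution.exists_kernel (hT : 0 ≤ T) (hg : GFamily d g)
    (h : IsProdCESolution d T a b g Λ) :
    ∃ M : Kernel ℝ (Rd d × SP d), IsMarkovKernel M ∧ (∀ t ∈ Icc 0 T, M t = Λ t) ∧
      IsProdCESolution d T a b g M := by
  have := hg.metrizableSpace
  have := hg.secondCountableTopology
  have hp : ∀ t, IsProbabilityMeasure (Λ (projIcc 0 T hT t)) := fun t =>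
    (h.1 _ (projIcc 0 T hT t).2).1
  let M : Kernel ℝ (Rd d × SP d) := ⟨fun t => Λ (projIcc 0 T hT t),
    measurable_of_measurable_integral fun f =>
      ((h.2.1 f f.continuous ⟨‖f‖, f.norm_coe_le_norm⟩).comp_projIcc hT).measurable⟩
  have hM : ∀ t ∈ Icc 0 T, M t = Λ t := fun t ht => by
    change Λ (projIcc 0 T hT t) = Λ t
    rw [projIcc_coe_of_mem hT ht]
  exact ⟨M, ⟨hp⟩, hM, h.congr hT hM⟩

variable [IsMarkovKernel M]

lemma IsProdCESolution.integrable_size (hab : GoodCoeffs d a b)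
    (h : IsProdCESolution d T a b g M) :
    Integrable (fun z => (∑ i, |b z.1 z.2.2 z.2.1 i|) + ∑ i, ∑ j, |a z.1 z.2.2 z.2.1 i j|)
      (spaceTime T M) := by
  have hm := hab.measurable_size.comp
    (f := fun z : ℝ × Rd d × SP d => (z.1, z.2.2, z.2.1)) (by fun_prop)
  refine ⟨hm.aestronglyMeasurable, ?_⟩
  rw [hasFiniteIntegral_iff_ofReal (Eventually.of_forall fun z => by positivity)]
  refine lt_of_eq_of_lt (Measure.lintegral_compProd (ENNReal.measurable_ofReal.comp hm)) ?_
  exact (lintegral_mono fun _ => lintegral_mono fun _ =>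
    ENNReal.ofReal_le_ofReal (sum_abs_coeff_le _ _)).trans_lt h.2.2.1

lemma IsProdCESolution.lintegral_coeffSize_ne_top (hab : GoodCoeffs d a b)
    (h : IsProdCESolution d T a b g M) :
    ∫⁻ z, coeffSize a b (z.1, z.2.2) ∂(spaceTime T M) ≠ ∞ := by
  refine (lt_of_eq_of_lt ((Measure.lintegral_compProd (hab.measurable_coeffSize.comp
    (f := fun z : ℝ × Rd d × SP d => (z.1, z.2.2)) (by fun_prop))).trans
    (lintegral_congr fun t => ?_)) h.2.2.2.1).ne
  exact (lintegral_map (hab.measurable_coeffSize.comp (f := fun m : SP d => (t, m)) (by fun_prop))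
    measurable_snd).symm

lemma IsC2c.measurable_Lop_swap (hab : GoodCoeffs d a b) (hφ : IsC2c φ) :
    Measurable fun z : ℝ × Rd d × SP d => Lop a b z.1 z.2.2 φ z.2.1 :=
  (hφ.measurable_Lop hab).comp (f := fun z : ℝ × Rd d × SP d => (z.1, z.2.2, z.2.1)) (by fun_prop)

lemma IsProdCESolution.integrable_Lop (hab : GoodCoeffs d a b)
    (h : IsProdCESolution d T a b g M) (hφ : IsC2c φ) :
    Integrable (fun z => Lop a b z.1 z.2.2 φ z.2.1) (spaceTime T M) := by
  obtain ⟨C, h0, h1, h2⟩ := hφ.exists_bound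
  exact ((h.integrable_size hab).const_mul C).mono' (hφ.measurable_Lop_swap hab).aestronglyMeasurable
    (Eventually.of_forall fun z => abs_Lop_le (fun i => h1 i _) (fun i j => h2 i j _) _ _)

lemma IsProdCESolution.integrable_meanLop (hab : GoodCoeffs d a b)
    (h : IsProdCESolution d T a b g M) (hφ : IsC2c φ) :
    Integrable (fun z => meanLop a b φ (z.1, z.2.2)) (spaceTime T M) := by
  have hm : Measurable fun z : ℝ × Rd d × SP d => (z.1, z.2.2) := by fun_prop
  refine (hφ.integrable_meanLop hab
    (ρ := (spaceTime T M).map fun z => (z.1, z.2.2)) ?_).comp_measurable hm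
  rw [lintegral_map hab.measurable_coeffSize hm]
  exact h.lintegral_coeffSize_ne_top hab

lemma GFamily.continuous_coords (hg : GFamily d g) (n : ℕ) :
    Continuous fun (m : SP d) (k : Fin n) => ∫ x, g k x ∂m.1 :=
  continuous_pi fun k => (continuous_apply (k : ℕ)).comp hg.continuous_Gmap

lemma GFamily.continuous_Fof (hg : GFamily d g) {n : ℕ} {f : (Fin n → ℝ) → ℝ} (hf : IsC2b f) :
    Continuous (Fof g f) :=
  hf.1.continuous.comp (hg.continuous_coords n)

lemma IsProdCESolution.integrable_bL (hab : GoodCoeffs d a b) (hg : GFamily d g)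
    (h : IsProdCESolution d T a b g M) {n : ℕ} {f : (Fin n → ℝ) → ℝ} (hf : IsC2b f) :
    Integrable (fun z => bL a b g f z.1 z.2.2) (spaceTime T M) := by
  obtain ⟨C, hC⟩ := hf.2
  refine integrable_finsetSum _ fun k _ => ?_
  have hpd : Continuous fun x => pd f k x :=
    (hf.1.continuous_fderiv two_ne_zero).clm_apply continuous_const
  exact integrable_bdd_mul ((hpd.comp (hg.continuous_coords n)).measurable.comp
    (f := fun z : ℝ × Rd d × SP d => z.2.2) (by fun_prop)) (fun z => (hC _).2.1 k)
    (h.integrable_meanLop hab (hg.1 k))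

lemma intervalIntegral_eq_spaceTime {f : ℝ × Rd d × SP d → ℝ} (hf : Integrable f (spaceTime T M))
    {t : ℝ} (ht : t ∈ Icc 0 T) :
    ∫ s in (0 : ℝ)..t, ∫ p, f (s, p) ∂(M s) = ∫ z in {z | z.1 ≤ t}, f z ∂(spaceTime T M) := by
  have hs : {z : ℝ × Rd d × SP d | z.1 ≤ t} = Iic t ×ˢ univ := by ext; simp
  rw [hs, Measure.setIntegral_compProd measurableSet_Iic MeasurableSet.univ hf.integrableOn,
    Measure.restrict_restrict measurableSet_Iic, intervalIntegral.integral_of_le ht.1]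
  have : Iic t ∩ Ioc 0 T = Ioc 0 t := by
    ext s
    simp only [mem_inter_iff, mem_Iic, mem_Ioc]
    exact ⟨fun h => ⟨h.2.1, h.1⟩, fun h => ⟨h.2, h.1, h.2.trans ht.2⟩⟩
  simp only [this, Measure.restrict_univ]

lemma IsProdCESolution.integral_mul_Fof_sub (hab : GoodCoeffs d a b) (hg : GFamily d g)
    (h : IsProdCESolution d T a b g M) (hφ : IsC2c φ) {n : ℕ} {f : (Fin n → ℝ) → ℝ}
    (hf : IsC2b f) {t : ℝ} (ht : t ∈ Icc 0 T) :
    ∫ p, φ p.1 * Fof g f p.2 ∂(M t) - ∫ p, φ p.1 * Fof g f p.2 ∂(M 0) =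
      ∫ z in {z | z.1 ≤ t}, (Fof g f z.2.2 * Lop a b z.1 z.2.2 φ z.2.1 +
        φ z.2.1 * bL a b g f z.1 z.2.2) ∂(spaceTime T M) := by
  obtain ⟨C, hC⟩ := hf.2
  obtain ⟨D, hD, -, -⟩ := hφ.exists_bound
  have h1 : Integrable (fun z => Fof g f z.2.2 * Lop a b z.1 z.2.2 φ z.2.1) (spaceTime T M) :=
    integrable_bdd_mul ((hg.continuous_Fof hf).measurable.comp
      (f := fun z : ℝ × Rd d × SP d => z.2.2) (by fun_prop)) (fun z => (hC _).1)
      (h.integrable_Lop hab hφ)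
  have h2 : Integrable (fun z => φ z.2.1 * bL a b g f z.1 z.2.2) (spaceTime T M) :=
    integrable_bdd_mul (hφ.1.continuous.measurable.comp
      (f := fun z : ℝ × Rd d × SP d => z.2.1) (by fun_prop)) (fun z => hD _)
      (h.integrable_bL hab hg hf)
  rw [h.2.2.2.2 φ hφ n f hf t ht]
  exact intervalIntegral_eq_spaceTime (h1.add h2) ht

lemma Lop_cutoff_eventually (t : ℝ) (m : SP d) (x : Rd d) :
    ∀ᶠ n in atTop, Lop a b t m (cutoff d n) x = 0 := by
  filter_upwards [eventually_pd_cutoff x, eventually_pd2_cutoff x] with n h1 h2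
  simp [Lop, h1, h2]

/-- The measure component of a solution on the product space solves the continuity equation. -/
lemma IsProdCESolution.integral_Fof_sub (hab : GoodCoeffs d a b) (hg : GFamily d g)
    (h : IsProdCESolution d T a b g M) {n : ℕ} {f : (Fin n → ℝ) → ℝ} (hf : IsC2b f) {t : ℝ}
    (ht : t ∈ Icc 0 T) :
    ∫ p, Fof g f p.2 ∂(M t) - ∫ p, Fof g f p.2 ∂(M 0) =
      ∫ z in {z | z.1 ≤ t}, bL a b g f z.1 z.2.2 ∂(spaceTime T M) := by
  obtain ⟨C, hC⟩ := hf.2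
  have hC0 : 0 ≤ C := (abs_nonneg _).trans (hC 0).1
  obtain ⟨D, hD⟩ := exists_bound_cutoff d
  have hFm := (hg.continuous_Fof hf).measurable
  have hlim : ∀ s, Tendsto (fun k => ∫ p, cutoff d k p.1 * Fof g f p.2 ∂(M s)) atTop
      (𝓝 (∫ p, Fof g f p.2 ∂(M s))) := fun s => by
    refine tendsto_integral_of_dominated_convergence (fun _ => C) (fun k =>
      (((continuous_cutoff d k).measurable.comp measurable_fst).mul
        (hFm.comp measurable_snd)).aestronglyMeasurable) (integrable_const _)
      (fun k => Eventually.of_forall fun p => ?_) (Eventually.of_forall fun p => ?_)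
    · rw [norm_mul]
      exact (mul_le_of_le_one_left (norm_nonneg _) (abs_cutoff_le_one k _)).trans (hC _).1
    · simpa using (tendsto_cutoff p.1).mul_const (Fof g f p.2)
  have hbL := h.integrable_bL hab hg hf
  have hrhs : Tendsto (fun k => ∫ z in {z | z.1 ≤ t}, (Fof g f z.2.2 *
      Lop a b z.1 z.2.2 (cutoff d k) z.2.1 + cutoff d k z.2.1 * bL a b g f z.1 z.2.2)
        ∂(spaceTime T M)) atTop
      (𝓝 (∫ z in {z | z.1 ≤ t}, bL a b g f z.1 z.2.2 ∂(spaceTime T M))) := by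
    refine tendsto_integral_of_dominated_convergence (fun z => C * (D *
      ((∑ i, |b z.1 z.2.2 z.2.1 i|) + ∑ i, ∑ j, |a z.1 z.2.2 z.2.1 i j|)) +
      ‖bL a b g f z.1 z.2.2‖) (fun k => ?_)
      ((((h.integrable_size hab).const_mul D).const_mul C).add hbL.norm).restrict
      (fun k => Eventually.of_forall fun z => ?_) (Eventually.of_forall fun z => ?_)
    · exact (((hFm.comp (f := fun z : ℝ × Rd d × SP d => z.2.2) (by fun_prop)).mul
        ((isC2c_cutoff d k).measurable_Lop_swap hab)).aestronglyMeasurable.add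
        (((continuous_cutoff d k).measurable.comp (f := fun z : ℝ × Rd d × SP d => z.2.1)
          (by fun_prop)).aestronglyMeasurable.mul hbL.1)).restrict
    · refine (norm_add_le _ _).trans (add_le_add ?_ ?_)
      · rw [norm_mul]
        exact mul_le_mul (hC _).1 (abs_Lop_le (fun i => (hD k).1 i _) (fun i j => (hD k).2 i j _)
          _ _) (norm_nonneg _) hC0
      · rw [norm_mul]
        exact mul_le_of_le_one_left (norm_nonneg _) (abs_cutoff_le_one k _)
    · refine Tendsto.congr' ?_ (by
        simpa using (tendsto_cutoff z.2.1).mul_const (bL a b g f z.1 z.2.2))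
      filter_upwards [Lop_cutoff_eventually z.1 z.2.2 z.2.1] with k hk
      rw [hk, mul_zero, zero_add]
  refine tendsto_nhds_unique ((hlim t).sub (hlim 0)) (hrhs.congr fun k => ?_)
  exact (h.integral_mul_Fof_sub hab hg (isC2c_cutoff d k) hf ht).symm

end ProductSolutions

section CurvesOfMeasures

open Set ProbabilityTheory
open scoped NNReal ENNReal

variable {d : ℕ} {T : ℝ} {g : ℕ → Rd d → ℝ}
  {a : ℝ → SP d → Rd d → Fin d → Fin d → ℝ} {b : ℝ → SP d → Rd d → Fin d → ℝ} {φ : Rd d → ℝ}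

lemma mem_of_ae_mem_Ioc {X : Type*} [TopologicalSpace X] {y : ℝ → X} (hT : 0 < T)
    (hy : Continuous y) {s : Set X} (hs : IsClosed s)
    (h : ∀ᵐ t ∂(volume.restrict (Ioc 0 T)), y t ∈ s) {t : ℝ} (ht : t ∈ Icc 0 T) : y t ∈ s := by
  by_contra hts
  rw [← closure_Ioo hT.ne] at ht
  obtain ⟨r, hr⟩ := mem_closure_iff.1 ht (y ⁻¹' sᶜ) (hs.isOpen_compl.preimage hy) hts
  have hopen : IsOpen (y ⁻¹' sᶜ ∩ Ioo 0 T) := (hs.isOpen_compl.preimage hy).inter isOpen_Ioo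
  refine (hopen.measure_pos volume ⟨r, hr⟩).ne' ?_
  rw [ae_restrict_iff' measurableSet_Ioc] at h
  rw [measure_eq_zero_iff_ae_notMem]
  filter_upwards [h] with q hq hq'
  exact hq'.1 (hq (Ioo_subset_Ioc_self hq'.2))

/-- A curve of measures along which the chart coordinates follow the drift solves the nonlinear
equation. -/
lemma isSubprobSolution_of_coords (hab : GoodCoeffs d a b) (hg : GFamily d g)
    {μ : ℝ → SP d} (hμ : ContinuousOn μ (Icc 0 T)) (hm : Measurable μ)
    (hsize : ∫⁻ s in Ioc 0 T, coeffSize a b (s, μ s) ≠ ∞)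
    (heq : ∀ i, ∀ t ∈ Icc 0 T, ∫ x, g i x ∂(μ t).1 - ∫ x, g i x ∂(μ 0).1 =
      ∫ s in (0 : ℝ)..t, meanLop a b (g i) (s, μ s)) :
    IsSubprobSolution d T a b μ := by
  refine ⟨hμ, fun i j => ?_, fun φ hφ t ht => ?_⟩
  · refine (lintegral_mono fun s => lintegral_mono fun x => ENNReal.ofReal_le_ofReal ?_).trans_lt
      hsize.lt_top
    rw [add_comm]
    refine add_le_add (Finset.single_le_sum (f := fun i => |b s (μ s) x i|)
      (fun _ _ => abs_nonneg _) (Finset.mem_univ i)) ?_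
    exact (Finset.single_le_sum (f := fun j => |a s (μ s) x i j|)
      (fun _ _ => abs_nonneg _) (Finset.mem_univ j)).trans
      (Finset.single_le_sum (f := fun i => ∑ j, |a s (μ s) x i j|)
      (fun _ _ => Finset.sum_nonneg fun _ _ => abs_nonneg _) (Finset.mem_univ i))
  · have hpair : Measurable fun s => (s, μ s) := measurable_id.prodMk hm
    have hsm := hab.measurable_coeffSize.comp hpair
    have hint : ∀ {ψ : Rd d → ℝ}, IsC2c ψ →
        IntegrableOn (fun s => meanLop a b ψ (s, μ s)) (Ioc 0 T) := fun hψ => by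
      refine (hψ.integrable_meanLop hab (ρ := (volume.restrict (Ioc 0 T)).map fun s => (s, μ s))
        ?_).comp_measurable hpair
      rwa [lintegral_map hab.measurable_coeffSize hpair]
    have hfin : ∀ᵐ s ∂(volume.restrict (Ioc 0 T)), coeffSize a b (s, μ s) < ∞ :=
      ae_lt_top hsm hsize
    have hsub : Ioc 0 t ⊆ Ioc 0 T := Ioc_subset_Ioc_right ht.2
    have hK : IntegrableOn (fun s => (coeffSize a b (s, μ s)).toReal) (Ioc 0 T) :=
      integrable_toReal_of_lintegral_ne_top hsm.aemeasurable hsize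
    unfold NLFPKEq
    change _ = ∫ s in (0 : ℝ)..t, meanLop a b φ (s, μ s)
    rw [intervalIntegral.integral_of_le ht.1]
    set K := ∫ s in Ioc 0 t, (coeffSize a b (s, μ s)).toReal with hKdef
    have key : ∀ ε > 0, |(∫ x, φ x ∂(μ t).1 - ∫ x, φ x ∂(μ 0).1) -
        ∫ s in Ioc 0 t, meanLop a b φ (s, μ s)| ≤ ε * (2 + K) := fun ε hε => by
      obtain ⟨i, hi⟩ := hg.2.2 φ hφ ε hε
      have h1 : ∀ m : SP d, |∫ x, g i x ∂m.1 - ∫ x, φ x ∂m.1| ≤ ε := fun m =>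
        m.abs_integral_sub_le (hg.integrable i m) (m.integrable hφ.1.continuous hφ.2) hε.le hi.1
      have h2 : |(∫ s in Ioc 0 t, meanLop a b (g i) (s, μ s)) -
          ∫ s in Ioc 0 t, meanLop a b φ (s, μ s)| ≤ ε * K := by
        rw [← integral_sub ((hint (hg.1 i)).mono_set hsub) ((hint hφ).mono_set hsub),
          ← Real.norm_eq_abs, hKdef, ← integral_const_mul]
        refine norm_integral_le_of_norm_le ((hK.mono_set hsub).const_mul ε) ?_
        filter_upwards [ae_restrict_of_ae_restrict_of_subset hsub hfin] with s hs
        exact abs_meanLop_sub_le hab (hg.1 i) hφ hε.le hi hs.ne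
      have h3 := heq i t ht
      rw [intervalIntegral.integral_of_le ht.1] at h3
      have h4 := abs_le.1 (h1 (μ t))
      have h5 := abs_le.1 (h1 (μ 0))
      have h6 := abs_le.1 h2
      rw [abs_le]
      constructor <;> linarith [h4.1, h4.2, h5.1, h5.2, h6.1, h6.2]
    have hK0 : 0 ≤ K := integral_nonneg fun s => ENNReal.toReal_nonneg
    refine sub_eq_zero.1 (abs_eq_zero.1 (le_antisymm (le_of_forall_pos_le_add fun ε hε => ?_)
      (abs_nonneg _)))
    have := key (ε / (2 + K)) (by positivity)
    rwa [div_mul_cancel₀ _ (by positivity), ← zero_add ε] at this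

/-- A curve in the chart that follows the drift and stays in the image of the chart for almost
every time comes from a solution of the nonlinear equation. -/
lemma isSubprobSolution_inv_of_curve (hT : 0 < T) (hab : GoodCoeffs d a b) (hg : GFamily d g)
    {y : ℝ → ℕ → ℝ} (hy : Continuous y)
    (hrange : ∀ᵐ s ∂(volume.restrict (Ioc 0 T)), y s ∈ range (Gmap g))
    (hsize : ∫⁻ s in Ioc 0 T, coeffSize a b (s, Gmap.inv g (y s)) ≠ ∞)
    (heq : ∀ i, ∀ t ∈ Icc 0 T, y t i - y 0 i =
      ∫ s in (0 : ℝ)..t, meanLop a b (g i) (s, Gmap.inv g (y s))) :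
    IsSubprobSolution d T a b (fun t => Gmap.inv g (y t)) ∧
      ∀ t ∈ Icc 0 T, Gmap g (Gmap.inv g (y t)) = y t := by
  have hG : ∀ t ∈ Icc 0 T, Gmap g (Gmap.inv g (y t)) = y t := fun t ht => by
    obtain ⟨m, hm⟩ := mem_of_ae_mem_Ioc hT hy hg.isClosedEmbedding_Gmap.isClosed_range hrange ht
    rw [← hm, hg.inv_Gmap]
  refine ⟨isSubprobSolution_of_coords hab hg ?_ (hg.measurable_inv.comp hy.measurable) hsize
    fun i t ht => ?_, hG⟩
  · exact hg.isInducing_Gmap.continuousOn_iff.2 (hy.continuousOn.congr hG)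
  · rw [← heq i t ht, ← hG t ht, ← hG 0 ⟨le_rfl, hT.le⟩, hg.inv_Gmap, hg.inv_Gmap]
    rfl

end CurvesOfMeasures

section Concentration

open Set ProbabilityTheory
open scoped NNReal ENNReal

variable {d : ℕ} {T : ℝ} {g : ℕ → Rd d → ℝ} {M : Kernel ℝ (Rd d × SP d)} [IsMarkovKernel M]
  {a : ℝ → SP d → Rd d → Fin d → Fin d → ℝ} {b : ℝ → SP d → Rd d → Fin d → ℝ} {μbar : SP d}

lemma GFamily.measurable_Gmap_snd (hg : GFamily d g) :
    Measurable fun p : Rd d × SP d => Gmap g p.2 :=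
  hg.continuous_Gmap.measurable.comp measurable_snd

/-- In the chart, the measure component of a solution moves with the velocity given by the drift
of the coordinates. -/
lemma IsProdCESolution.isVelocity (hab : GoodCoeffs d a b) (hg : GFamily d g)
    (h : IsProdCESolution d T a b g M) (h0 : (M 0).map Prod.snd = Measure.dirac μbar) (n : ℕ) :
    IsVelocity T (M.map fun p => Gmap g p.2) (fun x (k : Fin n) => x k)
      (fun k => Gmap g μbar k)
      (fun k z => meanLop a b (g k) (z.1, Gmap.inv g z.2)) := by
  intro f hf t ht
  have hG := hg.measurable_Gmap_snd
  have hproj : Continuous fun (x : ℕ → ℝ) (k : Fin n) => x k := by fun_prop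
  have hfp : Continuous fun x : ℕ → ℝ => f fun k : Fin n => x k := hf.1.continuous.comp hproj
  have hpd : ∀ k, Continuous fun x => pd f k x := fun k =>
    (hf.1.continuous_fderiv two_ne_zero).clm_apply continuous_const
  have hinit : ∫ p, Fof g f p.2 ∂(M 0) = f fun k : Fin n => Gmap g μbar k := by
    have hF := (hg.continuous_Fof hf).measurable.stronglyMeasurable
    rw [← integral_map (φ := Prod.snd) (f := Fof g f) measurable_snd.aemeasurable
      hF.aestronglyMeasurable, h0, integral_dirac' _ _ hF]
    rfl
  have hv : Measurable fun z : ℝ × (ℕ → ℝ) =>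
      ∑ k : Fin n, pd f k (fun l : Fin n => z.2 l) * meanLop a b (g k) (z.1, Gmap.inv g z.2) := by
    refine Finset.measurable_sum _ fun k _ => ?_
    exact ((hpd k).comp hproj).measurable.comp measurable_snd |>.mul
      (((hg.1 k).measurable_meanLop hab).comp
        (measurable_fst.prodMk (hg.measurable_inv.comp measurable_snd)))
  rw [← hinit, Kernel.map_apply _ hG, integral_map hG.aemeasurable hfp.aestronglyMeasurable,
    spaceTime, Measure.compProd_map hG, setIntegral_map
      (measurableSet_le measurable_fst measurable_const) hv.aestronglyMeasurable
      (measurable_id.prodMap hG).aemeasurable]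
  refine (h.integral_Fof_sub hab hg hf ht).trans (integral_congr_ae (Eventually.of_forall fun z => ?_))
  simp only [Prod.map, id, hg.inv_Gmap]
  rfl

/-- If the nonlinear equation has a unique subprobability solution, then the measure component of a
solution on the product space is concentrated on it. -/
theorem IsProdCESolution.ae_snd_eq (hT : 0 < T) (hab : GoodCoeffs d a b) (hg : GFamily d g)
    (h : IsProdCESolution d T a b g M) (h0 : (M 0).map Prod.snd = Measure.dirac μbar)
    {μ : ℝ → SP d} (hμ : ContinuousOn μ (Icc 0 T))
    (huniq : ∀ μ' : ℝ → SP d, IsSubprobSolution d T a b μ' → μ' 0 = μbar →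
      ∀ t ∈ Icc (0 : ℝ) T, μ' t = μ t) :
    ∀ᵐ z ∂(spaceTime T M), z.2.2 = μ z.1 := by
  have hG := hg.measurable_Gmap_snd
  set m : Kernel ℝ (ℕ → ℝ) := M.map fun p => Gmap g p.2
  have : IsMarkovKernel m := Kernel.IsMarkovKernel.map M hG
  have hΨ : Measurable (Prod.map id fun p : Rd d × SP d => Gmap g p.2 :
      ℝ × Rd d × SP d → ℝ × (ℕ → ℝ)) := measurable_id.prodMap hG
  have hmap : spaceTime T m = (spaceTime T M).map (Prod.map id fun p => Gmap g p.2) :=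
    Measure.compProd_map hG
  have hinv : Measurable fun z : ℝ × (ℕ → ℝ) => (z.1, Gmap.inv g z.2) :=
    measurable_fst.prodMk (hg.measurable_inv.comp measurable_snd)
  have hvm : ∀ i, Measurable fun z : ℝ × (ℕ → ℝ) => meanLop a b (g i) (z.1, Gmap.inv g z.2) :=
    fun i => ((hg.1 i).measurable_meanLop hab).comp hinv
  have hvi : ∀ i, Integrable (fun z : ℝ × (ℕ → ℝ) => meanLop a b (g i) (z.1, Gmap.inv g z.2))
      (spaceTime T m) := fun i => by
    rw [hmap, integrable_map_measure (hvm i).aestronglyMeasurable hΨ.aemeasurable]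
    simpa [Function.comp_def, hg.inv_Gmap] using h.integrable_meanLop hab (hg.1 i)
  have hcm : Measurable fun z : ℝ × (ℕ → ℝ) => coeffSize a b (z.1, Gmap.inv g z.2) :=
    hab.measurable_coeffSize.comp hinv
  have hS : ∫⁻ z, coeffSize a b (z.1, Gmap.inv g z.2) ∂(spaceTime T m) ≠ ∞ := by
    rw [hmap, lintegral_map hcm hΨ]
    simpa [hg.inv_Gmap] using h.lintegral_coeffSize_ne_top hab
  set S := ∫⁻ z, coeffSize a b (z.1, Gmap.inv g z.2) ∂(spaceTime T m)
  have hR : MeasurableSet (range (Gmap g)) := hg.isClosedEmbedding_Gmap.isClosed_range.measurableSet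
  have hRi : Measurable fun z : ℝ × (ℕ → ℝ) =>
      (range (Gmap g))ᶜ.indicator (fun _ => (∞ : ℝ≥0∞)) z.2 :=
    (measurable_const.indicator hR.compl).comp measurable_snd
  have hRm : ∫⁻ z, (range (Gmap g))ᶜ.indicator (fun _ => ∞) z.2 ∂(spaceTime T m) = 0 := by
    rw [hmap, lintegral_map hRi hΨ]
    simp
  let A : Set (ℝ × (ℕ → ℝ)) := {z | z.2 = Gmap g (μ (projIcc 0 T hT.le z.1))}
  have hA : MeasurableSet A := measurableSet_eq_fun measurable_snd
    ((hg.continuous_Gmap.comp (hμ.comp_projIcc hT.le)).measurable.comp measurable_fst)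
  have hmass : ENNReal.ofReal T ≤ spaceTime T m A := by
    refine ENNReal.le_of_forall_pos_le_add fun ε hε _ => ?_
    obtain ⟨c, hc, hcS⟩ := ENNReal.exists_nnreal_pos_mul_lt hS
      (b := ENNReal.ofReal (ε / 2)) (by simpa using hε)
    let f : ℝ × (ℕ → ℝ) → ℝ≥0∞ := fun z => (range (Gmap g))ᶜ.indicator (fun _ => ∞) z.2 +
      (c * coeffSize a b (z.1, Gmap.inv g z.2) + A.indicator 1 z)
    have hfm : Measurable f :=
      hRi.add ((hcm.const_mul _).add (measurable_one.indicator hA))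
    have hfint : ∫⁻ z, f z ∂(spaceTime T m) = c * S + spaceTime T m A := by
      rw [lintegral_add_left hRi, hRm, zero_add, lintegral_add_left (hcm.const_mul _),
        lintegral_const_mul _ hcm, lintegral_indicator_one hA]
    have hfin : ∫⁻ z, f z ∂(spaceTime T m) ≠ ∞ := by
      rw [hfint]
      exact ENNReal.add_ne_top.2 ⟨ENNReal.mul_ne_top ENNReal.coe_ne_top hS, measure_ne_top _ _⟩
    obtain ⟨y, hyc, hy0, -, hyeq, hyf⟩ := exists_curve hT hvm hvi
      (fun n => h.isVelocity hab hg h0 n) hfm hfin (half_pos (NNReal.coe_pos.2 hε))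
    have hyp : Measurable fun s => (s, y s) := measurable_id.prodMk hyc.measurable
    have hyfin : ∫⁻ s in Ioc 0 T, f (s, y s) ≠ ∞ :=
      (hyf.trans_lt (ENNReal.add_lt_top.2 ⟨hfin.lt_top, ENNReal.ofReal_lt_top⟩)).ne
    have hrange : ∀ᵐ s ∂(volume.restrict (Ioc 0 T)), y s ∈ range (Gmap g) := by
      filter_upwards [ae_lt_top (hfm.comp hyp) hyfin] with s hs
      by_contra hn
      simp [f, indicator_of_mem (mem_compl hn)] at hs
    have hsize : ∫⁻ s in Ioc 0 T, coeffSize a b (s, Gmap.inv g (y s)) ≠ ∞ := by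
      have h1 : ∫⁻ s in Ioc 0 T, c * coeffSize a b (s, Gmap.inv g (y s)) < ∞ :=
        (lintegral_mono fun s => le_add_left (le_add_right le_rfl)).trans_lt hyfin.lt_top
      rw [lintegral_const_mul' _ _ ENNReal.coe_ne_top] at h1
      exact (ENNReal.lt_top_of_mul_ne_top_right h1.ne (by simpa using hc.ne')).ne
    obtain ⟨hsol, hGy⟩ := isSubprobSolution_inv_of_curve hT hab hg hyc hrange hsize
      (fun i t ht => by rw [hy0]; exact hyeq i t ht)
    have hμy := huniq _ hsol (by rw [hy0, hg.inv_Gmap])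
    have hT1 : ENNReal.ofReal T ≤ ∫⁻ s in Ioc 0 T, f (s, y s) := by
      calc ENNReal.ofReal T = ∫⁻ s in Ioc 0 T, 1 := by simp
        _ ≤ _ := setLIntegral_mono (hfm.comp hyp) fun s hs => by
          have hs' := Ioc_subset_Icc_self hs
          have hsA : (s, y s) ∈ A := by
            change y s = Gmap g (μ (projIcc 0 T hT.le s))
            rw [projIcc_coe_of_mem hT.le hs', ← hμy s hs', hGy s hs']
          refine le_add_left (le_add_left ?_)
          rw [indicator_of_mem hsA]
          rfl
    calc ENNReal.ofReal T ≤ c * S + spaceTime T m A + ENNReal.ofReal (ε / 2) := by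
          rw [← hfint]; exact hT1.trans hyf
      _ ≤ ENNReal.ofReal (ε / 2) + spaceTime T m A + ENNReal.ofReal (ε / 2) := by gcongr
      _ = spaceTime T m A + (ENNReal.ofReal (ε / 2) + ENNReal.ofReal (ε / 2)) := by ring
      _ = spaceTime T m A + ε := by
          rw [← ENNReal.ofReal_add (by positivity) (by positivity), add_halves,
            ENNReal.ofReal_coe_nnreal]
  have huniv : spaceTime T m univ = ENNReal.ofReal T := by
    rw [spaceTime, Measure.compProd_apply_univ]
    simp
  have hae : ∀ᵐ z ∂(spaceTime T m), z ∈ A :=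
    (ae_iff_measure_eq hA.nullMeasurableSet).2
      (le_antisymm (measure_mono (subset_univ _)) (huniv.trans_le hmass))
  rw [hmap] at hae
  filter_upwards [ae_of_ae_map hΨ.aemeasurable hae, spaceTime_ae_mem T M] with z hz hzT
  have hzμ : z.2.2 = μ (projIcc 0 T hT.le z.1) := hg.injective_Gmap hz
  rwa [projIcc_coe_of_mem hT.le (Ioc_subset_Icc_self hzT)] at hzμ

end Concentration

section ProductForm

open Set ProbabilityTheory
open scoped NNReal ENNReal BoundedContinuousFunction

variable {d : ℕ} {T : ℝ} {g : ℕ → Rd d → ℝ} {M : Kernel ℝ (Rd d × SP d)} [IsMarkovKernel M]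
  {a : ℝ → SP d → Rd d → Fin d → Fin d → ℝ} {b : ℝ → SP d → Rd d → Fin d → ℝ} {μ : ℝ → SP d}

/-- A solution concentrated on the graph of `μ` for almost every time has measure component
`δ_{μ_t}` for every time. -/
lemma IsProdCESolution.map_snd_eq_dirac (hT : 0 < T) (hg : GFamily d g)
    (h : IsProdCESolution d T a b g M) (hμ : ContinuousOn μ (Icc 0 T))
    (hae : ∀ᵐ z ∂(spaceTime T M), z.2.2 = μ z.1) {t : ℝ} (ht : t ∈ Icc 0 T) :
    (M t).map Prod.snd = Measure.dirac (μ t) := by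
  have := hg.metrizableSpace
  have : IsProbabilityMeasure ((M t).map Prod.snd) :=
    Measure.isProbabilityMeasure_map measurable_snd.aemeasurable
  refine ext_of_forall_integral_eq_of_IsFiniteMeasure fun F => ?_
  have hF := F.continuous.measurable.stronglyMeasurable
  rw [integral_dirac' _ _ hF, integral_map measurable_snd.aemeasurable hF.aestronglyMeasurable]
  have hc : ContinuousOn (fun s => ∫ p, F p.2 ∂(M s) - F (μ s)) (Icc 0 T) :=
    (h.2.1 (fun p => F p.2) (F.continuous.comp continuous_snd)
      ⟨‖F‖, fun p => F.norm_coe_le_norm p.2⟩).sub (F.continuous.comp_continuousOn hμ)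
  have key := mem_of_ae_mem_Ioc hT (hc.comp_projIcc hT.le) (isClosed_singleton (x := (0 : ℝ))) (by
    filter_upwards [Measure.ae_ae_of_ae_compProd hae, ae_restrict_mem measurableSet_Ioc]
      with s hs hsT
    rw [mem_singleton_iff, projIcc_coe_of_mem hT.le (Ioc_subset_Icc_self hsT),
      integral_congr_ae (g := fun _ => F (μ s)) (hs.mono fun p hp => congrArg F hp)]
    simp) ht
  rw [mem_singleton_iff, projIcc_coe_of_mem hT.le ht] at key
  exact sub_eq_zero.1 key

lemma GFamily.ae_snd_eq_of_map_eq_dirac (hg : GFamily d g) {ρ : Measure (Rd d × SP d)} {m : SP d}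
    (h : ρ.map Prod.snd = Measure.dirac m) : ∀ᵐ p ∂ρ, p.2 = m := by
  have := hg.metrizableSpace
  refine ae_of_ae_map (p := fun q => q = m) measurable_snd.aemeasurable ?_
  rw [h]
  exact (ae_dirac_iff (measurableSet_singleton m)).2 rfl

lemma eq_map_fst_prod_dirac {ρ : Measure (Rd d × SP d)} [SFinite ρ] {m : SP d}
    (h : ∀ᵐ p ∂ρ, p.2 = m) : ρ = (ρ.map Prod.fst).prod (Measure.dirac m) := by
  have hm : Measurable fun x : Rd d => (x, m) := by fun_prop
  rw [Measure.prod_dirac, Measure.map_map hm measurable_fst]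
  conv_lhs => rw [← Measure.map_id (μ := ρ)]
  exact Measure.map_congr (h.mono fun p hp => Prod.ext rfl hp)

/-- The space marginal of a kernel on the product space. -/
def spaceMarginal (M : Kernel ℝ (Rd d × SP d)) [IsMarkovKernel M] (t : ℝ) : SP d :=
  ⟨(M t).map Prod.fst, by
    rw [Measure.map_apply measurable_fst MeasurableSet.univ]; exact prob_le_one⟩

lemma integral_spaceMarginal {f : Rd d → ℝ} (hf : Measurable f) (t : ℝ) :
    ∫ x, f x ∂(spaceMarginal M t).1 = ∫ p, f p.1 ∂(M t) :=
  integral_map measurable_fst.aemeasurable hf.aestronglyMeasurable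

lemma lintegral_spaceMarginal {f : Rd d → ℝ≥0∞} (hf : Measurable f) (t : ℝ) :
    ∫⁻ x, f x ∂(spaceMarginal M t).1 = ∫⁻ p, f p.1 ∂(M t) :=
  lintegral_map hf measurable_fst

lemma isC2b_one (n : ℕ) : IsC2b fun _ : Fin n → ℝ => (1 : ℝ) :=
  ⟨contDiff_const, 1, fun x => by simp [pd, pd2]⟩

/-- The space marginal of a solution concentrated on the graph of `μ` solves the linear equation
along `μ`. -/
theorem IsProdCESolution.isLinearizedSolution (hab : GoodCoeffs d a b)
    (h : IsProdCESolution d T a b g M) (hae : ∀ t ∈ Icc 0 T, ∀ᵐ p ∂(M t), p.2 = μ t) :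
    IsLinearizedSolution d T a b μ (spaceMarginal M) := by
  refine ⟨fun t ht => ?_, fun f hf ⟨C, hC⟩ => ?_, fun i j => ?_, fun φ hφ t ht => ?_⟩
  · change (M t).map Prod.fst univ = 1
    rw [Measure.map_apply measurable_fst MeasurableSet.univ]
    exact measure_univ
  · simp_rw [integral_spaceMarginal hf.measurable]
    exact h.2.1 (fun p => f p.1) (hf.comp continuous_fst) ⟨C, fun p => hC p.1⟩
  · refine (setLIntegral_mono' measurableSet_Ioc fun t ht => ?_).trans_lt h.2.2.1
    have hm : Measurable fun x => ENNReal.ofReal (|a t (μ t) x i j| + |b t (μ t) x i|) :=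
      ENNReal.measurable_ofReal.comp ((measurable_abs.comp ((hab.1 i j).comp
        (f := fun x : Rd d => (t, μ t, x)) (by fun_prop))).add (measurable_abs.comp
          ((hab.2.1 i).comp (f := fun x : Rd d => (t, μ t, x)) (by fun_prop))))
    rw [lintegral_spaceMarginal hm]
    refine lintegral_mono_ae ((hae t (Ioc_subset_Icc_self ht)).mono fun p hp => ?_)
    rw [hp]
    refine ENNReal.ofReal_le_ofReal ?_
    exact (Finset.single_le_sum (f := fun j => |a t (μ t) p.1 i j| + |b t (μ t) p.1 i|)
      (fun _ _ => by positivity) (Finset.mem_univ j)).trans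
      (Finset.single_le_sum (f := fun i => ∑ j, (|a t (μ t) p.1 i j| + |b t (μ t) p.1 i|))
        (fun _ _ => Finset.sum_nonneg fun _ _ => by positivity) (Finset.mem_univ i))
  · have heq := h.2.2.2.2 φ hφ 0 _ (isC2b_one 0) t ht
    simp only [Fof, bL, Finset.univ_eq_empty, Finset.sum_empty, mul_one, one_mul, mul_zero,
      add_zero] at heq
    rw [integral_spaceMarginal hφ.1.continuous.measurable,
      integral_spaceMarginal hφ.1.continuous.measurable, heq]
    refine intervalIntegral.integral_congr fun s hs => ?_
    rw [uIcc_of_le ht.1] at hs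
    refine Eq.trans ?_ (integral_spaceMarginal ((hφ.measurable_Lop hab).comp
      (f := fun x : Rd d => (s, μ s, x)) (by fun_prop)) s).symm
    refine integral_congr_ae ((hae s ⟨hs.1, hs.2.trans ht.2⟩).mono fun p hp => ?_)
    beta_reduce
    rw [hp]
    rfl

end ProductForm

/-- Proposition 3.10: if `(μ_t, ν_t)` is the unique solution of the
coupled system (9) with initial condition `(μ̄, ν̄) ∈ P × P`, and `(μ_t)` is the unique
subprobability solution to (NLFPK) starting at `μ̄`, then `(ν_t × δ_{μ_t})` is the unique
weakly continuous solution to (10) with initial condition `ν̄ × δ_{μ̄}`. -/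
theorem coupled_system_product_uniqueness (d : ℕ) (T : ℝ) (hT : 0 < T)
    (a : ℝ → SP d → Rd d → Fin d → Fin d → ℝ) (b : ℝ → SP d → Rd d → Fin d → ℝ)
    (hab : GoodCoeffs d a b) (g : ℕ → Rd d → ℝ) (hg : GFamily d g)
    (μbar νbar : SP d) (hμbar : μbar.1 Set.univ = 1) (hνbar : νbar.1 Set.univ = 1)
    (μ ν : ℝ → SP d)
    (hsol : IsCoupledSolution d T a b μbar νbar μ ν)
    (huniq : ∀ μ' ν' : ℝ → SP d, IsCoupledSolution d T a b μbar νbar μ' ν' →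
      ∀ t ∈ Set.Icc (0:ℝ) T, μ' t = μ t ∧ ν' t = ν t)
    (hNLuniq : ∀ μ' : ℝ → SP d, IsSubprobSolution d T a b μ' → μ' 0 = μbar →
      ∀ t ∈ Set.Icc (0:ℝ) T, μ' t = μ t) :
    IsProdCESolution d T a b g (fun t => ((ν t).1).prod (Measure.dirac (μ t))) ∧
    ((ν 0).1).prod (Measure.dirac (μ 0)) = (νbar.1).prod (Measure.dirac μbar) ∧
    ∀ Λ' : ℝ → Measure (Rd d × SP d), IsProdCESolution d T a b g Λ' →
      Λ' 0 = (νbar.1).prod (Measure.dirac μbar) →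
      ∀ t ∈ Set.Icc (0:ℝ) T, Λ' t = ((ν t).1).prod (Measure.dirac (μ t)) := by
  obtain ⟨hμ, hμ0, hν, hν0⟩ := hsol
  refine ⟨isProdCESolution_prod_dirac hT.le hab hg hμ hν, by rw [hμ0, hν0],
    fun Λ' hΛ hΛ0 t ht => ?_⟩
  obtain ⟨M, hMp, hM, hMsol⟩ := hΛ.exists_kernel hT.le hg
  have : IsProbabilityMeasure νbar.1 := ⟨hνbar⟩
  have hM0 : M 0 = νbar.1.prod (Measure.dirac μbar) := (hM 0 ⟨le_rfl, hT.le⟩).trans hΛ0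
  have hsnd : (M 0).map Prod.snd = Measure.dirac μbar := by
    rw [hM0]
    exact Measure.snd_prod
  have hfst : spaceMarginal M 0 = νbar := Subtype.ext <| by
    change (M 0).map Prod.fst = νbar.1
    rw [hM0]
    exact Measure.fst_prod
  have hae := hMsol.ae_snd_eq hT hab hg hsnd hμ.1.1 hNLuniq
  have hgraph : ∀ t ∈ Set.Icc 0 T, ∀ᵐ p ∂(M t), p.2 = μ t := fun t ht =>
    hg.ae_snd_eq_of_map_eq_dirac (hMsol.map_snd_eq_dirac hT hg hμ.1.1 hae ht)
  have hνM := (huniq μ (spaceMarginal M)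
    ⟨hμ, hμ0, hMsol.isLinearizedSolution hab hgraph, hfst⟩ t ht).2
  rw [← hM t ht, ← hνM]
  exact eq_map_fst_prod_dirac (hgraph t ht)
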